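/- Let n ≥ 0 be an integer and J = n + 1. For every (b,λ) in the real QES spectral locus Z_{n+1}^{QES}(ℝ), the associated polynomial p has degree n and exactly n distinct zeros, and the number of its real zeros equals n − 2m for some integer m with 0 ≤ m ≤ n/2. Letting Γ_{n,m} denote the set of (b,λ) ∈ Z_{n+1}^{QES}(ℝ) whose polynomial p has exactly n − 2m real zeros, the sets Γ_{n,m} for 0 ≤ m ≤ ⌊n/2⌋ are pairwise disjoint, each Γ_{n,m} is nonempty and is the image of an injective continuous proper map from ℝ to ℝ², and Z_{n+1}^{QES}(ℝ) is the union of the Γ_{n,m}, 0 ≤ m ≤ ⌊n/2⌋. -/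

import Mathlib

open Complex Filter Polynomial

/-- The quasi-exactly solvable candidate eigenfunction `p(z) exp(z³/3 - b z)`. -/
noncomputable def qesFun (b : ℂ) (p : Polynomial ℂ) : ℂ → ℂ :=
  fun z => p.eval z * Complex.exp (z ^ 3 / 3 - b * z)

/-- `y` satisfies the quartic ODE `-y'' + (z⁴ - 2 b z² + 2 J z) y = λ y`. -/
def SatisfiesQuarticODE (J b lam : ℂ) (y : ℂ → ℂ) : Prop :=
  ∀ z : ℂ,
    -(deriv (deriv y) z) + (z ^ 4 - 2 * b * z ^ 2 + 2 * J * z) * y z = lam * y z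

/-- `y` is an eigenfunction of `L_J(b)` with eigenvalue `λ`:
an entire function, not identically zero, satisfying the ODE and tending to `0`
along the rays `arg z = ±π/3`. -/
def IsQuarticEigenfunction (J b lam : ℂ) (y : ℂ → ℂ) : Prop :=
  Differentiable ℂ y ∧ y ≠ 0 ∧ SatisfiesQuarticODE J b lam y ∧
  Tendsto (fun r : ℝ => y (r * Complex.exp (Complex.I * (Real.pi / 3))))
    atTop (nhds 0) ∧
  Tendsto (fun r : ℝ => y (r * Complex.exp (-Complex.I * (Real.pi / 3))))
    atTop (nhds 0)

/-- `λ` is an eigenvalue of `L_J(b)`. -/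
def IsQuarticEigenvalue (J b lam : ℂ) : Prop :=
  ∃ y : ℂ → ℂ, IsQuarticEigenfunction J b lam y

/-- `p` witnesses that `(b, λ)` lies in the QES spectral locus of `L_J`. -/
def QESWitness (J b lam : ℂ) (p : Polynomial ℂ) : Prop :=
  p ≠ 0 ∧ SatisfiesQuarticODE J b lam (qesFun b p)

/-- The quasi-exactly solvable part of the spectral locus of `L_J`. -/
def qesSpectralLocus (J : ℂ) : Set (ℂ × ℂ) :=
  {q : ℂ × ℂ | ∃ p : Polynomial ℂ, QESWitness J q.1 q.2 p}

/-- The real QES spectral locus of `L_J`. -/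
def qesRealLocus (J : ℂ) : Set (ℝ × ℝ) :=
  {q : ℝ × ℝ | ((q.1 : ℂ), (q.2 : ℂ)) ∈ qesSpectralLocus J}

/-- `Γ_{n,m}`: points of the real QES spectral locus of `L_{n+1}` whose
polynomial has exactly `n - 2m` (distinct) real zeros. -/
def qesGamma (n m : ℕ) : Set (ℝ × ℝ) :=
  {q : ℝ × ℝ | ∃ p : Polynomial ℂ, QESWitness ((n : ℂ) + 1) q.1 q.2 p ∧
    {z : ℂ | p.eval z = 0 ∧ z.im = 0}.ncard = n - 2 * m}

namespace QES

noncomputable def ph (n : ℕ) (e b m : ℝ) : ℕ → ℝ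
  | 0 => 0
  | 1 => 0
  | 2 => 1
  | (k+3) => (m * ph n e b m (k+2) - 2*b*ph n e b m (k+1) + e * ph n e b m k) / (2*((k:ℝ)+1)*((n:ℝ)-k))

noncomputable def qq (n : ℕ) (e b m : ℝ) : ℝ :=
  m * ph n e b m (n+2) - 2*b*ph n e b m (n+1) + e * ph n e b m n

lemma ph_rec (n : ℕ) (e b m : ℝ) (k : ℕ) (hk : k ≠ n) :
    2*((k:ℝ)+1)*((n:ℝ)-k) * ph n e b m (k+3) =
      m * ph n e b m (k+2) - 2*b*ph n e b m (k+1) + e * ph n e b m k := by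
  have h1 : (n:ℝ) - k ≠ 0 := sub_ne_zero.2 (by exact_mod_cast hk.symm)
  have h2 : (k:ℝ)+1 ≠ 0 := by positivity
  rw [ph]; field_simp

lemma ph_n (n : ℕ) (e b m : ℝ) : ph n e b m (n+3) = 0 := by
  rw [ph]; simp

lemma strong3 {p : ℕ → Prop} (h0 : p 0) (h1 : p 1) (h2 : p 2)
    (h : ∀ k, p k → p (k+1) → p (k+2) → p (k+3)) (k : ℕ) : p k := by
  have : p k ∧ p (k+1) ∧ p (k+2) := by
    induction k with
    | zero => exact ⟨h0, h1, h2⟩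
    | succ k ih => exact ⟨ih.2.1, ih.2.2, h k ih.1 ih.2.1 ih.2.2⟩
  exact this.1

lemma ph_scale (n : ℕ) (s e b m : ℝ) (k : ℕ) :
    s^2 * ph n (s^3*e) (s^2*b) (s*m) k = s^k * ph n e b m k := by
  induction k using strong3 with
  | h0 => simp [ph]
  | h1 => simp [ph]
  | h2 => simp [ph]
  | h k h0 h1 h2 =>
    rw [ph, ph]
    have : s^2*(s * m * ph n (s ^ 3 * e) (s ^ 2 * b) (s * m) (k + 2) -
      2 * (s ^ 2 * b) * ph n (s ^ 3 * e) (s ^ 2 * b) (s * m) (k + 1) +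
      s ^ 3 * e * ph n (s ^ 3 * e) (s ^ 2 * b) (s * m) k) =
      s^(k+3) * (m * ph n e b m (k+2) - 2*b*ph n e b m (k+1) + e * ph n e b m k) := by
      linear_combination s*m*h2 - 2*s^2*b*h1 + s^3*e*h0
    rw [← mul_div_assoc, this, mul_div_assoc]

lemma qq_scale (n : ℕ) (s e b m : ℝ) :
    s^2 * qq n (s^3*e) (s^2*b) (s*m) = s^(n+3) * qq n e b m := by
  unfold qq
  have h0 := ph_scale n s e b m n
  have h1 := ph_scale n s e b m (n+1)
  have h2 := ph_scale n s e b m (n+2)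
  linear_combination s*m*h2 - 2*s^2*b*h1 + s^3*e*h0

lemma qq_bound (n : ℕ) (e b m : ℝ) (he : |e| ≤ 1) (h : qq n e b m = 0) :
    |m| < 2*|b| + 1 + 2*((n:ℝ)+1)^2 := by
  by_contra hm
  push Not at hm
  have tri : ∀ x y z : ℝ, |x| ≤ |y| → |y| ≤ |z| →
      2*((n:ℝ)+1)^2 * |z| ≤ |m*z - 2*b*y + e*x| := by
    intro x y z hxy hyz
    have h1 : |m*z| ≤ |m*z - 2*b*y + e*x| + |2*b*y| + |e*x| := by
      have e1 : m*z = (m*z - 2*b*y + e*x) + 2*b*y - e*x := by ring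
      calc |m*z| = |(m*z - 2*b*y + e*x) + 2*b*y - e*x| := by rw [← e1]
        _ ≤ |(m*z - 2*b*y + e*x) + 2*b*y| + |e*x| := abs_sub _ _
        _ ≤ _ := by gcongr; exact abs_add_le _ _
    rw [abs_mul, abs_mul, abs_mul, abs_mul] at h1
    have h2 : |e| * |x| ≤ 1 * |z| := mul_le_mul he (hxy.trans hyz) (abs_nonneg _) zero_le_one
    have h3 : |(2:ℝ)| * |b| * |y| ≤ 2 * |b| * |z| := by rw [abs_two]; gcongr
    have h4 : (2*|b| + 1 + 2*((n:ℝ)+1)^2) * |z| ≤ |m| * |z| := by gcongr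
    nlinarith
  have key : ∀ k, k ≤ n → |ph n e b m k| ≤ |ph n e b m (k+1)| ∧
      |ph n e b m (k+1)| ≤ |ph n e b m (k+2)| ∧ 1 ≤ |ph n e b m (k+2)| := by
    intro k
    induction k with
    | zero => intro _; simp [ph]
    | succ k ih =>
      intro hk
      obtain ⟨i1, i2, i3⟩ := ih (by omega)
      have hr := ph_rec n e b m k (by omega)
      have t := tri _ _ _ i1 i2
      rw [← hr, abs_mul] at t
      have hkn : (k:ℝ)+1 ≤ n := by exact_mod_cast hk
      have h5 : |2*((k:ℝ)+1)*((n:ℝ)-k)| ≤ 2*((n:ℝ)+1)^2 := by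
        rw [abs_of_nonneg (mul_nonneg (by positivity) (by linarith))]
        nlinarith [Nat.cast_nonneg (α := ℝ) k]
      have h6 : |ph n e b m (k+2)| ≤ |ph n e b m (k+3)| := by
        have : 2*((n:ℝ)+1)^2 * |ph n e b m (k+2)| ≤ 2*((n:ℝ)+1)^2 * |ph n e b m (k+3)| :=
          t.trans (by gcongr)
        exact le_of_mul_le_mul_left this (by positivity)
      exact ⟨i2, h6, i3.trans h6⟩
  obtain ⟨i1, i2, i3⟩ := key n le_rfl
  have t := tri _ _ _ i1 i2
  have : |m * ph n e b m (n+2) - 2*b*ph n e b m (n+1) + e * ph n e b m n| = 0 := by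
    rw [abs_eq_zero]; exact h
  rw [this] at t
  have : 0 < 2*((n:ℝ)+1)^2 * |ph n e b m (n+2)| := by positivity
  linarith

lemma ph_cont (n k : ℕ) : Continuous (fun v : ℝ × ℝ × ℝ => ph n v.1 v.2.1 v.2.2 k) := by
  induction k using strong3 with
  | h0 => simp only [ph]; fun_prop
  | h1 => simp only [ph]; fun_prop
  | h2 => simp only [ph]; fun_prop
  | h k h0 h1 h2 => simp only [ph]; fun_prop

lemma ph_contDiff (n k : ℕ) : ContDiff ℝ ⊤ (fun v : ℝ × ℝ × ℝ => ph n v.1 v.2.1 v.2.2 k) := by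
  induction k using strong3 with
  | h0 => simp only [ph]; fun_prop
  | h1 => simp only [ph]; fun_prop
  | h2 => simp only [ph]; fun_prop
  | h k h0 h1 h2 => simp only [ph]; fun_prop

lemma qq_cont (n : ℕ) : Continuous (fun v : ℝ × ℝ × ℝ => qq n v.1 v.2.1 v.2.2) := by
  unfold qq
  have h0 := ph_cont n n
  have h1 := ph_cont n (n+1)
  have h2 := ph_cont n (n+2)
  fun_prop

/-- coefficient recursion of the operator -/
def CoefRec (n : ℕ) (e b m : ℂ) (c : ℕ → ℂ) : Prop :=
  (2*e*c 2 - 2*b*c 1 + m*c 0 = 0) ∧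
  ∀ k : ℕ, e*(k+3)*(k+2)*c (k+3) - 2*b*(k+2)*c (k+2) + m*c (k+1) + 2*(k-n)*c k = 0

noncomputable def Lop (n : ℕ) (e b m : ℂ) (p : ℂ[X]) : ℂ[X] :=
  C e * derivative (derivative p) + 2*(X^2 - C b)*derivative p - 2*(n:ℂ[X])*X*p + C m*p

lemma Lop_coeff_zero (n : ℕ) (e b m : ℂ) (p : ℂ[X]) :
    (Lop n e b m p).coeff 0 = 2*e*p.coeff 2 - 2*b*p.coeff 1 + m*p.coeff 0 := by
  have : Lop n e b m p = C e * derivative (derivative p) + C 2 * (derivative p * X^2)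
    - C (2*b) *derivative p - C (2*(n:ℂ)) * (p * X) + C m*p := by
    unfold Lop; simp only [C_mul, map_natCast, C_ofNat]; ring
  rw [this]
  simp only [coeff_add, coeff_sub, coeff_C_mul, coeff_mul_X_zero, coeff_derivative, coeff_mul_X_pow']
  norm_num; ring

lemma Lop_coeff_succ (n : ℕ) (e b m : ℂ) (p : ℂ[X]) (k : ℕ) :
    (Lop n e b m p).coeff (k+1) =
      e*(k+3)*(k+2)*p.coeff (k+3) - 2*b*(k+2)*p.coeff (k+2) + m*p.coeff (k+1) + 2*(k-n)*p.coeff k := by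
  have : Lop n e b m p = C e * derivative (derivative p) + C 2 * (derivative p * X *X)
    - C (2*b) *derivative p - C (2*(n:ℂ)) * (p * X) + C m*p := by
    unfold Lop; simp only [C_mul, map_natCast, C_ofNat]; ring
  rw [this]
  simp only [coeff_add, coeff_sub, coeff_C_mul, coeff_mul_X, coeff_derivative]
  cases k with
  | zero => simp; ring
  | succ k => simp only [coeff_mul_X, coeff_derivative]; push_cast; ring

lemma Lop_zero_iff (n : ℕ) (e b m : ℂ) (p : ℂ[X]) :
    Lop n e b m p = 0 ↔ CoefRec n e b m p.coeff := by
  constructor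
  · intro h
    refine ⟨?_, fun k => ?_⟩
    · rw [← Lop_coeff_zero n, h]; simp
    · rw [← Lop_coeff_succ, h]; simp
  · rintro ⟨h0, h1⟩
    ext k
    cases k with
    | zero => rw [Lop_coeff_zero, h0]; simp
    | succ k => rw [Lop_coeff_succ, h1]; simp

noncomputable def PR (n : ℕ) (e b m : ℝ) : ℝ[X] :=
  ∑ k ∈ Finset.range (n+1), C ((n.factorial : ℝ)/(k.factorial) * ph n e b m (n+2-k)) * X^k

noncomputable def PC (n : ℕ) (e b m : ℝ) : ℂ[X] := (PR n e b m).map ofRealHom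

lemma PR_coeff (n : ℕ) (e b m : ℝ) (k j : ℕ) (h : k + j = n + 2) :
    (PR n e b m).coeff k * k.factorial = n.factorial * ph n e b m j := by
  have hk : (k.factorial : ℝ) ≠ 0 := by positivity
  unfold PR
  simp only [finsetSum_coeff, coeff_C_mul_X_pow]
  rw [Finset.sum_ite_eq]
  split_ifs with hh
  · rw [show n+2-k = j by omega]; field_simp
  · simp only [Finset.mem_range, not_lt] at hh
    have : j = 0 ∨ j = 1 := by omega
    rcases this with rfl | rfl <;> simp [ph]

lemma PR_coeff_large (n : ℕ) (e b m : ℝ) (k : ℕ) (h : n < k) :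
    (PR n e b m).coeff k = 0 := by
  unfold PR
  simp only [finsetSum_coeff, coeff_C_mul_X_pow]
  rw [Finset.sum_ite_eq, if_neg]
  simpa using h

lemma PR_coeff_n (n : ℕ) (e b m : ℝ) : (PR n e b m).coeff n = 1 := by
  have := PR_coeff n e b m n 2 rfl
  have hk : (n.factorial : ℝ) ≠ 0 := by positivity
  simp [ph] at this
  simpa [hk] using this

lemma PR_natDegree (n : ℕ) (e b m : ℝ) : (PR n e b m).natDegree = n := by
  apply le_antisymm
  · rw [natDegree_le_iff_coeff_eq_zero]
    exact fun k hk => PR_coeff_large n e b m k hk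
  · apply le_natDegree_of_ne_zero
    rw [PR_coeff_n]; simp

lemma PR_monic (n : ℕ) (e b m : ℝ) : (PR n e b m).Monic := by
  rw [Monic, leadingCoeff, PR_natDegree, PR_coeff_n]

lemma PC_monic (n : ℕ) (e b m : ℝ) : (PC n e b m).Monic := (PR_monic n e b m).map _

lemma PC_natDegree (n : ℕ) (e b m : ℝ) : (PC n e b m).natDegree = n := by
  rw [PC, natDegree_map, PR_natDegree]

lemma PC_coeff (n : ℕ) (e b m : ℝ) (k : ℕ) :
    (PC n e b m).coeff k = ((PR n e b m).coeff k : ℝ) := by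
  rw [PC, coeff_map]; rfl

lemma PC_coeff' (n : ℕ) (e b m : ℝ) (k j : ℕ) (h : k + j = n + 2) :
    (PC n e b m).coeff k * k.factorial = n.factorial * (ph n e b m j : ℂ) := by
  rw [PC_coeff]; exact_mod_cast PR_coeff n e b m k j h

lemma fact_aux (k : ℕ) : ((k+1).factorial : ℂ) = (k+1) * k.factorial := by
  rw [Nat.factorial_succ]; push_cast; ring

lemma PC_Lop (n : ℕ) (e b m : ℝ) (h : qq n e b m = 0) : Lop n e b m (PC n e b m) = 0 := by
  rw [Lop_zero_iff]
  constructor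
  · have h0 := PC_coeff' n e b m 0 (n+2) (by omega)
    have h1 := PC_coeff' n e b m 1 (n+1) (by omega)
    have h2 := PC_coeff' n e b m 2 n (by omega)
    simp [Nat.factorial] at h0 h1 h2
    have hq : (m:ℂ) * ph n e b m (n+2) - 2*b*ph n e b m (n+1) + e * ph n e b m n = 0 := by
      exact_mod_cast h
    linear_combination e * h2 - 2*b*h1+m*h0 + (n.factorial:ℂ) * hq
  · intro k
    by_cases hk : n < k
    · simp only [PC_coeff]
      rw [PR_coeff_large _ _ _ _ k hk, PR_coeff_large _ _ _ _ (k+1) (by omega),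
        PR_coeff_large _ _ _ _ (k+2) (by omega), PR_coeff_large _ _ _ _ (k+3) (by omega)]
      simp
    rcases Nat.lt_or_ge k n with hk' | hk'
    · obtain ⟨j, hj⟩ : ∃ j, k + j + 1 = n := ⟨n-k-1, by omega⟩
      have h0 := PC_coeff' n e b m k (j+3) (by omega)
      have h1 := PC_coeff' n e b m (k+1) (j+2) (by omega)
      have h2 := PC_coeff' n e b m (k+2) (j+1) (by omega)
      have h3 := PC_coeff' n e b m (k+3) j (by omega)
      have hr : 2*((j:ℂ)+1)*((n:ℂ)-j) * ph n e b m (j+3) =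
        m * ph n e b m (j+2) - 2*b*ph n e b m (j+1) + e * ph n e b m j := by
        exact_mod_cast ph_rec n e b m j (by omega)
      have f1 := fact_aux k
      have f2 := fact_aux (k+1)
      have f3 := fact_aux (k+2)
      push_cast at f1 f2 f3
      have hkf : ((k+1).factorial : ℂ) ≠ 0 := Nat.cast_ne_zero.2 (Nat.factorial_ne_zero _)
      apply mul_right_cancel₀ hkf
      rw [f3] at h3
      rw [f2] at h2 h3
      have hn : (n:ℂ) = k + j + 1 := by rw [← hj]; push_cast; ring
      rw [hn] at hr ⊢
      rw [f1] at h1 h2 h3 ⊢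
      linear_combination e * h3 - 2*b*h2+m*h1 - 2*(j+1)*(k+1)*h0 - (n.factorial:ℂ) * hr
    · have : k = n := by omega
      subst this
      simp only [PC_coeff]
      rw [PR_coeff_large _ _ _ _ (k+1) (by omega),
        PR_coeff_large _ _ _ _ (k+2) (by omega), PR_coeff_large _ _ _ _ (k+3) (by omega)]
      simp

lemma Lop_unique (n : ℕ) (e b m : ℝ) (p : ℂ[X]) (hp : p ≠ 0) (h : Lop n e b m p = 0) :
    p.natDegree = n ∧ qq n e b m = 0 ∧ p = C p.leadingCoeff * PC n e b m := by
  rw [Lop_zero_iff] at h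
  obtain ⟨h0, h1⟩ := h
  have hd : p.natDegree = n := by
    have := h1 p.natDegree
    rw [coeff_eq_zero_of_natDegree_lt (n := p.natDegree+1) (by omega),
      coeff_eq_zero_of_natDegree_lt (n := p.natDegree+2) (by omega),
      coeff_eq_zero_of_natDegree_lt (n := p.natDegree+3) (by omega)] at this
    have hl : p.coeff p.natDegree ≠ 0 := by simpa using hp
    simp [hp, sub_eq_zero] at this
    exact_mod_cast this
  have hl : p.leadingCoeff = p.coeff n := by rw [leadingCoeff, hd]
  have hl0 : p.coeff n ≠ 0 := by rw [← hl]; simpa using hp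
  have hbig : ∀ k, n < k → p.coeff k = 0 := fun k hk =>
    coeff_eq_zero_of_natDegree_lt (by omega)
  have key : ∀ j k : ℕ, k + j = n + 2 → p.coeff k * k.factorial =
      p.coeff n * n.factorial * (ph n e b m j : ℂ) := by
    intro j
    induction j using strong3 with
    | h0 => intro k hk; rw [hbig k (by omega)]; simp [ph]
    | h1 => intro k hk; rw [hbig k (by omega)]; simp [ph]
    | h2 => intro k hk; have : k = n := by omega
            subst this; simp [ph]
    | h j i0 i1 i2 =>
      intro k hk
      have i0 := i0 (k+3) (by omega)
      have i1 := i1 (k+2) (by omega)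
      have i2 := i2 (k+1) (by omega)
      have hr : 2*((j:ℂ)+1)*((n:ℂ)-j) * ph n e b m (j+3) =
        m * ph n e b m (j+2) - 2*b*ph n e b m (j+1) + e * ph n e b m j := by
        exact_mod_cast ph_rec n e b m j (by omega)
      have f1 := fact_aux k
      have f2 := fact_aux (k+1)
      have f3 := fact_aux (k+2)
      push_cast at f1 f2 f3
      rw [f3] at i0
      rw [f2] at i0 i1
      have hn : (n:ℂ) = k + j + 1 := by
        have : n = k + j + 1 := by omega
        rw [this]; push_cast; ring
      have h1 := h1 k
      rw [hn] at hr h1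
      rw [f1] at i0 i1 i2
      have hx : 2*((j:ℂ)+1)*(k+1) ≠ 0 := by norm_cast
      apply mul_left_cancel₀ hx
      linear_combination e * i0 - 2*b*i1+m*i2  - (p.coeff n*n.factorial:ℂ) * hr - (k+1)*k.factorial * h1
  have nf : (n.factorial : ℂ) ≠ 0 := Nat.cast_ne_zero.2 (Nat.factorial_ne_zero _)
  refine ⟨hd, ?_, ?_⟩
  · have g0 := key (n+2) 0 (by omega)
    have g1 := key (n+1) 1 (by omega)
    have g2 := key n 2 (by omega)
    simp [Nat.factorial] at g0 g1 g2
    have hq : (p.coeff n * n.factorial) * ((m:ℂ) * ph n e b m (n+2) - 2*b*ph n e b m (n+1) + e * ph n e b m n) = 0 := by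
      linear_combination - e * g2 + 2*b*g1-m*g0 + h0
    have := (mul_eq_zero.1 hq).resolve_left (mul_ne_zero hl0 nf)
    unfold qq
    exact_mod_cast this
  · ext k
    rw [coeff_C_mul, hl]
    by_cases hk : n < k
    · rw [hbig k hk, PC_coeff, PR_coeff_large _ _ _ _ k hk]; simp
    · have a := key (n+2-k) k (by omega)
      have a' := PC_coeff' n e b m k (n+2-k) (by omega)
      have hkf : (k.factorial : ℂ) ≠ 0 := Nat.cast_ne_zero.2 (Nat.factorial_ne_zero _)
      apply mul_right_cancel₀ hkf
      linear_combination a - p.coeff n * a'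

end QES

namespace QES

lemma deriv_qesFun (b : ℂ) (p : ℂ[X]) :
    deriv (qesFun b p) = qesFun b (derivative p + (X^2 - C b)*p) := by
  funext z
  have h1 : HasDerivAt (fun z => p.eval z) ((derivative p).eval z) z := p.hasDerivAt z
  have h2 : HasDerivAt (fun z : ℂ => z^3/3 - b*z) (z^2 - b) z := by
    have := ((hasDerivAt_pow 3 z).div_const 3).sub ((hasDerivAt_id z).const_mul b)
    exact this.congr_deriv (by norm_num)
  have := (h1.mul h2.cexp).deriv
  unfold qesFun
  simp only [eval_add, eval_mul, eval_sub, eval_pow, eval_X, eval_C]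
  rw [show (fun z => eval z p * Complex.exp (z^3/3 - b*z)) = (fun z => eval z p) * (fun z => Complex.exp (z^3/3 - b*z)) from rfl, this]
  ring

lemma witness_iff (n : ℕ) (b lam : ℂ) (p : ℂ[X]) :
    QESWitness ((n:ℂ)+1) b lam p ↔ p ≠ 0 ∧ Lop n 1 b (lam + b^2) p = 0 := by
  unfold QESWitness SatisfiesQuarticODE
  refine and_congr_right fun _ => ?_
  have key : ∀ z, -(deriv (deriv (qesFun b p)) z) + (z ^ 4 - 2 * b * z ^ 2 + 2 * ((n:ℂ)+1) * z) * qesFun b p z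
      - lam * qesFun b p z = - (Lop n 1 b (lam + b^2) p).eval z * Complex.exp (z^3/3 - b*z) := by
    intro z
    rw [deriv_qesFun, deriv_qesFun]
    unfold qesFun Lop
    simp
    ring
  constructor
  · intro h
    apply Polynomial.funext
    intro z
    have := key z
    rw [h z, sub_self] at this
    have := (mul_eq_zero.1 this.symm).resolve_right (Complex.exp_ne_zero _)
    simpa using this
  · intro h z
    have := key z
    rw [h] at this
    simp at this
    linear_combination this

lemma witness_iff' (n : ℕ) (b lam : ℝ) (p : ℂ[X]) :
    QESWitness ((n:ℂ)+1) b lam p ↔ qq n 1 b (lam + b^2) = 0 ∧ ∃ c : ℂ, c ≠ 0 ∧ p = C c * PC n 1 b (lam + b^2) := by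
  rw [witness_iff]
  constructor
  · rintro ⟨hp, h⟩
    have := Lop_unique n 1 b (lam + b^2) p hp (by push_cast; exact h)
    exact ⟨this.2.1, p.leadingCoeff, by simpa using hp, this.2.2⟩
  · rintro ⟨h, c, hc, rfl⟩
    refine ⟨mul_ne_zero (by simpa using hc) (PC_monic _ _ _ _).ne_zero, ?_⟩
    have h1 := PC_Lop n 1 b (lam+b^2) h
    have : Lop n 1 b (lam+b^2) (C c * PC n 1 b (lam + b^2)) = C c * Lop n 1 b (lam+b^2) (PC n 1 b (lam + b^2)) := by
      unfold Lop; simp [derivative_mul]; ring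
    rw [this]
    push_cast at h1
    rw [h1, mul_zero]

lemma Lop_simple (n : ℕ) (e b m : ℂ) (he : e ≠ 0) (p : ℂ[X]) (hp : p ≠ 0) (h : Lop n e b m p = 0)
    (z : ℂ) (hz : p.eval z = 0) : (derivative p).eval z ≠ 0 := by
  intro hz'
  have h0 : derivative p ≠ 0 := by
    intro h0
    have h1 := derivative_eq_zero.1 h0
    rw [eq_C_of_natDegree_eq_zero h1] at hz hp
    simp at hz hp; exact hp hz
  have h2 : derivative (derivative p) ≠ 0 := by
    intro h2
    have h1 := derivative_eq_zero.1 h2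
    rw [eq_C_of_natDegree_eq_zero h1] at hz' h0
    simp at hz' h0; exact h0 hz'
  have m1 := derivative_rootMultiplicity_of_root (p := p) (t := z) hz
  have m2 := derivative_rootMultiplicity_of_root (p := derivative p) (t := z) hz'
  have d1 : 0 < (derivative p).rootMultiplicity z := (rootMultiplicity_pos h0).2 hz'
  set k := (derivative p).rootMultiplicity z with hk
  have dv1 : (X - C z)^k ∣ derivative p := pow_rootMultiplicity_dvd _ _
  have dv0 : (X - C z)^k ∣ p := (pow_dvd_pow _ (by omega)).trans (pow_rootMultiplicity_dvd p z)
  have dv2 : (X - C z)^k ∣ C e * derivative (derivative p) := by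
    have : C e * derivative (derivative p) = - (2*(X^2 - C b)*derivative p - 2*(n:ℂ[X])*X*p + C m*p) := by
      unfold Lop at h; linear_combination h
    rw [this, dvd_neg]
    exact dvd_add (dvd_sub (dv1.mul_left _) (dv0.mul_left _)) (dv0.mul_left _)
  have dv3 : (X - C z)^k ∣ derivative (derivative p) := by
    have : derivative (derivative p) = C e⁻¹ * (C e * derivative (derivative p)) := by
      rw [← mul_assoc, ← C_mul, inv_mul_cancel₀ he]; simp
    rw [this]; exact dv2.mul_left _
  have := (le_rootMultiplicity_iff h2).2 dv3
  omega

lemma PC_nodup (n : ℕ) (e b m : ℝ) (he : e ≠ 0) (h : qq n e b m = 0) : (PC n e b m).roots.Nodup := by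
  rw [Multiset.nodup_iff_count_le_one]
  intro z
  rw [count_roots]
  by_contra hh
  push Not at hh
  have := (one_lt_rootMultiplicity_iff_isRoot (PC_monic n e b m).ne_zero).1 hh
  exact Lop_simple n e b m (by exact_mod_cast he) _ (PC_monic n e b m).ne_zero (PC_Lop n e b m h) z this.1 this.2

lemma PC_card_roots (n : ℕ) (e b m : ℝ) : (PC n e b m).roots.card = n := by
  rw [splits_iff_card_roots.1 (IsAlgClosed.splits _), PC_natDegree]

lemma PC_card_finset (n : ℕ) (e b m : ℝ) (he : e ≠ 0) (h : qq n e b m = 0) :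
    (PC n e b m).roots.toFinset.card = n := by
  rw [Multiset.toFinset_card_of_nodup (PC_nodup n e b m he h), PC_card_roots]

lemma mem_PC (n : ℕ) (e b m : ℝ) (z : ℂ) : z ∈ (PC n e b m).roots.toFinset ↔ (PC n e b m).eval z = 0 := by
  rw [Multiset.mem_toFinset, mem_roots (PC_monic n e b m).ne_zero]; rfl

lemma PC_eval_conj (n : ℕ) (e b m : ℝ) (z : ℂ) :
    (PC n e b m).eval ((starRingEnd ℂ) z) = (starRingEnd ℂ) ((PC n e b m).eval z) := by
  unfold PC
  rw [eval_map, eval_map, Polynomial.hom_eval₂]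
  congr 1
  ext x; simp

/-- number of real zeros -/
noncomputable def NR (n : ℕ) (e b m : ℝ) : ℕ := ((PC n e b m).roots.toFinset.filter (fun z => z.im = 0)).card

lemma NR_parity (n : ℕ) (e b m : ℝ) (he : e ≠ 0) (h : qq n e b m = 0) :
    ∃ k : ℕ, 2*k ≤ n ∧ NR n e b m = n - 2*k := by
  set R := (PC n e b m).roots.toFinset with hR
  have hc := PC_card_finset n e b m he h
  rw [← hR] at hc
  have c1 := Finset.card_filter_add_card_filter_not (s := R) (fun z : ℂ => z.im = 0)
  have c2 := Finset.card_filter_add_card_filter_not (s := R.filter (fun z : ℂ => ¬ z.im = 0)) (fun z : ℂ => 0 < z.im)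
  have c3 : ((R.filter (fun z : ℂ => ¬ z.im = 0)).filter (fun z : ℂ => 0 < z.im)).card =
     ((R.filter (fun z : ℂ => ¬ z.im = 0)).filter (fun z : ℂ => ¬ 0 < z.im)).card := by
    apply Finset.card_bij (fun z _ => (starRingEnd ℂ) z)
    · intro z hz
      simp only [Finset.mem_filter, hR, mem_PC, PC_eval_conj, Complex.conj_im] at hz ⊢
      refine ⟨⟨by simp [hz.1.1], by simpa using hz.1.2⟩, by linarith⟩
    · intro z _ w _ hzw
      exact (starRingEnd ℂ).injective hzw
    · intro z hz
      refine ⟨(starRingEnd ℂ) z, ?_, by simp⟩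
      simp only [Finset.mem_filter, hR, mem_PC, PC_eval_conj, Complex.conj_im] at hz ⊢
      refine ⟨⟨by simp [hz.1.1], by simpa using hz.1.2⟩, ?_⟩
      have := lt_of_le_of_ne (not_lt.1 hz.2) hz.1.2
      linarith
  have : NR n e b m = (R.filter (fun z : ℂ => z.im = 0)).card := rfl
  exact ⟨((R.filter (fun z : ℂ => ¬ z.im = 0)).filter (fun z : ℂ => 0 < z.im)).card, by omega, by omega⟩

lemma zeros_smul (n : ℕ) (e b m : ℝ) (c : ℂ) (hc : c ≠ 0) :
    {z : ℂ | (C c * PC n e b m).eval z = 0} = ((PC n e b m).roots.toFinset : Set ℂ) := by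
  ext z; simp only [Set.mem_ofPred_eq, Finset.mem_coe, mem_PC]; simp [hc]

lemma ncard_real (n : ℕ) (e b m : ℝ) (c : ℂ) (hc : c ≠ 0) :
    {z : ℂ | (C c * PC n e b m).eval z = 0 ∧ z.im = 0}.ncard = NR n e b m := by
  unfold NR
  rw [← Set.ncard_coe_finset]
  congr 1
  ext z
  simp only [Set.mem_ofPred_eq, Finset.mem_coe, Finset.mem_filter, mem_PC]; simp [hc]

theorem part1 (n : ℕ) : (∀ b lam : ℝ, ∀ p : Polynomial ℂ, QESWitness ((n : ℂ) + 1) b lam p →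
      p.natDegree = n ∧ {z : ℂ | p.eval z = 0}.ncard = n ∧
      ∃ m : ℕ, 2 * m ≤ n ∧ {z : ℂ | p.eval z = 0 ∧ z.im = 0}.ncard = n - 2 * m) := by
  intro b lam p hp
  obtain ⟨h, c, hc, rfl⟩ := (witness_iff' n b lam p).1 hp
  refine ⟨?_, ?_, ?_⟩
  · rw [natDegree_C_mul hc, PC_natDegree]
  · rw [zeros_smul n _ _ _ c hc, Set.ncard_coe_finset, PC_card_finset _ _ _ _ one_ne_zero h]
  · rw [ncard_real n _ _ _ c hc]; exact NR_parity n _ _ _ one_ne_zero h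

lemma gamma_iff (n m : ℕ) (x : ℝ × ℝ) : x ∈ qesGamma n m ↔
    qq n 1 x.1 (x.2 + x.1^2) = 0 ∧ NR n 1 x.1 (x.2 + x.1^2) = n - 2*m := by
  unfold qesGamma
  simp only [Set.mem_ofPred_eq, witness_iff']
  constructor
  · rintro ⟨p, ⟨h, c, hc, rfl⟩, h2⟩
    rw [ncard_real n _ _ _ c hc] at h2
    exact ⟨h, h2⟩
  · rintro ⟨h, h2⟩
    refine ⟨C 1 * PC n 1 x.1 (x.2+x.1^2), ⟨h, 1, one_ne_zero, rfl⟩, ?_⟩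
    rw [ncard_real n _ _ _ 1 one_ne_zero, h2]

theorem part2 (n : ℕ) : (∀ m m' : ℕ, m ≤ n / 2 → m' ≤ n / 2 → m ≠ m' →
      Disjoint (qesGamma n m) (qesGamma n m')) := by
  intro m m' hm hm' hne
  rw [Set.disjoint_left]
  intro x hx hx'
  rw [gamma_iff] at hx hx'
  omega

theorem part4 (n : ℕ) : (⋃ m ∈ {m : ℕ | m ≤ n / 2}, qesGamma n m) = qesRealLocus ((n : ℂ) + 1) := by
  ext x
  simp only [Set.mem_iUnion, Set.mem_ofPred_eq, gamma_iff, exists_prop]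
  unfold qesRealLocus qesSpectralLocus
  simp only [Set.mem_ofPred_eq, witness_iff']
  constructor
  · rintro ⟨m, hm, h, h2⟩
    exact ⟨C 1 * PC n 1 x.1 (x.2+x.1^2), h, 1, one_ne_zero, rfl⟩
  · rintro ⟨p, h, -⟩
    obtain ⟨k, hk, h2⟩ := NR_parity n _ _ _ one_ne_zero h
    exact ⟨k, by omega, h, h2⟩

end QES

namespace QES
open PowerSeries in
noncomputable def Phi (n : ℕ) (e b m : ℝ) : PowerSeries ℝ := PowerSeries.mk (fun k => ph n e b m (k+2))

noncomputable def gg (e b m : ℝ) : PowerSeries ℝ :=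
  PowerSeries.C m - PowerSeries.C (2*b) * PowerSeries.X + PowerSeries.C e * PowerSeries.X^2

lemma coeff_Xmul (f : PowerSeries ℝ) (k : ℕ) :
    PowerSeries.coeff k (PowerSeries.X * PowerSeries.derivative ℝ f) = k * PowerSeries.coeff k f := by
  cases k with
  | zero => simp
  | succ k => rw [PowerSeries.coeff_succ_X_mul, PowerSeries.coeff_derivative]; push_cast; ring

lemma Phi_eq (n : ℕ) (e b m : ℝ) :
    2 * PowerSeries.X * PowerSeries.derivative ℝ (PowerSeries.derivative ℝ (Phi n e b m))
      - 2 * (n : PowerSeries ℝ) * PowerSeries.derivative ℝ (Phi n e b m) + gg e b m * Phi n e b m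
      = PowerSeries.C (qq n e b m) * PowerSeries.X^n := by
  have e1 : 2 * PowerSeries.X * PowerSeries.derivative ℝ (PowerSeries.derivative ℝ (Phi n e b m))
      - 2 * (n : PowerSeries ℝ) * PowerSeries.derivative ℝ (Phi n e b m) + gg e b m * Phi n e b m =
     PowerSeries.C 2 * (PowerSeries.X * PowerSeries.derivative ℝ (PowerSeries.derivative ℝ (Phi n e b m)))
      - PowerSeries.C (2 * (n:ℝ)) * PowerSeries.derivative ℝ (Phi n e b m)
      + (PowerSeries.C m * Phi n e b m - PowerSeries.C (2*b) * (PowerSeries.X * Phi n e b m)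
        + PowerSeries.C e * (PowerSeries.X * (PowerSeries.X * Phi n e b m))) := by
    unfold gg
    simp only [map_mul, map_natCast, map_ofNat]; ring
  rw [e1]
  ext k
  simp only [map_add, map_sub, PowerSeries.coeff_C_mul, coeff_Xmul, PowerSeries.coeff_derivative]
  have h2 : PowerSeries.coeff k (PowerSeries.X * Phi n e b m) = ph n e b m (k+1) := by
    cases k with
    | zero => simp [ph]
    | succ k => rw [PowerSeries.coeff_succ_X_mul, Phi, PowerSeries.coeff_mk]
  have h3 : PowerSeries.coeff k (PowerSeries.X * (PowerSeries.X * Phi n e b m)) = ph n e b m k := by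
    rcases k with _ | _ | k
    · simp [ph]
    · rw [PowerSeries.coeff_succ_X_mul]; simp [ph]
    · rw [PowerSeries.coeff_succ_X_mul, PowerSeries.coeff_succ_X_mul, Phi, PowerSeries.coeff_mk]
  rw [h2, h3, PowerSeries.coeff_X_pow]
  simp only [Phi, PowerSeries.coeff_mk]
  by_cases hk : k = n
  · subst hk; rw [show k+1+2 = k+3 from rfl, ph_n]; simp [qq]
  · have := ph_rec n e b m k hk
    simp only [hk, if_false]
    rw [show k+1+2 = k+3 from rfl]
    linear_combination -this

noncomputable def PP (n : ℕ) (e b m b' m' : ℝ) : ℝ := PowerSeries.coeff n (Phi n e b m * Phi n e b' m')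
noncomputable def QQ (n : ℕ) (e b m b' m' : ℝ) : ℝ :=
  PowerSeries.coeff n (PowerSeries.X * (Phi n e b m * Phi n e b' m'))

lemma qq_sub (n : ℕ) (e b m b' m' : ℝ) : qq n e b m - qq n e b' m' =
    (m - m') * PP n e b m b' m' - 2*(b-b') * QQ n e b m b' m' := by
  have h1 := Phi_eq n e b m
  have h2 := Phi_eq n e b' m'
  set F := Phi n e b m with hF
  set G := Phi n e b' m' with hG
  set D := PowerSeries.derivative ℝ with hD
  have key : PowerSeries.C 2 * (PowerSeries.X * D (G * D F - F * D G)) - PowerSeries.C (2*(n:ℝ)) * (G * D F - F * D G)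
    + (PowerSeries.C (m-m') * (F*G) - PowerSeries.C (2*(b-b')) * (PowerSeries.X * (F*G))) =
     PowerSeries.C (qq n e b m) * (PowerSeries.X^n * G) - PowerSeries.C (qq n e b' m') * (PowerSeries.X^n * F) := by
    have hd : D (G * D F - F * D G) = G * D (D F) - F * D (D G) := by
      rw [map_sub, D.leibniz, D.leibniz]; simp only [smul_eq_mul]; ring
    rw [hd]
    have e3 : PowerSeries.C (qq n e b m) * (PowerSeries.X^n * G) = (PowerSeries.C (qq n e b m) * PowerSeries.X^n) * G := by ring
    have e4 : PowerSeries.C (qq n e b' m') * (PowerSeries.X^n * F) = (PowerSeries.C (qq n e b' m') * PowerSeries.X^n) * F := by ring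
    rw [e3, e4, ← h1, ← h2]
    unfold gg
    simp only [map_mul, map_natCast, map_ofNat, map_sub]; ring
  have := congrArg (PowerSeries.coeff n) key
  simp only [LinearMap.map_add, LinearMap.map_sub, PowerSeries.coeff_C_mul, hD, coeff_Xmul] at this
  have c1 : ∀ H : PowerSeries ℝ, PowerSeries.coeff n (PowerSeries.X^n * H) = PowerSeries.coeff 0 H := by
    intro H
    have := PowerSeries.coeff_X_pow_mul H n 0
    rwa [zero_add] at this
  rw [c1, c1] at this
  have c2 : PowerSeries.coeff 0 F = 1 := by rw [hF, Phi, PowerSeries.coeff_mk]; simp [ph]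
  have c3 : PowerSeries.coeff 0 G = 1 := by rw [hG, Phi, PowerSeries.coeff_mk]; simp [ph]
  rw [c2, c3] at this
  unfold PP QQ
  rw [← hF, ← hG]
  linear_combination -this

lemma PP_eq (n : ℕ) (e b m b' m' : ℝ) : PP n e b m b' m' =
    ∑ k ∈ Finset.range (n+1), ph n e b m (k+2) * ph n e b' m' (n-k+2) := by
  unfold PP
  rw [PowerSeries.coeff_mul, Finset.Nat.sum_antidiagonal_eq_sum_range_succ_mk]
  simp [Phi]

lemma QQ_eq (n : ℕ) (e b m b' m' : ℝ) : QQ n e b m b' m' =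
    ∑ k ∈ Finset.range n, ph n e b m (k+2) * ph n e b' m' (n-1-k+2) := by
  unfold QQ
  cases n with
  | zero => simp
  | succ n => 
    rw [PowerSeries.coeff_succ_X_mul, PowerSeries.coeff_mul, Finset.Nat.sum_antidiagonal_eq_sum_range_succ_mk]
    simp [Phi]

noncomputable def qm (n : ℕ) (e b m : ℝ) : ℝ := PP n e b m b m
noncomputable def qb (n : ℕ) (e b m : ℝ) : ℝ := -2 * QQ n e b m b m

lemma PP_cont (n : ℕ) : Continuous (fun v : ℝ × (ℝ × ℝ) × (ℝ × ℝ) => PP n v.1 v.2.1.1 v.2.1.2 v.2.2.1 v.2.2.2) := by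
  simp only [PP_eq]
  refine continuous_finsetSum _ fun k _ => ?_
  have h1 := (ph_cont n (k+2)).comp (f := fun v : ℝ × (ℝ × ℝ) × (ℝ × ℝ) => (v.1, v.2.1.1, v.2.1.2)) (by fun_prop)
  have h2 := (ph_cont n (n-k+2)).comp (f := fun v : ℝ × (ℝ × ℝ) × (ℝ × ℝ) => (v.1, v.2.2.1, v.2.2.2)) (by fun_prop)
  exact h1.mul h2

lemma QQ_cont (n : ℕ) : Continuous (fun v : ℝ × (ℝ × ℝ) × (ℝ × ℝ) => QQ n v.1 v.2.1.1 v.2.1.2 v.2.2.1 v.2.2.2) := by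
  simp only [QQ_eq]
  refine continuous_finsetSum _ fun k _ => ?_
  have h1 := (ph_cont n (k+2)).comp (f := fun v : ℝ × (ℝ × ℝ) × (ℝ × ℝ) => (v.1, v.2.1.1, v.2.1.2)) (by fun_prop)
  have h2 := (ph_cont n (n-1-k+2)).comp (f := fun v : ℝ × (ℝ × ℝ) × (ℝ × ℝ) => (v.1, v.2.2.1, v.2.2.2)) (by fun_prop)
  exact h1.mul h2

lemma qm_cont (n : ℕ) : Continuous (fun v : ℝ × ℝ × ℝ => qm n v.1 v.2.1 v.2.2) :=
  (PP_cont n).comp (f := fun v : ℝ × ℝ × ℝ => (v.1, (v.2.1, v.2.2), (v.2.1, v.2.2))) (by fun_prop)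

lemma qb_cont (n : ℕ) : Continuous (fun v : ℝ × ℝ × ℝ => qb n v.1 v.2.1 v.2.2) :=
  ((QQ_cont n).comp (f := fun v : ℝ × ℝ × ℝ => (v.1, (v.2.1, v.2.2), (v.2.1, v.2.2))) (by fun_prop)).const_mul (-2)

/-- strict-differentiability estimate (uniform in e near e0) -/
lemma qq_strict (n : ℕ) (e b m : ℝ) (η : ℝ) (hη : 0 < η) : ∃ δ > 0, ∀ e' b1 m1 b2 m2 : ℝ,
    |e' - e| < δ → |b1 - b| < δ → |m1 - m| < δ → |b2 - b| < δ → |m2 - m| < δ →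
    |qq n e' b1 m1 - qq n e' b2 m2 - (qm n e b m * (m1 - m2) + qb n e b m * (b1 - b2))|
      ≤ η * (|m1 - m2| + |b1 - b2|) := by
  have c1 := Metric.continuous_iff.1 (PP_cont n) (e, (b, m), (b, m)) η hη
  have c2 := Metric.continuous_iff.1 (QQ_cont n) (e, (b, m), (b, m)) (η/2) (by positivity)
  obtain ⟨d1, hd1, c1⟩ := c1
  obtain ⟨d2, hd2, c2⟩ := c2
  refine ⟨min d1 d2, lt_min hd1 hd2, ?_⟩
  intro e' b1 m1 b2 m2 he hb1 hm1 hb2 hm2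
  have hd : ∀ d, min d1 d2 ≤ d → dist ((e', (b1, m1), (b2, m2)) : ℝ × (ℝ × ℝ) × (ℝ × ℝ)) (e, (b, m), (b, m)) < d := by
    intro d hd
    simp only [Prod.dist_eq, Real.dist_eq, max_lt_iff]
    exact ⟨by linarith, ⟨by linarith, by linarith⟩, ⟨by linarith, by linarith⟩⟩
  have c1 := c1 _ (hd d1 (min_le_left _ _))
  have c2 := c2 _ (hd d2 (min_le_right _ _))
  rw [Real.dist_eq] at c1 c2
  simp only at c1 c2
  rw [qq_sub]
  unfold qm qb
  have : (m1 - m2) * PP n e' b1 m1 b2 m2 - 2 * (b1 - b2) * QQ n e' b1 m1 b2 m2 -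
      (PP n e b m b m * (m1 - m2) + -2 * QQ n e b m b m * (b1 - b2)) =
      (PP n e' b1 m1 b2 m2 - PP n e b m b m) * (m1 - m2) - 2 * (QQ n e' b1 m1 b2 m2 - QQ n e b m b m) * (b1 - b2) := by ring
  rw [this]
  calc _ ≤ |(PP n e' b1 m1 b2 m2 - PP n e b m b m) * (m1 - m2)| + |2 * (QQ n e' b1 m1 b2 m2 - QQ n e b m b m) * (b1 - b2)| := abs_sub _ _
    _ = |PP n e' b1 m1 b2 m2 - PP n e b m b m| * |m1 - m2| + 2 * |QQ n e' b1 m1 b2 m2 - QQ n e b m b m| * |b1 - b2| := by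
        rw [abs_mul, abs_mul, abs_mul, abs_two]
    _ ≤ η * |m1 - m2| + 2 * (η/2) * |b1 - b2| := by gcongr
    _ = _ := by ring

end QES

namespace QES

noncomputable def uu (n : ℕ) (b m : ℝ) (k : ℕ) : ℝ :=
  PowerSeries.coeff k (PowerSeries.X * (PowerSeries.X * (Phi n 1 b m * Phi n 1 b m)))

lemma uu_rec (n : ℕ) (b m : ℝ) (h : qq n 1 b m = 0) (i : ℕ) :
    ((i:ℝ)-2*n-1)*(i+1)*(i-n)*uu n b m (i+3) + m*(2*i-2*n-1)*uu n b m (i+2)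
      - 2*b*(2*i-2*n-2)*uu n b m (i+1) + (2*i-2*n-3)*uu n b m i = 0 := by
  have h1 := Phi_eq n 1 b m
  rw [h] at h1
  set F := Phi n 1 b m with hF
  obtain ⟨D, hD⟩ : ∃ D, D = PowerSeries.derivative ℝ := ⟨_, rfl⟩
  rw [← hD] at h1
  obtain ⟨S, hS⟩ : ∃ S, S = F*F := ⟨_, rfl⟩
  obtain ⟨E, hE⟩ : ∃ E, E = PowerSeries.X * D (D S) - PowerSeries.C (n:ℝ) * D S + (PowerSeries.C m * S - PowerSeries.C (2*b) * (PowerSeries.X * S)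
      + PowerSeries.X * (PowerSeries.X * S)) := ⟨_, rfl⟩
  have dS : D S = 2*F*D F := by rw [hS, D.leibniz]; simp only [smul_eq_mul]; ring
  have d2 : D (2 : PowerSeries ℝ) = 0 := by
    have := PowerSeries.derivative_C (R := ℝ) (r := 2); rw [map_ofNat] at this; rw [hD]; exact this
  have dX : D (PowerSeries.X : PowerSeries ℝ) = 1 := by rw [hD]; exact PowerSeries.derivative_X
  have ddS : D (D S) = 2*D F*D F + 2*F*D (D F) := by
    rw [dS, D.leibniz, D.leibniz, d2]; simp only [smul_eq_mul]; ring
  unfold gg at h1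
  simp only [map_mul, map_ofNat, map_one, map_zero, zero_mul, one_mul] at h1
  have e1 : E = 2 * PowerSeries.X * (D F * D F) := by
    rw [hE, ddS, dS, hS]
    simp only [map_mul, map_ofNat, map_natCast]
    linear_combination F * h1
  have key : PowerSeries.X * D E = PowerSeries.C (2*(n:ℝ)+1) * E - (PowerSeries.C m * (PowerSeries.X * D S) -
     PowerSeries.C (2*b) * (PowerSeries.X * (PowerSeries.X * D S)) + PowerSeries.X * (PowerSeries.X * (PowerSeries.X * D S))) := by
    rw [e1, dS]
    simp only [D.leibniz, d2, dX, smul_eq_mul, map_mul, map_ofNat, map_natCast, map_add, map_one]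
    linear_combination (2*PowerSeries.X * D F) * h1
  have hu2 : ∀ k, uu n b m (k+2) = PowerSeries.coeff k S := by
    intro k; rw [uu, PowerSeries.coeff_succ_X_mul, PowerSeries.coeff_succ_X_mul, hS]
  have hu1 : ∀ k, uu n b m (k+1) = PowerSeries.coeff k (PowerSeries.X * S) := by
    intro k; rw [uu, PowerSeries.coeff_succ_X_mul, hS]
  have hu0 : ∀ k, uu n b m k = PowerSeries.coeff k (PowerSeries.X * (PowerSeries.X * S)) := by
    intro k; rw [uu, hS]
  have x1 : PowerSeries.coeff i (PowerSeries.X * (PowerSeries.X * D S)) = (i-1) * uu n b m (i+1) := by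
    rw [hu1]
    cases i with
    | zero => simp
    | succ k => rw [PowerSeries.coeff_succ_X_mul, PowerSeries.coeff_succ_X_mul, hD, coeff_Xmul]; push_cast; ring
  have x2 : PowerSeries.coeff i (PowerSeries.X * (PowerSeries.X * (PowerSeries.X * D S))) = (i-2) * uu n b m i := by
    rw [hu0]
    rcases i with _ | _ | k
    · simp
    · rw [PowerSeries.coeff_succ_X_mul, PowerSeries.coeff_succ_X_mul]; simp
    · rw [PowerSeries.coeff_succ_X_mul, PowerSeries.coeff_succ_X_mul, PowerSeries.coeff_succ_X_mul, PowerSeries.coeff_succ_X_mul, hD, coeff_Xmul]; push_cast; ring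
  have cE := congrArg (PowerSeries.coeff i) hE
  have ck := congrArg (PowerSeries.coeff i) key
  simp only [LinearMap.map_add, LinearMap.map_sub, PowerSeries.coeff_C_mul, x1, x2] at cE ck
  rw [hD, coeff_Xmul] at cE ck
  rw [← hD, hD, coeff_Xmul] at ck
  rw [PowerSeries.coeff_derivative] at cE
  rw [← hu1 i, ← hu2 i, ← hu0 i, ← hu2 (i+1)] at cE
  rw [← hu2 i] at ck
  rw [show i + 3 = i+1+2 from rfl]
  linear_combination ck - (i-2*n-1) * cE

lemma uu_0 (n : ℕ) (b m : ℝ) : uu n b m 0 = 0 := by simp [uu]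
lemma uu_1 (n : ℕ) (b m : ℝ) : uu n b m 1 = 0 := by
  rw [uu, PowerSeries.coeff_succ_X_mul]; simp
lemma uu_2 (n : ℕ) (b m : ℝ) : uu n b m 2 = 1 := by
  rw [uu, PowerSeries.coeff_succ_X_mul, PowerSeries.coeff_succ_X_mul]; simp [Phi, ph]
lemma uu_n1 (n : ℕ) (b m : ℝ) : uu n b m (n+1) = QQ n 1 b m b m := by
  rw [uu, PowerSeries.coeff_succ_X_mul, QQ]
lemma uu_n2 (n : ℕ) (b m : ℝ) : uu n b m (n+2) = qm n 1 b m := by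
  rw [uu, PowerSeries.coeff_succ_X_mul, PowerSeries.coeff_succ_X_mul, qm, PP]

noncomputable def rr (n : ℕ) (b m : ℝ) (j : ℕ) : ℝ := uu n b m (n+1-j)

lemma rr_rec1 (n : ℕ) (b m : ℝ) (h : qq n 1 b m = 0) (h' : qm n 1 b m = 0) :
    3 * rr n b m 1 = 4*b*rr n b m 0 := by
  rcases n with _ | n
  · simp [rr, uu_1, uu_0]
  have := uu_rec (n+1) b m h (n+1)
  have h2 := uu_n2 (n+1) b m
  rw [h'] at h2
  rw [h2] at this
  have e1 : rr (n+1) b m 1 = uu (n+1) b m (n+1) := rfl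
  have e0 : rr (n+1) b m 0 = uu (n+1) b m (n+1+1) := rfl
  rw [e1, e0]
  push_cast at this
  linear_combination -this

lemma rr_rec2 (n : ℕ) (b m : ℝ) (h : qq n 1 b m = 0) (h' : qm n 1 b m = 0) :
    5 * rr n b m 2 = 8*b*rr n b m 1 - 3 * m * rr n b m 0 := by
  rcases n with _ | n
  · simp [rr, uu_1, uu_0]
  have := uu_rec (n+1) b m h n
  have h2 := uu_n2 (n+1) b m
  rw [h'] at h2
  rw [show n + 3 = n+1+2 from rfl, h2] at this
  have e1 : rr (n+1) b m 1 = uu (n+1) b m (n+1) := rfl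
  have e0 : rr (n+1) b m 0 = uu (n+1) b m (n+2) := rfl
  have e2 : rr (n+1) b m 2 = uu (n+1) b m n := rfl
  rw [e1, e0, e2]
  push_cast at this
  linear_combination -this

lemma rr_rec3 (n : ℕ) (b m : ℝ) (h : qq n 1 b m = 0) (l : ℕ) :
    (2*(l:ℝ)+7) * rr n b m (l+3) = 4*(l+3)*b*rr n b m (l+2) - m*(2*l+5)*rr n b m (l+1)
      + (l+2)*(n+l+3)*(n-l-1)*rr n b m l := by
  rcases Nat.lt_or_ge n (l+2) with hl | hl
  · have e3 : rr n b m (l+3) = 0 := by rw [rr, show n+1-(l+3) = 0 by omega, uu_0]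
    have e2 : rr n b m (l+2) = 0 := by rw [rr, show n+1-(l+2) = 0 by omega, uu_0]
    have e1 : rr n b m (l+1) = 0 := by
      rw [rr]
      have : n+1-(l+1) = 0 ∨ n+1-(l+1) = 1 := by omega
      rcases this with h | h <;> rw [h]; exacts [uu_0 _ _ _, uu_1 _ _ _]
    have e0 : ((n:ℝ)-l-1) * rr n b m l = 0 := by
      by_cases hn : n = l+1
      · subst hn; push_cast; ring
      · have : n+1-l = 0 ∨ n+1-l = 1 := by omega
        rw [rr]
        rcases this with h | h <;> rw [h]; rw [uu_0, mul_zero]; rw [uu_1, mul_zero]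
    rw [e3, e2, e1]
    linear_combination -(l+2)*(n+l+3)*e0
  · obtain ⟨i, rfl⟩ : ∃ i, n = i + (l+2) := ⟨n-(l+2), by omega⟩
    have := uu_rec (i + (l+2)) b m h i
    have e3 : rr (i + (l+2)) b m (l+3) = uu (i+(l+2)) b m i := by rw [rr]; congr 1; omega
    have e2 : rr (i + (l+2)) b m (l+2) = uu (i+(l+2)) b m (i+1) := by rw [rr]; congr 1; omega
    have e1 : rr (i + (l+2)) b m (l+1) = uu (i+(l+2)) b m (i+2) := by rw [rr]; congr 1; omega
    have e0 : rr (i + (l+2)) b m l = uu (i+(l+2)) b m (i+3) := by rw [rr]; congr 1; omega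
    rw [e0, e1, e2, e3]
    push_cast at this ⊢
    linear_combination -this

noncomputable def ww (n : ℕ) (b m : ℝ) : ℝ[X] := ∑ j ∈ Finset.range n, C (rr n b m j) * X^j

lemma ww_coeff (n : ℕ) (b m : ℝ) (j : ℕ) : (ww n b m).coeff j = rr n b m j := by
  unfold ww
  simp only [finsetSum_coeff, coeff_C_mul_X_pow]
  rw [Finset.sum_ite_eq]
  split_ifs with h
  · rfl
  · simp at h
    have : n+1-j = 0 ∨ n+1-j = 1 := by omega
    rw [rr]
    rcases this with h | h <;> rw [h]; exacts [(uu_0 _ _ _).symm, (uu_1 _ _ _).symm]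

lemma coeff_T (f : ℝ[X]) (k : ℕ) : (X * derivative f).coeff k = k * f.coeff k := by
  cases k with
  | zero => simp
  | succ k => rw [coeff_X_mul, coeff_derivative]; push_cast; ring

lemma ww_ode (n : ℕ) (b m : ℝ) (h : qq n 1 b m = 0) (h' : qm n 1 b m = 0) :
    C 2 * (X * derivative (ww n b m)) + ww n b m - C (rr n b m 0)
     - C (4*b) * (X * (ww n b m + X * derivative (ww n b m)))
     + C m * (X * (X * (C 2 * (X * derivative (ww n b m)) + C 3 * ww n b m)))
     + X * (X * (X * (X * derivative (X * derivative (X * derivative (ww n b m)))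
       + C 6 * (X * derivative (X * derivative (ww n b m)))
       + C (11 - (n^2+2*n:ℝ)) * (X * derivative (ww n b m)) + C (6 - 2*(n^2+2*n:ℝ)) * ww n b m))) = 0 := by
  ext j
  rcases j with _ | _ | _ | l
  · simp only [coeff_add, coeff_sub, coeff_C_mul, coeff_T, mul_coeff_zero, coeff_X_zero, coeff_C_zero, ww_coeff]
    simp
  · simp only [coeff_add, coeff_sub, coeff_C_mul, coeff_T, coeff_X_mul, mul_coeff_zero, coeff_X_zero, coeff_C_succ, ww_coeff]
    have := rr_rec1 n b m h h'
    simp [coeff_derivative, ww_coeff]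
    linear_combination this
  · simp only [coeff_add, coeff_sub, coeff_C_mul, coeff_T, coeff_X_mul, mul_coeff_zero, coeff_X_zero, coeff_C_succ, ww_coeff]
    have := rr_rec2 n b m h h'
    simp [coeff_derivative, ww_coeff]
    linear_combination this
  · simp only [coeff_add, coeff_sub, coeff_C_mul, coeff_T, coeff_X_mul, coeff_C_succ, ww_coeff]
    have := rr_rec3 n b m h l
    simp [coeff_derivative, ww_coeff]
    linear_combination this

noncomputable def Dl (n : ℕ) (b m : ℝ) (w : ℝ[X]) : ℝ[X] :=
  X^4*(C 2*w*(X * derivative w + X * derivative (X * derivative w)) - (w + X * derivative w)^2)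
   + C 4 * X^4*w*(w + X * derivative w)
   - X^2*w^2*(C (n^2+2*n:ℝ)*X^2 - C 2*C m*X + C 4*C b) + C 2*X*w^2

lemma Dl_deriv (n : ℕ) (b m : ℝ) (h : qq n 1 b m = 0) (h' : qm n 1 b m = 0) :
    derivative (Dl n b m (ww n b m)) = C 2 * C (rr n b m 0) * ww n b m := by
  have := ww_ode n b m h h'
  unfold Dl
  set w := ww n b m
  simp only [derivative_add, derivative_sub, derivative_mul, derivative_pow, derivative_C, derivative_X] at this ⊢
  simp only [C_sub, C_mul, C_add] at this ⊢
  have c2 : (C 2 : ℝ[X]) = 2 := rfl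
  have c3 : (C 3 : ℝ[X]) = 3 := rfl
  have c4 : (C 4 : ℝ[X]) = 4 := rfl
  have c6 : (C 6 : ℝ[X]) = 6 := rfl
  have c11 : (C 11 : ℝ[X]) = 11 := rfl
  simp only [c2, c3, c4, c6, c11] at this ⊢
  push_cast
  simp only [c2, c3, c4]
  linear_combination (2*w) * this

lemma lemmaK (n : ℕ) (b m : ℝ) (h : qq n 1 b m = 0) (h' : qm n 1 b m = 0) : qb n 1 b m < 0 := by
  rcases n with _ | n
  · simp [qm, PP_eq, ph] at h'
  have r0 : rr (n+1) b m 0 = QQ (n+1) 1 b m b m := by rw [← uu_n1]; rfl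
  have rn : rr (n+1) b m n = 1 := by rw [rr, show n+1+1-n = 2 by omega, uu_2]
  suffices hs : 0 < rr (n+1) b m 0 by unfold qb; linarith
  by_contra hneg
  push Not at hneg
  rcases hneg.lt_or_eq with hneg | hz
  · set w := ww (n+1) b m with hw
    have w0 : w.eval 0 = rr (n+1) b m 0 := by rw [← coeff_zero_eq_eval_zero, ww_coeff]
    have wdeg : w.natDegree ≤ n := by
      rw [natDegree_le_iff_coeff_eq_zero]
      intro j hj
      rw [ww_coeff, rr]
      have : n+1+1-j = 0 ∨ n+1+1-j = 1 := by omega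
      rcases this with h | h <;> rw [h]; exacts [(uu_0 _ _ _), (uu_1 _ _ _)]
    have wmon : w.Monic := monic_of_natDegree_le_of_coeff_eq_one n wdeg (by rw [ww_coeff, rn])
    obtain ⟨T, hT0, hT⟩ : ∃ T : ℝ, 0 ≤ T ∧ 0 ≤ w.eval T := by
      by_cases hd : w.natDegree = 0
      · rw [wmon.natDegree_eq_zero.1 hd]; exact ⟨0, le_rfl, by simp⟩
      · have : Tendsto (fun x => w.eval x) atTop atTop :=
          w.tendsto_atTop_of_leadingCoeff_nonneg (natDegree_pos_iff_degree_pos.1 (Nat.pos_of_ne_zero hd)) (by rw [wmon.leadingCoeff]; norm_num)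
        obtain ⟨T, hT, hT0⟩ := ((this.eventually_ge_atTop 0).and (eventually_ge_atTop 0)).exists
        exact ⟨T, hT0, hT⟩
    have hcomp : IsCompact (Set.Icc 0 T ∩ {t | 0 ≤ w.eval t}) :=
      isCompact_Icc.inter_right (isClosed_le continuous_const w.continuous)
    obtain ⟨t0, ⟨⟨ht0, ht0T⟩, hwt⟩, hmin⟩ := hcomp.exists_isLeast ⟨T, ⟨hT0, le_rfl⟩, hT⟩
    have hlt : ∀ t, 0 ≤ t → t < t0 → w.eval t < 0 := by
      intro t h0 h1
      by_contra hc
      exact absurd (hmin ⟨⟨h0, (h1.le.trans ht0T)⟩, not_lt.1 hc⟩) (not_le.2 h1)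
    have ht0' : 0 < t0 := by
      rcases ht0.lt_or_eq with h | h
      · exact h
      · subst h
        have : 0 ≤ w.eval 0 := hwt
        linarith
    have hwz : w.eval t0 = 0 := by
      have hc : ContinuousOn (fun t => w.eval t) (Set.Icc 0 t0) := w.continuous.continuousOn
      obtain ⟨t, ⟨a, a'⟩, ha⟩ := intermediate_value_Icc ht0 hc ⟨by rw [w0]; exact hneg.le, hwt⟩
      rcases a'.lt_or_eq with h | h
      · have := hlt t a h; simp only at ha; linarith
      · subst h; exact ha
    have hdd := Dl_deriv (n+1) b m h h'
    rw [← hw] at hdd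
    have hmono : StrictMonoOn (fun t => (Dl (n+1) b m w).eval t) (Set.Icc 0 t0) := by
      apply strictMonoOn_of_deriv_pos (convex_Icc _ _) (Polynomial.continuous _).continuousOn
      intro t ht
      rw [interior_Icc] at ht
      rw [Polynomial.deriv, hdd]
      have := hlt t ht.1.le ht.2
      simp only [eval_mul, eval_C]
      nlinarith
    have h1 := hmono ⟨le_rfl, ht0⟩ ⟨ht0, le_rfl⟩ ht0'
    simp only [Dl, eval_add, eval_sub, eval_mul, eval_pow, eval_X, eval_C, hwz] at h1
    have : 0 ≤ t0^4 * (t0 * (derivative w).eval t0)^2 := by positivity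
    nlinarith
  · have : ∀ j, rr (n+1) b m j = 0 := by
      intro j
      have r1 := rr_rec1 _ b m h h'
      have r2 := rr_rec2 _ b m h h'
      induction j using strong3 with
      | h0 => exact hz
      | h1 => rw [hz] at r1; linarith
      | h2 => rw [hz] at r1; rw [hz, show rr (n+1) b m 1 = 0 by linarith] at r2; linarith
      | h k i0 i1 i2 =>
        have := rr_rec3 _ b m h k
        rw [i0, i1, i2] at this
        simp at this
        rcases this with h | h
        · have : (0:ℝ) ≤ k := Nat.cast_nonneg k
          linarith
        · exact h
    rw [this n] at rn
    norm_num at rn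

end QES

namespace QES

open scoped Manifold ContDiff in
lemma exists_slope (F A B : ℝ × ℝ → ℝ) (hF : Continuous F) (hA : Continuous A) (hB : Continuous B)
    (hK : ∀ x, F x = 0 → A x = 0 → B x < 0) (c : ℝ) (hc : ∀ x, F x = 0 → |x.2| < 2*|x.1| + c) :
    ∃ σ : ℝ × ℝ → ℝ, ContDiff ℝ 1 σ ∧ (∀ x, F x = 0 → σ x * A x + B x < 0) ∧
      (∀ x, 2*|x.1| + c ≤ |x.2| → σ x = 0) := by
  have := exists_contMDiffMap_forall_mem_convex_of_local_const (n := 1) (𝓘(ℝ, ℝ × ℝ))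
    (t := fun x : ℝ × ℝ => {s : ℝ | (F x = 0 → s * A x + B x < 0) ∧ (2*|x.1| + c ≤ |x.2| → s = 0)}) ?_ ?_
  · obtain ⟨g, hg⟩ := this
    refine ⟨g, contMDiff_iff_contDiff.1 g.contMDiff, fun x => (hg x).1, fun x => (hg x).2⟩
  · intro x s hs t ht p q hp hq hpq
    refine ⟨fun h => ?_, fun h => ?_⟩
    · have h1 := hs.1 h
      have h2 := ht.1 h
      simp only [smul_eq_mul]
      have : (p * s + q * t) * A x + B x = p * (s * A x + B x) + q * (t * A x + B x) := by
        linear_combination (-(B x)) * hpq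
      rw [this]
      rcases hp.eq_or_lt with h0 | h0
      · subst h0
        have : q = 1 := by linarith
        subst this; linarith
      · nlinarith [mul_pos h0 (neg_pos.2 h1), mul_nonneg hq (neg_pos.2 h2).le]
    · simp [hs.2 h, ht.2 h]
  · intro x
    by_cases h : F x = 0
    · have ho : ∀ᶠ y in nhds x, |y.2| < 2*|y.1| + c :=
        (isOpen_lt (f := fun y : ℝ × ℝ => |y.2|) (g := fun y => 2*|y.1| + c) (by fun_prop) (by fun_prop)).mem_nhds (hc x h)
      obtain ⟨s, hs⟩ : ∃ s, s * A x + B x < 0 := by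
        by_cases hA0 : A x = 0
        · exact ⟨0, by simpa using hK x h hA0⟩
        · refine ⟨(-B x - 1) / A x, ?_⟩
          rw [div_mul_cancel₀ _ hA0]; linarith
      have ho2 : ∀ᶠ y in nhds x, s * A y + B y < 0 :=
        (isOpen_lt (f := fun y : ℝ × ℝ => s * A y + B y) (g := fun y => 0) (by fun_prop) (by fun_prop)).mem_nhds hs
      refine ⟨s, ?_⟩
      filter_upwards [ho, ho2] with y h1 h2
      exact ⟨fun _ => h2, fun h => absurd h (not_le.2 h1)⟩
    · refine ⟨0, ?_⟩
      filter_upwards [hF.continuousAt.eventually_ne h] with y hy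
      exact ⟨fun h => absurd h hy, fun _ => rfl⟩

/-- Lipschitz estimates for a slope field vanishing far away -/
lemma slope_lip (σ : ℝ × ℝ → ℝ) (hσ : ContDiff ℝ 1 σ) (c : ℝ) (hc : ∀ x : ℝ × ℝ, 2*|x.1| + c ≤ |x.2| → σ x = 0)
    (R : ℝ) : ∃ K : NNReal, ∃ L : NNReal, ∀ t ∈ Set.Icc (-R) R, LipschitzWith K (fun y => σ (t, y)) ∧ ∀ y, ‖σ (t, y)‖ ≤ L := by
  obtain ⟨d, hd0, hd⟩ : ∃ d : ℝ, 0 ≤ d ∧ 2*R + c ≤ d := ⟨max 0 (2*R+c), le_max_left _ _, le_max_right _ _⟩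
  have hcv : Convex ℝ ((Set.Icc (-R) R) ×ˢ (Set.Icc (-d) d)) := (convex_Icc _ _).prod (convex_Icc _ _)
  have hcp : IsCompact ((Set.Icc (-R) R) ×ˢ (Set.Icc (-d) d)) := isCompact_Icc.prod isCompact_Icc
  obtain ⟨K, hK⟩ := hσ.contDiffOn.exists_lipschitzOnWith (by norm_num) hcv hcp
  obtain ⟨L, hL⟩ := hcp.exists_bound_of_continuousOn hσ.continuous.continuousOn
  have key : ∀ t ∈ Set.Icc (-R) R, ∀ y, max (-d) (min d y) ∈ Set.Icc (-d) d ∧ σ (t, y) = σ (t, max (-d) (min d y)) := by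
    intro t ht y
    have ht' : |t| ≤ R := abs_le.2 ht
    refine ⟨⟨le_max_left _ _, max_le (by linarith) (min_le_left _ _)⟩, ?_⟩
    rcases lt_or_ge y (-d) with h | h
    · rw [min_eq_right (by linarith), max_eq_left h.le, hc, hc]
      · simp only [abs_neg, abs_of_nonneg hd0]; linarith
      · simp only; linarith [neg_le_abs y]
    · rcases lt_or_ge d y with h' | h'
      · rw [min_eq_left h'.le, max_eq_right (by linarith), hc, hc]
        · simp only [abs_of_nonneg hd0]; linarith
        · simp only; linarith [le_abs_self y]
      · rw [min_eq_right h', max_eq_right h]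
  refine ⟨K, Real.toNNReal L, fun t ht => ⟨?_, ?_⟩⟩
  · refine LipschitzWith.of_dist_le_mul fun y z => ?_
    rw [(key t ht y).2, (key t ht z).2]
    have := hK.dist_le_mul (t, max (-d) (min d y)) ⟨ht, (key t ht y).1⟩ (t, max (-d) (min d z)) ⟨ht, (key t ht z).1⟩
    refine this.trans ?_
    gcongr
    rw [Prod.dist_eq, dist_self]
    refine max_le dist_nonneg ?_
    rw [Real.dist_eq, Real.dist_eq]
    refine (abs_max_sub_max_le_max _ _ _ _).trans ?_
    rw [sub_self, abs_zero]
    refine max_le (abs_nonneg _) ((abs_min_sub_min_le_max _ _ _ _).trans ?_)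
    rw [sub_self, abs_zero]
    exact max_le (abs_nonneg _) le_rfl
  · intro y
    rw [(key t ht y).2]
    exact (hL (t, max (-d) (min d y)) ⟨ht, (key t ht y).1⟩).trans (Real.le_coe_toNNReal L)

/-- global leaf of the slope field -/
def IsLeaf (σ : ℝ × ℝ → ℝ) (f : ℝ → ℝ) : Prop := ∀ t, HasDerivAt f (σ (t, f t)) t

lemma leaf_exists (σ : ℝ × ℝ → ℝ) (hσ : ContDiff ℝ 1 σ) (c : ℝ) (hc : ∀ x : ℝ × ℝ, 2*|x.1| + c ≤ |x.2| → σ x = 0)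
    (x : ℝ × ℝ) : ∃ f, IsLeaf σ f ∧ f x.1 = x.2 := by
  have step : ∀ R : ℝ, |x.1| < R → ∃ f : ℝ → ℝ, f x.1 = x.2 ∧ ∀ t ∈ Set.Ioo (-R) R, HasDerivAt f (σ (t, f t)) t := by
    intro R hR
    obtain ⟨K, L, hKL⟩ := slope_lip σ hσ c hc R
    have hR0 : 0 < R := (abs_nonneg _).trans_lt hR
    have hx : x.1 ∈ Set.Icc (-R) R := abs_le.1 hR.le
    have : IsPicardLindelof (fun t y => σ (t, y)) (⟨x.1, hx⟩ : Set.Icc (-R) R) x.2 (L * (Real.toNNReal (2*R))) 0 L K := by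
      refine ⟨fun t ht => (hKL t ht).1.lipschitzOnWith, fun y _ => ?_, fun t ht y _ => (hKL t ht).2 y, ?_⟩
      · have := hσ.continuous
        fun_prop
      · push_cast
        rw [Real.coe_toNNReal _ (by linarith), sub_zero]
        refine mul_le_mul_of_nonneg_left (max_le ?_ ?_) L.2
        · have := hx.1; linarith
        · have := hx.2; linarith
    obtain ⟨f, hf0, hf⟩ := this.exists_eq_forall_mem_Icc_hasDerivWithinAt₀
    exact ⟨f, hf0, fun t ht => (hf t (Set.Ioo_subset_Icc_self ht)).hasDerivAt (Icc_mem_nhds ht.1 ht.2)⟩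
  choose! g hg0 hg using step
  have glue : ∀ R S, |x.1| < R → R ≤ S → Set.EqOn (g R) (g S) (Set.Ioo (-R) R) := by
    intro R S hR hS
    obtain ⟨K, L, hKL⟩ := slope_lip σ hσ c hc R
    refine ODE_solution_unique_of_mem_Ioo (v := fun t y => σ (t, y)) (s := fun _ => Set.univ) (K := K) (t₀ := x.1)
      (fun t ht => (hKL t (Set.Ioo_subset_Icc_self ht)).1.lipschitzOnWith) (abs_lt.1 hR) ?_ ?_ ?_
    · exact fun t ht => ⟨hg R hR t ht, trivial⟩
    · exact fun t ht => ⟨hg S (hR.trans_le hS) t ⟨by linarith [ht.1], by linarith [ht.2]⟩, trivial⟩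
    · rw [hg0 R hR, hg0 S (hR.trans_le hS)]
  have hR : ∀ t, |x.1| < |x.1| + |t| + 1 := fun t => by have := abs_nonneg t; linarith
  refine ⟨fun t => g (|x.1| + |t| + 1) t, fun t => ?_, hg0 _ (hR _)⟩
  have hR2 : |x.1| < |x.1| + |t| + 2 := by have := abs_nonneg t; linarith
  have e : ∀ s, |s| < |t| + 1 → g (|x.1| + |s| + 1) s = g (|x.1| + |t| + 2) s := by
    intro s hs
    refine glue _ _ (hR s) (by linarith) (abs_lt.1 ?_)
    have := abs_nonneg x.1
    linarith
  have h1 := hg _ hR2 t (abs_lt.1 (by have := abs_nonneg x.1; linarith))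
  simp only []
  rw [e t (by linarith)]
  refine h1.congr_of_eventuallyEq ?_
  have : ∀ᶠ s in nhds t, |s| < |t| + 1 := continuous_abs.continuousAt.eventually_lt continuousAt_const (by simp)
  filter_upwards [this] with s hs using e s hs

lemma leaf_unique (σ : ℝ × ℝ → ℝ) (hσ : ContDiff ℝ 1 σ) (c : ℝ) (hc : ∀ x : ℝ × ℝ, 2*|x.1| + c ≤ |x.2| → σ x = 0)
    (f g : ℝ → ℝ) (hf : IsLeaf σ f) (hg : IsLeaf σ g) (t₀ : ℝ) (h : f t₀ = g t₀) (t : ℝ) : f t = g t := by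
  set R := |t₀| + |t| + 1
  obtain ⟨K, L, hKL⟩ := slope_lip σ hσ c hc R
  have := ODE_solution_unique_of_mem_Ioo (v := fun t y => σ (t, y)) (s := fun _ => Set.univ) (K := K) (t₀ := t₀) (f := f) (g := g) (a := -R) (b := R)
      (fun t ht => (hKL t (Set.Ioo_subset_Icc_self ht)).1.lipschitzOnWith) (abs_lt.1 (by have := abs_nonneg t; simp only [R]; linarith))
      (fun t ht => ⟨hf t, trivial⟩) (fun t ht => ⟨hg t, trivial⟩) h
  exact this (abs_lt.1 (by have := abs_nonneg t₀; simp only [R]; linarith))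

lemma leaf_lt (σ : ℝ × ℝ → ℝ) (hσ : ContDiff ℝ 1 σ) (c : ℝ) (hc : ∀ x : ℝ × ℝ, 2*|x.1| + c ≤ |x.2| → σ x = 0)
    (f g : ℝ → ℝ) (hf : IsLeaf σ f) (hg : IsLeaf σ g) (t₀ : ℝ) (h : f t₀ < g t₀) (t : ℝ) : f t < g t := by
  by_contra hcon
  push Not at hcon
  have cf : Continuous f := continuous_iff_continuousAt.2 fun t => (hf t).continuousAt
  have cg : Continuous g := continuous_iff_continuousAt.2 fun t => (hg t).continuousAt
  obtain ⟨s, hs⟩ := mem_range_of_exists_le_of_exists_ge (f := fun t => g t - f t) (c := 0) (by fun_prop) ⟨t, by simpa using hcon⟩ ⟨t₀, by simpa using h.le⟩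
  have := leaf_unique σ hσ c hc f g hf hg s (by simp only at hs; linarith) t₀
  linarith

/-- the transversal coordinate -/
lemma exists_Theta (σ : ℝ × ℝ → ℝ) (hσ : ContDiff ℝ 1 σ) (c : ℝ) (hc : ∀ x : ℝ × ℝ, 2*|x.1| + c ≤ |x.2| → σ x = 0) :
    ∃ (Λ : ℝ × ℝ → ℝ → ℝ) (Θ : ℝ × ℝ → ℝ), Continuous Θ ∧ (∀ x, IsLeaf σ (Λ x)) ∧ (∀ x, Λ x x.1 = x.2) ∧
      (∀ x y, Λ x y.1 < y.2 → Θ x < Θ y) ∧ (∀ x y, y.2 < Λ x y.1 → Θ y < Θ x) := by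
  choose Λ h1 h2 using leaf_exists σ hσ c hc
  have lt := leaf_lt σ hσ c hc
  have L1 : ∀ x y, Λ x y.1 < y.2 → Λ x 0 < Λ y 0 := fun x y h => lt _ _ (h1 x) (h1 y) y.1 (by rwa [h2]) 0
  have L2 : ∀ x y, y.2 < Λ x y.1 → Λ y 0 < Λ x 0 := fun x y h => lt _ _ (h1 y) (h1 x) y.1 (by rwa [h2]) 0
  refine ⟨Λ, fun x => Λ x 0, ?_, h1, h2, L1, L2⟩
  have cL : ∀ x, Continuous (Λ x) := fun x => continuous_iff_continuousAt.2 fun t => (h1 x t).continuousAt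
  rw [OrderTopology.continuous_iff]
  intro a
  have e : Λ (0, a) 0 = a := h2 (0,a)
  have M : ∀ x : ℝ × ℝ, (Λ x 0 < a ↔ x.2 < Λ (0,a) x.1) ∧ (a < Λ x 0 ↔ Λ (0,a) x.1 < x.2) := by
    intro x
    rcases lt_trichotomy x.2 (Λ (0,a) x.1) with h | h | h
    · have := L2 _ _ h
      rw [e] at this
      exact ⟨by simp [h, this], by simp [not_lt.2 h.le, this.le]⟩
    · have := leaf_unique σ hσ c hc (Λ x) (Λ (0,a)) (h1 _) (h1 _) x.1 (by rw [h2, h]) 0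
      rw [e] at this
      exact ⟨by simp [h, this], by simp [h, this]⟩
    · have := L1 _ _ h
      rw [e] at this
      exact ⟨by simp [not_lt.2 h.le, this.le], by simp [h, this]⟩
  constructor
  · have : (fun x => Λ x 0) ⁻¹' Set.Ioi a = {x : ℝ × ℝ | Λ (0,a) x.1 < x.2} := by ext x; exact (M x).2
    rw [this]
    exact isOpen_lt ((cL _).comp continuous_fst) continuous_snd
  · have : (fun x => Λ x 0) ⁻¹' Set.Iio a = {x : ℝ × ℝ | x.2 < Λ (0,a) x.1} := by ext x; exact (M x).1
    rw [this]
    exact isOpen_lt continuous_snd ((cL _).comp continuous_fst)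

end QES

namespace QES

structure Fol (F A B σ : ℝ × ℝ → ℝ) (Λ : ℝ × ℝ → ℝ → ℝ) (Θ : ℝ × ℝ → ℝ) : Prop where
  cF : Continuous F
  cA : Continuous A
  strict : ∀ x : ℝ × ℝ, ∀ η > 0, ∃ δ > 0, ∀ y z : ℝ × ℝ, dist y x < δ → dist z x < δ →
    |F y - F z - (A x * (y.2 - z.2) + B x * (y.1 - z.1))| ≤ η * (|y.2 - z.2| + |y.1 - z.1|)
  cσ : Continuous σ
  σneg : ∀ x, F x = 0 → σ x * A x + B x < 0
  σbd : ∀ R : ℝ, ∃ L : ℝ, 0 ≤ L ∧ ∀ t ∈ Set.Icc (-R) R, ∀ y, |σ (t, y)| ≤ L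
  cΘ : Continuous Θ
  leaf : ∀ x, IsLeaf σ (Λ x)
  init : ∀ x, Λ x x.1 = x.2
  lt : ∀ x y, Λ x y.1 < y.2 → Θ x < Θ y
  gt : ∀ x y, y.2 < Λ x y.1 → Θ y < Θ x

section
variable {F A B σ : ℝ × ℝ → ℝ} {Λ : ℝ × ℝ → ℝ → ℝ} {Θ : ℝ × ℝ → ℝ}

lemma Fol.mvt (H : Fol F A B σ Λ Θ) (x : ℝ × ℝ) (a c : ℝ) (s0 C : ℝ)
    (h : ∀ t ∈ Set.uIcc a c, |σ (t, Λ x t) - s0| ≤ C) : |Λ x c - Λ x a - s0 * (c - a)| ≤ C * |c - a| := by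
  have := (convex_uIcc a c).norm_image_sub_le_of_norm_hasDerivWithin_le (f := fun t => Λ x t - s0 * t)
    (f' := fun t => σ (t, Λ x t) - s0) (C := C) (x := a) (y := c)
    (fun t ht => (((H.leaf x t).sub ((hasDerivAt_id t).const_mul s0)).congr_deriv (by ring)).hasDerivWithinAt)
    (fun t ht => h t ht) Set.left_mem_uIcc Set.right_mem_uIcc
  rw [Real.norm_eq_abs, Real.norm_eq_abs] at this
  refine le_trans (le_of_eq ?_) this
  congr 1; ring

/-- local estimate for leaves -/
lemma Fol.leafEst (H : Fol F A B σ Λ Θ) (x : ℝ × ℝ) (η : ℝ) (hη : 0 < η) : ∃ δ > 0, ∀ y z : ℝ × ℝ,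
    dist y x < δ → dist z x < δ → |Λ y z.1 - y.2 - σ x * (z.1 - y.1)| ≤ η * |z.1 - y.1| := by
  obtain ⟨r, hr, hs⟩ := Metric.continuous_iff.1 H.cσ x η hη
  obtain ⟨L, hL0, hL⟩ := H.σbd (|x.1| + 1)
  have hpos : 0 < min 1 (r / (2*L+1)) := lt_min one_pos (by positivity)
  refine ⟨min 1 (r / (2*L+1)), hpos, fun y z hy hz => ?_⟩
  set δ := min 1 (r / (2*L+1))
  have hδ1 : δ ≤ 1 := min_le_left _ _
  have hδ2 : δ * (2*L+1) ≤ r := by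
    have : δ ≤ r / (2*L+1) := min_le_right _ _
    rwa [le_div_iff₀ (by positivity)] at this
  have hδr : δ ≤ r := by nlinarith
  rw [Prod.dist_eq, max_lt_iff, Real.dist_eq, Real.dist_eq] at hy hz
  have hseg : ∀ t ∈ Set.uIcc y.1 z.1, |t - x.1| < δ := by
    intro t ht
    rw [abs_lt] at *
    rcases Set.mem_uIcc.1 ht with h | h <;> constructor <;> linarith [h.1, h.2, hy.1.1, hy.1.2, hz.1.1, hz.1.2]
  have hI : ∀ t, |t - x.1| < δ → t ∈ Set.Icc (-(|x.1|+1)) (|x.1|+1) := by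
    intro t ht
    refine abs_le.1 ?_
    calc |t| = |(t - x.1) + x.1| := by ring_nf
      _ ≤ |t - x.1| + |x.1| := abs_add_le _ _
      _ ≤ _ := by linarith
  have hin : ∀ t ∈ Set.uIcc y.1 z.1, |Λ y t - x.2| < r := by
    intro t ht
    have h1 := H.mvt y y.1 t 0 L (fun s hs => by
      rw [sub_zero]
      exact hL s (hI s (hseg s (Set.uIcc_subset_uIcc_left ht hs))) _)
    rw [H.init, zero_mul, sub_zero] at h1
    have h2 : |t - y.1| ≤ 2 * δ := by
      have a1 := hseg t ht
      have a2 := hy.1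
      rw [abs_lt] at a1 a2
      rw [abs_le]
      constructor <;> linarith [a1.1, a1.2, a2.1, a2.2]
    calc |Λ y t - x.2| = |(Λ y t - y.2) + (y.2 - x.2)| := by ring_nf
      _ ≤ |Λ y t - y.2| + |y.2 - x.2| := abs_add_le _ _
      _ < L * (2*δ) + δ := add_lt_add_of_le_of_lt (h1.trans (mul_le_mul_of_nonneg_left h2 hL0)) hy.2
      _ = δ * (2*L+1) := by ring
      _ ≤ r := hδ2
  have := H.mvt y y.1 z.1 (σ x) η (fun t ht => by
    have := hs (t, Λ y t) (by
      rw [Prod.dist_eq, max_lt_iff, Real.dist_eq, Real.dist_eq]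
      exact ⟨(hseg t ht).trans_le hδr, hin t ht⟩)
    rw [Real.dist_eq] at this
    exact this.le)
  rwa [H.init] at this

/-- local structure of `Θ` on the zero set -/
lemma Fol.loc (H : Fol F A B σ Λ Θ) (x : ℝ × ℝ) (hx : F x = 0) : ∃ C : ℝ, 0 ≤ C ∧ ∃ δ > 0, ∀ y z : ℝ × ℝ,
    dist y x < δ → dist z x < δ → F y = 0 → F z = 0 →
    (|z.1 - y.1| ≤ C * |(z.2 - σ x * z.1) - (y.2 - σ x * y.1)|) ∧
    (y.2 - σ x * y.1 < z.2 - σ x * z.1 → Θ y < Θ z) ∧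
    (0 < A x → y.1 < z.1 → Θ y < Θ z) ∧ (A x < 0 → y.1 < z.1 → Θ z < Θ y) := by
  obtain ⟨κ, hκ⟩ : ∃ κ, κ = -(σ x * A x + B x) := ⟨_, rfl⟩
  have hκ0 : 0 < κ := by rw [hκ]; linarith [H.σneg x hx]
  obtain ⟨η', hη'0, hη'1, hη'2⟩ : ∃ η' > 0, η' * (|σ x| + 1) ≤ κ/2 ∧ (A x ≠ 0 → η' ≤ |A x|) := by
    have hp : 0 < |σ x| + 1 := by positivity
    by_cases h : A x = 0
    · exact ⟨κ/2/(|σ x|+1), by positivity, by rw [div_mul_cancel₀ _ hp.ne'], fun h' => absurd h h'⟩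
    · refine ⟨min (κ/2/(|σ x|+1)) |A x|, lt_min (by positivity) (abs_pos.2 h), ?_, fun _ => min_le_right _ _⟩
      rw [← le_div_iff₀ hp]; exact min_le_left _ _
  obtain ⟨C, hC⟩ : ∃ C, C = 2*(|A x| + η')/κ := ⟨_, rfl⟩
  have hC0 : 0 ≤ C := by rw [hC]; positivity
  obtain ⟨d1, hd1, h1⟩ := H.strict x η' hη'0
  obtain ⟨d2, hd2, h2⟩ := H.leafEst x (1/(C+1)) (by positivity)
  refine ⟨C, hC0, min d1 d2, lt_min hd1 hd2, fun y z hy hz Fy Fz => ?_⟩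
  have s1 := h1 z y (hz.trans_le (min_le_left _ _)) (hy.trans_le (min_le_left _ _))
  have s2 := h2 y z (hy.trans_le (min_le_right _ _)) (hz.trans_le (min_le_right _ _))
  obtain ⟨u, hu⟩ : ∃ u, u = (z.2 - σ x * z.1) - (y.2 - σ x * y.1) := ⟨_, rfl⟩
  obtain ⟨d, hd⟩ : ∃ d, d = z.1 - y.1 := ⟨_, rfl⟩
  have e2 : z.2 - y.2 = u + σ x * d := by rw [hu, hd]; ring
  rw [Fy, Fz, e2, ← hd] at s1
  rw [← hd] at s2
  rw [← hd, ← hu]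
  have s3 : |A x * u - κ * d| ≤ η' * |u| + κ/2 * |d| := by
    have a1 : |u + σ x * d| ≤ |u| + |σ x| * |d| := (abs_add_le _ _).trans (by rw [abs_mul])
    have a2 : |A x * u - κ * d| = |0 - 0 - (A x * (u + σ x * d) + B x * d)| := by
      rw [← abs_neg]; congr 1; rw [hκ]; ring
    rw [a2]
    refine s1.trans ?_
    have := mul_le_mul_of_nonneg_left a1 hη'0.le
    have := mul_le_mul_of_nonneg_right hη'1 (abs_nonneg d)
    nlinarith
  have s4 : |d| ≤ C * |u| := by
    have a1 : κ * |d| ≤ |A x| * |u| + |A x * u - κ * d| := by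
      rw [← abs_of_pos hκ0, ← abs_mul, ← abs_mul, abs_of_pos hκ0]
      calc |κ * d| = |A x * u - (A x * u - κ * d)| := by ring_nf
        _ ≤ _ := abs_sub _ _
    have a2 : |d| * κ ≤ 2*(|A x| + η') * |u| := by nlinarith
    rw [hC, div_mul_eq_mul_div, le_div_iff₀ hκ0]; exact a2
  have s5 : ∀ w : ℝ, 0 < w → |d| ≤ C * w → 1/(C+1) * |d| < w := by
    intro w hw h
    rw [div_mul_eq_mul_div, one_mul, div_lt_iff₀ (by positivity)]
    nlinarith
  have up : 0 < u → Θ y < Θ z := by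
    intro h
    apply H.lt
    have := s5 u h (by rwa [abs_of_pos h] at s4)
    have := (abs_le.1 s2).2
    linarith
  have down : u < 0 → Θ z < Θ y := by
    intro h
    apply H.gt
    have := s5 (-u) (by linarith) (by rwa [abs_of_neg h] at s4)
    have := (abs_le.1 s2).1
    linarith
  refine ⟨s4, fun h => up (by linarith), fun hA h => up ?_, fun hA h => down ?_⟩
  · have hd0 : 0 < d := by linarith
    by_contra hcon
    push Not at hcon
    have a := hη'2 hA.ne'
    rw [abs_of_pos hA] at a
    rw [abs_of_nonpos hcon, abs_of_pos hd0] at s3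
    have := (abs_le.1 s3).1
    nlinarith [mul_pos hκ0 hd0]
  · have hd0 : 0 < d := by linarith
    by_contra hcon
    push Not at hcon
    have a := hη'2 hA.ne
    rw [abs_of_neg hA] at a
    rw [abs_of_nonneg hcon, abs_of_pos hd0] at s3
    have := (abs_le.1 s3).1
    nlinarith [mul_pos hκ0 hd0]

lemma Fol.inj (H : Fol F A B σ Λ Θ) (x : ℝ × ℝ) (hx : F x = 0) : ∃ N ∈ nhds x, Set.InjOn Θ (N ∩ {y | F y = 0}) := by
  obtain ⟨C, hC, δ, hδ, h⟩ := H.loc x hx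
  refine ⟨Metric.ball x δ, Metric.ball_mem_nhds _ hδ, ?_⟩
  rintro y ⟨hy, Fy⟩ z ⟨hz, Fz⟩ hyz
  have a := h y z hy hz Fy Fz
  have b := h z y hz hy Fz Fy
  have e : z.2 - σ x * z.1 = y.2 - σ x * y.1 := by
    rcases lt_trichotomy (y.2 - σ x * y.1) (z.2 - σ x * z.1) with h | h | h
    · exact absurd hyz (a.2.1 h).ne
    · exact h.symm
    · exact absurd hyz (b.2.1 h).ne'
  have e1 := a.1
  rw [e, sub_self, abs_zero, mul_zero] at e1
  have e2 : z.1 - y.1 = 0 := abs_eq_zero.1 (le_antisymm e1 (abs_nonneg _))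
  have e3 : z.1 = y.1 := by linarith
  rw [e3] at e
  exact Prod.ext e3.symm (by linarith)

/-- openness of `Θ` on the zero set -/
lemma Fol.open (H : Fol F A B σ Λ Θ) (x : ℝ × ℝ) (hx : F x = 0) (N : Set (ℝ × ℝ)) (hN : N ∈ nhds x) :
    Θ '' (N ∩ {y | F y = 0}) ∈ nhds (Θ x) := by
  obtain ⟨C, hC, δ0, hδ0, hloc⟩ := H.loc x hx
  obtain ⟨δ1, hδ1, hN⟩ := Metric.mem_nhds_iff.1 hN
  have hneg := H.σneg x hx
  obtain ⟨κ, hκ⟩ : ∃ κ, κ = -(σ x * A x + B x) := ⟨_, rfl⟩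
  have hκ0 : 0 < κ := by rw [hκ]; linarith
  have hp : 0 < |σ x| + 1 := by positivity
  obtain ⟨δ2, hδ2, hst⟩ := H.strict x (κ/2/(|σ x|+1)) (by positivity)
  obtain ⟨δ, hδ, hδle⟩ : ∃ δ > 0, δ ≤ δ0 ∧ δ ≤ δ1 ∧ δ ≤ δ2 :=
    ⟨min δ0 (min δ1 δ2), lt_min hδ0 (lt_min hδ1 hδ2), min_le_left _ _, (min_le_right _ _).trans (min_le_left _ _), (min_le_right _ _).trans (min_le_right _ _)⟩
  -- line points
  obtain ⟨ρ, hρ0, hρ⟩ : ∃ ρ > 0, ρ * (|σ x| + 1) ≤ δ/2 := ⟨δ/2/(|σ x|+1), by positivity, by rw [div_mul_cancel₀ _ hp.ne']⟩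
  set P : ℝ → ℝ → ℝ × ℝ := fun s d => (x.1 + d, x.2 + s + σ x * d) with hP
  have hPd : ∀ s d, |s| < δ/2 → |d| ≤ ρ → dist (P s d) x < δ := by
    intro s d hs hd
    rw [Prod.dist_eq, max_lt_iff, Real.dist_eq, Real.dist_eq]
    have : |d| * (|σ x| + 1) ≤ δ/2 := (mul_le_mul_of_nonneg_right hd hp.le).trans hρ
    have h0 := mul_nonneg (abs_nonneg d) (abs_nonneg (σ x))
    constructor
    · simp only [hP, add_sub_cancel_left]; linarith
    · have : |s + σ x * d| ≤ |s| + |σ x| * |d| := (abs_add_le _ _).trans (by rw [abs_mul])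
      have e : (P s d).2 - x.2 = s + σ x * d := by simp only [hP]; ring
      rw [e]; nlinarith [abs_nonneg d]
  have hF0 : ∀ d, |d| ≤ ρ → |F (P 0 d) + κ * d| ≤ κ/2 * |d| := by
    intro d hd
    have := hst (P 0 d) x ((hPd 0 d (by simpa using hδ) hd).trans_le hδle.2.2) (by simpa using hδ2)
    rw [hx] at this
    have e1 : F (P 0 d) - 0 - (A x * ((P 0 d).2 - x.2) + B x * ((P 0 d).1 - x.1)) = F (P 0 d) + κ * d := by
      simp only [hP, hκ]; ring
    have e2 : (P 0 d).2 - x.2 = σ x * d := by simp only [hP]; ring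
    have e3 : (P 0 d).1 - x.1 = d := by simp only [hP]; ring
    rw [e1, e2, e3, abs_mul] at this
    refine this.trans (le_of_eq ?_)
    field_simp
  have hpos : 0 < F (P 0 (-ρ)) := by
    have := (abs_le.1 (hF0 (-ρ) (by rw [abs_neg, abs_of_pos hρ0]))).1
    rw [abs_neg, abs_of_pos hρ0] at this
    nlinarith [mul_pos hκ0 hρ0]
  have hneg' : F (P 0 ρ) < 0 := by
    have := (abs_le.1 (hF0 ρ (by rw [abs_of_pos hρ0]))).2
    rw [abs_of_pos hρ0] at this
    nlinarith [mul_pos hκ0 hρ0]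
  have cF := H.cF
  have cP : Continuous (fun v : ℝ × ℝ => F (P v.1 v.2)) := by simp only [hP]; fun_prop
  have ev1 : ∀ᶠ s in nhds (0:ℝ), 0 < F (P s (-ρ)) :=
    (continuous_const.tendsto (0:ℝ)).eventually_lt ((cP.comp (Continuous.prodMk_left (-ρ))).tendsto 0) hpos
  have ev2 : ∀ᶠ s in nhds (0:ℝ), F (P s ρ) < 0 :=
    ((cP.comp (Continuous.prodMk_left ρ)).tendsto 0).eventually_lt (continuous_const.tendsto (0:ℝ)) hneg'
  obtain ⟨r, hr, hr2⟩ := Metric.eventually_nhds_iff.1 (ev1.and ev2)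
  obtain ⟨τ, hτ0, hτ1, hτ2⟩ : ∃ τ > 0, τ < r ∧ τ < δ/2 := ⟨min (r/2) (δ/4), by positivity, by
    have := min_le_left (r/2) (δ/4); linarith, by have := min_le_right (r/2) (δ/4); linarith⟩
  have ex : ∀ s, |s| ≤ τ → ∃ d, |d| ≤ ρ ∧ F (P s d) = 0 := by
    intro s hs
    have h2 := hr2 (y := s) (by rw [Real.dist_eq, sub_zero]; linarith)
    have hc : ContinuousOn (fun d => F (P s d)) (Set.Icc (-ρ) ρ) := by
      have : Continuous (fun d => F (P s d)) := cP.comp (Continuous.prodMk_right s)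
      exact this.continuousOn
    obtain ⟨d, hd, hd2⟩ := intermediate_value_Icc' (by linarith) hc ⟨h2.2.le, h2.1.le⟩
    exact ⟨d, abs_le.2 hd, hd2⟩
  choose! D hD1 hD2 using ex
  have dd : ∀ s, |s| ≤ τ → dist (P s (D s)) x < δ := fun s hs => hPd s _ (by linarith) (hD1 s hs)
  have lip : ∀ s s', |s| ≤ τ → |s'| ≤ τ → |D s' - D s| ≤ C * |s' - s| := by
    intro s s' hs hs'
    have := (hloc (P s (D s)) (P s' (D s')) ((dd s hs).trans_le hδle.1) ((dd s' hs').trans_le hδle.1) (hD2 s hs) (hD2 s' hs')).1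
    simp only [hP] at this
    have e1 : x.1 + D s' - (x.1 + D s) = D s' - D s := by ring
    have e2 : x.2 + s' + σ x * D s' - σ x * (x.1 + D s') - (x.2 + s + σ x * D s - σ x * (x.1 + D s)) = s' - s := by ring
    rwa [e1, e2] at this
  have mono : ∀ s s', |s| ≤ τ → |s'| ≤ τ → s < s' → Θ (P s (D s)) < Θ (P s' (D s')) := by
    intro s s' hs hs' hlt
    refine (hloc (P s (D s)) (P s' (D s')) ((dd s hs).trans_le hδle.1) ((dd s' hs').trans_le hδle.1) (hD2 s hs) (hD2 s' hs')).2.1 ?_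
    simp only [hP]; linarith
  have cD : ContinuousOn D (Set.Icc (-τ) τ) := by
    have : LipschitzOnWith (Real.toNNReal C) D (Set.Icc (-τ) τ) := LipschitzOnWith.of_dist_le_mul (fun s hs s' hs' => by
      rw [Real.dist_eq, Real.dist_eq, Real.coe_toNNReal _ hC]
      exact lip s' s (abs_le.2 hs') (abs_le.2 hs))
    exact this.continuousOn
  have c0 : D 0 = 0 := by
    have h0 : P 0 0 = x := by simp [hP]
    have := (hloc (P 0 (D 0)) x ((dd 0 (by simpa using hτ0.le)).trans_le hδle.1) (by simpa using hδ0) (hD2 0 (by simpa using hτ0.le)) hx).1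
    have e : (x.2 - σ x * x.1) - ((P 0 (D 0)).2 - σ x * (P 0 (D 0)).1) = 0 := by simp only [hP]; ring
    rw [e, abs_zero, mul_zero] at this
    have e2 := abs_eq_zero.1 (le_antisymm this (abs_nonneg _))
    simp only [hP] at e2
    linarith
  have hx0 : P 0 (D 0) = x := by rw [c0]; simp [hP]
  have cΘ := H.cΘ
  have cT : ContinuousOn (fun s => Θ (P s (D s))) (Set.Icc (-τ) τ) := by
    refine cΘ.comp_continuousOn ?_
    simp only [hP]
    fun_prop
  have hτa : |τ| ≤ τ := by rw [abs_of_pos hτ0]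
  have hτb : |(-τ)| ≤ τ := by rw [abs_neg, abs_of_pos hτ0]
  have h0a : |(0:ℝ)| ≤ τ := by simpa using hτ0.le
  have m1 := mono (-τ) 0 hτb h0a (by linarith)
  have m2 := mono 0 τ h0a hτa hτ0
  rw [hx0] at m1 m2
  refine mem_of_superset (Icc_mem_nhds m1 m2) ?_
  intro v hv
  obtain ⟨s, hs, rfl⟩ := intermediate_value_Icc (by linarith) cT hv
  exact ⟨P s (D s), ⟨hN ((dd s (abs_le.2 hs)).trans_le hδle.2.1), hD2 s (abs_le.2 hs)⟩, rfl⟩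

end
end QES

namespace QES

lemma locMono (θ : ℝ → ℝ) (I : Set ℝ) (hI : I.OrdConnected) (hc : ContinuousOn θ I)
    (h : ∀ b ∈ I, ∃ δ > 0, ∀ y ∈ I, ∀ z ∈ I, |y - b| < δ → |z - b| < δ → y < z → θ y < θ z) : StrictMonoOn θ I := by
  intro a ha c hcI hac
  have hsub : Set.Icc a c ⊆ I := hI.out ha hcI
  have key : ∀ p ∈ Set.Icc a c, p < c → ∃ q ∈ Set.Icc a c, θ p < θ q := by
    intro p hp hpc
    obtain ⟨δ, hδ, h⟩ := h p (hsub hp)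
    have hm : p < min c (p + δ/2) := lt_min hpc (by linarith)
    refine ⟨min c (p+δ/2), ⟨hp.1.trans hm.le, min_le_left _ _⟩, ?_⟩
    refine h p (hsub hp) _ (hsub ⟨hp.1.trans hm.le, min_le_left _ _⟩) (by simpa using hδ) ?_ hm
    rw [abs_of_pos (by linarith)]
    have := min_le_right c (p+δ/2)
    linarith
  obtain ⟨p, hp, hmax⟩ := isCompact_Icc.exists_isMaxOn ⟨a, Set.left_mem_Icc.2 hac.le⟩ (hc.mono hsub)
  replace hmax : ∀ y ∈ Set.Icc a c, θ y ≤ θ p := fun y hy => hmax hy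
  rcases hp.2.eq_or_lt with h1 | h1
  · subst h1
    rcases (hmax a (Set.left_mem_Icc.2 hac.le)).eq_or_lt with h2 | h2
    · obtain ⟨q, hq, hq2⟩ := key a (Set.left_mem_Icc.2 hac.le) hac
      have := hmax q hq
      linarith
    · exact h2
  · obtain ⟨q, hq, hq2⟩ := key p hp h1
    have := hmax q hq
    linarith

section
variable {F A B σ : ℝ × ℝ → ℝ} {Λ : ℝ × ℝ → ℝ → ℝ} {Θ : ℝ × ℝ → ℝ}

lemma Fol.tail (H : Fol F A B σ Λ Θ) (I : Set ℝ) (hI : I.OrdConnected) (g : ℝ → ℝ) (hg : ContinuousOn g I)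
    (hF : ∀ b ∈ I, F (b, g b) = 0) : ((∀ b ∈ I, 0 < A (b, g b)) → StrictMonoOn (fun b => Θ (b, g b)) I) ∧
      ((∀ b ∈ I, A (b, g b) < 0) → StrictAntiOn (fun b => Θ (b, g b)) I) := by
  have hc : ContinuousOn (fun b => (b, g b)) I := continuousOn_id.prodMk hg
  have hT : ContinuousOn (fun b => Θ (b, g b)) I := H.cΘ.comp_continuousOn hc
  have near : ∀ b ∈ I, ∀ δ > 0, ∃ r > 0, ∀ y ∈ I, |y - b| < r → dist ((y, g y) : ℝ × ℝ) (b, g b) < δ := by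
    intro b hb δ hδ
    obtain ⟨r, hr, h⟩ := Metric.continuousOn_iff.1 hc b hb δ hδ
    exact ⟨r, hr, fun y hy hyb => h y hy hyb⟩
  constructor
  · intro hA
    refine locMono _ I hI hT fun b hb => ?_
    obtain ⟨C, hC, δ, hδ, hl⟩ := H.loc (b, g b) (hF b hb)
    obtain ⟨r, hr, hn⟩ := near b hb δ hδ
    exact ⟨r, hr, fun y hy z hz hyb hzb hyz => (hl (y, g y) (z, g z) (hn y hy hyb) (hn z hz hzb) (hF y hy) (hF z hz)).2.2.1 (hA b hb) hyz⟩
  · intro hA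
    have : StrictMonoOn (fun b => - Θ (b, g b)) I := by
      refine locMono _ I hI hT.neg fun b hb => ?_
      obtain ⟨C, hC, δ, hδ, hl⟩ := H.loc (b, g b) (hF b hb)
      obtain ⟨r, hr, hn⟩ := near b hb δ hδ
      exact ⟨r, hr, fun y hy z hz hyb hzb hyz => neg_lt_neg <| (hl (y, g y) (z, g z) (hn y hy hyb) (hn z hz hzb) (hF y hy) (hF z hz)).2.2.2 (hA b hb) hyz⟩
    intro y hy z hz hyz
    exact neg_lt_neg_iff.1 (this hy hz hyz)
end

lemma interval_param (A : Set ℝ) (ho : IsOpen A) (hc : A.OrdConnected) (hne : A.Nonempty) :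
    ∃ χ : ℝ → ℝ, Continuous χ ∧ StrictMono χ ∧ Set.range χ = A := by
  set A' := Real.arctan '' A with hA'
  have hne' : A'.Nonempty := hne.image _
  have bb : BddBelow A' := ⟨-(Real.pi/2), by rintro _ ⟨v, _, rfl⟩; exact (Real.neg_pi_div_two_lt_arctan v).le⟩
  have ba : BddAbove A' := ⟨(Real.pi/2), by rintro _ ⟨v, _, rfl⟩; exact (Real.arctan_lt_pi_div_two v).le⟩
  obtain ⟨i, hi⟩ : ∃ i, i = sInf A' := ⟨_, rfl⟩
  obtain ⟨s, hs⟩ : ∃ s, s = sSup A' := ⟨_, rfl⟩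
  have hmem : ∀ v, v ∈ A ↔ Real.arctan v ∈ Set.Ioo i s := by
    intro v
    constructor
    · intro hv
      obtain ⟨ε, hε, hb⟩ := Metric.isOpen_iff.1 ho v hv
      constructor
      · have : v - ε/2 ∈ A := hb (by rw [Metric.mem_ball, Real.dist_eq, abs_lt]; constructor <;> linarith)
        have h1 : i ≤ Real.arctan (v - ε/2) := hi ▸ csInf_le bb ⟨_, this, rfl⟩
        exact h1.trans_lt (Real.arctan_strictMono (by linarith))
      · have : v + ε/2 ∈ A := hb (by rw [Metric.mem_ball, Real.dist_eq, abs_lt]; constructor <;> linarith)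
        have h1 : Real.arctan (v + ε/2) ≤ s := hs ▸ le_csSup ba ⟨_, this, rfl⟩
        exact lt_of_lt_of_le (Real.arctan_strictMono (by linarith)) h1
    · rintro ⟨h1, h2⟩
      rw [hi] at h1; rw [hs] at h2
      obtain ⟨_, ⟨p, hp, rfl⟩, hp2⟩ := exists_lt_of_csInf_lt hne' h1
      obtain ⟨_, ⟨q, hq, rfl⟩, hq2⟩ := exists_lt_of_lt_csSup hne' h2
      exact hc.out hp hq ⟨(Real.arctan_strictMono.lt_iff_lt.1 hp2).le, (Real.arctan_strictMono.lt_iff_lt.1 hq2).le⟩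
  have his : i < s := by
    obtain ⟨v, hv⟩ := hne
    have := (hmem v).1 hv
    exact this.1.trans this.2
  have hi0 : -(Real.pi/2) ≤ i := hi ▸ le_csInf hne' (by rintro _ ⟨v, _, rfl⟩; exact (Real.neg_pi_div_two_lt_arctan v).le)
  have hs0 : s ≤ Real.pi/2 := hs ▸ csSup_le hne' (by rintro _ ⟨v, _, rfl⟩; exact (Real.arctan_lt_pi_div_two v).le)
  have hpi := Real.pi_pos
  set ψ : ℝ → ℝ := fun t => i + (s - i) * (Real.arctan t / Real.pi + 1/2) with hψ
  have ψm : ∀ t, ψ t ∈ Set.Ioo i s := by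
    intro t
    have h1 : -(1/2) < Real.arctan t / Real.pi := by
      rw [lt_div_iff₀ hpi]; have := Real.neg_pi_div_two_lt_arctan t; linarith
    have h2 : Real.arctan t / Real.pi < 1/2 := by
      rw [div_lt_iff₀ hpi]; have := Real.arctan_lt_pi_div_two t; linarith
    have h3 : 0 < s - i := by linarith
    simp only [hψ]
    constructor
    · nlinarith
    · nlinarith
  have ψI : ∀ t, ψ t ∈ Set.Ioo (-(Real.pi/2)) (Real.pi/2) := fun t => ⟨hi0.trans_lt (ψm t).1, (ψm t).2.trans_le hs0⟩
  have ψc : Continuous ψ := by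
    have := Real.continuous_arctan
    simp only [hψ]; fun_prop
  have ψs : StrictMono ψ := by
    intro a b hab
    have := Real.arctan_strictMono hab
    have h3 : 0 < s - i := by linarith
    have : Real.arctan a / Real.pi < Real.arctan b / Real.pi := by gcongr
    simp only [hψ]; nlinarith
  refine ⟨fun t => Real.tan (ψ t), ?_, ?_, ?_⟩
  · exact Real.continuousOn_tan_Ioo.comp_continuous ψc ψI
  · intro a b hab
    exact Real.strictMonoOn_tan (ψI a) (ψI b) (ψs hab)
  · ext v
    constructor
    · rintro ⟨t, rfl⟩
      rw [hmem]
      simp only []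
      rw [Real.arctan_tan (ψI t).1 (ψI t).2]
      exact ψm t
    · intro hv
      have h := (hmem v).1 hv
      have h3 : 0 < s - i := by linarith
      obtain ⟨w, hw⟩ : ∃ w, w = ((Real.arctan v - i)/(s-i) - 1/2) * Real.pi := ⟨_, rfl⟩
      have a1 : 0 < (Real.arctan v - i)/(s-i) := div_pos (by linarith [h.1]) h3
      have a2 : (Real.arctan v - i)/(s-i) < 1 := by rw [div_lt_one h3]; linarith [h.2]
      refine ⟨Real.tan w, ?_⟩
      have : ψ (Real.tan w) = Real.arctan v := by
        simp only [hψ]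
        rw [Real.arctan_tan (by rw [hw]; nlinarith) (by rw [hw]; nlinarith), hw]
        field_simp
        ring
      simp only []
      rw [this, Real.tan_arctan]

/-- the abstract parametrization lemma -/
lemma param (Θ : ℝ × ℝ → ℝ) (hΘ : Continuous Θ) (Γ : Set (ℝ × ℝ)) (hcl : IsClosed Γ)
    (hinj : ∀ x ∈ Γ, ∃ N ∈ nhds x, Set.InjOn Θ (N ∩ Γ))
    (hop : ∀ x ∈ Γ, ∀ N ∈ nhds x, Θ '' (N ∩ Γ) ∈ nhds (Θ x))
    (K : Set (ℝ × ℝ)) (hK : IsCompact K) (R : ℝ) (o ι : ℝ → ℝ × ℝ)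
    (ho : ContinuousOn o (Set.Ici R)) (hι : ContinuousOn ι (Set.Ici R))
    (hoK : o R ∈ K) (hιK : ι R ∈ K) (hΓ : Γ = K ∪ o '' Set.Ici R ∪ ι '' Set.Ici R)
    (mo : StrictMonoOn (fun t => Θ (o t)) (Set.Ici R)) (mι : StrictAntiOn (fun t => Θ (ι t)) (Set.Ici R)) :
    ∃ f : ℝ → ℝ × ℝ, Continuous f ∧ Function.Injective f ∧ (∀ K, IsCompact K → IsCompact (f ⁻¹' K)) ∧
      Set.range f = Γ := by
  have hKΓ : K ⊆ Γ := by rw [hΓ]; exact fun x hx => Or.inl (Or.inl hx)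
  have hoΓ : ∀ t, R ≤ t → o t ∈ Γ := fun t ht => by rw [hΓ]; exact Or.inl (Or.inr ⟨t, ht, rfl⟩)
  have hιΓ : ∀ t, R ≤ t → ι t ∈ Γ := fun t ht => by rw [hΓ]; exact (Or.inr ⟨t, ht, rfl⟩)
  obtain ⟨xM, hxM, hM⟩ := hK.exists_isMaxOn ⟨_, hoK⟩ hΘ.continuousOn
  obtain ⟨xm, hxm, hm⟩ := hK.exists_isMinOn ⟨_, hoK⟩ hΘ.continuousOn
  replace hM : ∀ y ∈ K, Θ y ≤ Θ xM := fun y hy => hM hy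
  replace hm : ∀ y ∈ K, Θ xm ≤ Θ y := fun y hy => hm hy
  -- every value can be exceeded
  have up : ∀ x ∈ Γ, ∀ a > Θ x, ∃ y ∈ Γ, Θ x < Θ y ∧ Θ y < a := by
    intro x hx a ha
    have := inter_mem (mem_nhdsWithin_of_mem_nhds (hop x hx Set.univ univ_mem)) (Ioo_mem_nhdsGT ha)
    obtain ⟨_, ⟨y, hy, rfl⟩, hv⟩ := (nonempty_of_mem this)
    exact ⟨y, hy.2, hv.1, hv.2⟩
  have dn : ∀ x ∈ Γ, ∀ a < Θ x, ∃ y ∈ Γ, Θ y < Θ x ∧ a < Θ y := by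
    intro x hx a ha
    have := inter_mem (mem_nhdsWithin_of_mem_nhds (hop x hx Set.univ univ_mem)) (Ioo_mem_nhdsLT ha)
    obtain ⟨_, ⟨y, hy, rfl⟩, hv⟩ := (nonempty_of_mem this)
    exact ⟨y, hy.2, hv.2, hv.1⟩
  have ιle : ∀ t, R ≤ t → Θ (ι t) ≤ Θ xM := fun t ht =>
    (mι.antitoneOn Set.self_mem_Ici ht ht).trans (hM _ hιK)
  have ole : ∀ t, R ≤ t → Θ xm ≤ Θ (o t) := fun t ht =>
    (hm _ hoK).trans (mo.monotoneOn Set.self_mem_Ici ht ht)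
  have high : ∀ x ∈ Γ, Θ xM < Θ x → ∃ t, R ≤ t ∧ x = o t := by
    intro x hx h
    rw [hΓ] at hx
    rcases hx with (hx | ⟨t, ht, rfl⟩) | ⟨t, ht, rfl⟩
    · exact absurd (hM x hx) (not_le.2 h)
    · exact ⟨t, ht, rfl⟩
    · exact absurd (ιle t ht) (not_le.2 h)
  have low : ∀ x ∈ Γ, Θ x < Θ xm → ∃ t, R ≤ t ∧ x = ι t := by
    intro x hx h
    rw [hΓ] at hx
    rcases hx with (hx | ⟨t, ht, rfl⟩) | ⟨t, ht, rfl⟩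
    · exact absurd (hm x hx) (not_le.2 h)
    · exact absurd (ole t ht) (not_le.2 h)
    · exact ⟨t, ht, rfl⟩
  have cpt : ∀ p ∈ Γ, ∀ q ∈ Γ, IsCompact (Γ ∩ Θ ⁻¹' Set.Icc (Θ p) (Θ q)) := by
    intro p hp q hq
    obtain ⟨t1, ht1, h1⟩ : ∃ t, R ≤ t ∧ Θ q < Θ (o t) := by
      rcases le_total (Θ xM) (Θ q) with h | h
      · obtain ⟨y, hy, hy1, _⟩ := up q hq (Θ q + 1) (by linarith)
        obtain ⟨t, ht, rfl⟩ := high y hy (h.trans_lt hy1)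
        exact ⟨t, ht, hy1⟩
      · obtain ⟨y, hy, hy1, _⟩ := up xM (hKΓ hxM) (Θ xM + 1) (by linarith)
        obtain ⟨t, ht, rfl⟩ := high y hy hy1
        exact ⟨t, ht, h.trans_lt hy1⟩
    obtain ⟨t2, ht2, h2⟩ : ∃ t, R ≤ t ∧ Θ (ι t) < Θ p := by
      rcases le_total (Θ xm) (Θ p) with h | h
      · obtain ⟨y, hy, hy1, _⟩ := dn xm (hKΓ hxm) (Θ xm - 1) (by linarith)
        obtain ⟨t, ht, rfl⟩ := low y hy hy1
        exact ⟨t, ht, hy1.trans_le h⟩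
      · obtain ⟨y, hy, hy1, _⟩ := dn p hp (Θ p - 1) (by linarith)
        obtain ⟨t, ht, rfl⟩ := low y hy (hy1.trans_le h)
        exact ⟨t, ht, hy1⟩
    have c1 : IsCompact (K ∪ o '' Set.Icc R t1 ∪ ι '' Set.Icc R t2) :=
      (hK.union (isCompact_Icc.image_of_continuousOn (ho.mono Set.Icc_subset_Ici_self))).union
        (isCompact_Icc.image_of_continuousOn (hι.mono Set.Icc_subset_Ici_self))
    refine c1.of_isClosed_subset (hcl.inter (isClosed_Icc.preimage hΘ)) ?_
    rintro x ⟨hx, hx1, hx2⟩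
    rw [hΓ] at hx
    rcases hx with (hx | ⟨t, ht, rfl⟩) | ⟨t, ht, rfl⟩
    · exact Or.inl (Or.inl hx)
    · refine Or.inl (Or.inr ⟨t, ⟨ht, ?_⟩, rfl⟩)
      exact ((mo.lt_iff_lt ht ht1).1 (hx2.trans_lt h1)).le
    · refine (Or.inr ⟨t, ⟨ht, ?_⟩, rfl⟩)
      exact ((mι.lt_iff_gt ht2 ht).1 (h2.trans_le hx1)).le
  -- injectivity
  have inj : Set.InjOn Θ Γ := by
    set C := Γ ∩ Θ ⁻¹' Set.Icc (Θ xm) (Θ xM) with hC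
    have cC : IsCompact C := cpt _ (hKΓ hxm) _ (hKΓ hxM)
    choose! N hN hNi using hinj
    set V : Set ((ℝ × ℝ) × (ℝ × ℝ)) := ⋃ x ∈ Γ, interior (N x) ×ˢ interior (N x) with hV
    have oV : IsOpen V := isOpen_biUnion fun x _ => isOpen_interior.prod isOpen_interior
    set E : Set ((ℝ × ℝ) × (ℝ × ℝ)) := (C ×ˢ C) ∩ {p | Θ p.1 = Θ p.2} with hE
    have cE : IsCompact E := (cC.prod cC).inter_right (isClosed_eq (by fun_prop) (by fun_prop))
    have cD : IsCompact (E \ V) := cE.diff oV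
    have memD : ∀ p q, p ∈ Γ → q ∈ Γ → Θ p = Θ q → p ≠ q → (p, q) ∈ E \ V := by
      intro p q hp hq he hne
      have range : Θ p ∈ Set.Icc (Θ xm) (Θ xM) := by
        constructor
        · by_contra h
          push Not at h
          obtain ⟨t, ht, rfl⟩ := low p hp h
          obtain ⟨t', ht', rfl⟩ := low q hq (he ▸ h)
          exact hne (by rw [mι.injOn ht ht' he])
        · by_contra h
          push Not at h
          obtain ⟨t, ht, rfl⟩ := high p hp h
          obtain ⟨t', ht', rfl⟩ := high q hq (he ▸ h)
          exact hne (by rw [mo.injOn ht ht' he])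
      refine ⟨⟨⟨⟨hp, range⟩, ⟨hq, ?_⟩⟩, he⟩, ?_⟩
      · show Θ q ∈ Set.Icc (Θ xm) (Θ xM)
        rw [← he]; exact range
      · intro h
        simp only [hV, Set.mem_iUnion, Set.mem_prod] at h
        obtain ⟨x, hx, h1, h2⟩ := h
        exact hne (hNi x hx ⟨interior_subset h1, hp⟩ ⟨interior_subset h2, hq⟩ he)
    intro p hp q hq he
    by_contra hne
    obtain ⟨⟨a, b⟩, hab, hmax⟩ := cD.exists_isMaxOn ⟨(p, q), memD p q hp hq he hne⟩ (f := fun v => Θ v.1) (by fun_prop)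
    have ha : a ∈ Γ := hab.1.1.1.1
    have hb : b ∈ Γ := hab.1.1.2.1
    have hΘab : Θ a = Θ b := hab.1.2
    have hne2 : a ≠ b := by
      rintro rfl
      exact hab.2 (Set.mem_biUnion ha ⟨mem_interior_iff_mem_nhds.2 (hN a ha), mem_interior_iff_mem_nhds.2 (hN a ha)⟩)
    obtain ⟨U, W, hU, hW, haU, hbW, hd⟩ := t2_separation hne2
    have n1 := hop a ha U (hU.mem_nhds haU)
    have n2 := hop b hb W (hW.mem_nhds hbW)
    rw [← hΘab] at n2
    have := inter_mem (mem_nhdsWithin_of_mem_nhds (inter_mem n1 n2)) (self_mem_nhdsWithin (s := Set.Ioi (Θ a)))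
    obtain ⟨v, ⟨⟨a', ha', hva⟩, ⟨b', hb', hvb⟩⟩, hv⟩ := nonempty_of_mem this
    have hne3 : a' ≠ b' := fun h => Set.disjoint_left.1 hd ha'.1 (h ▸ hb'.1)
    have := hmax (memD a' b' ha'.2 hb'.2 (hva.trans hvb.symm) hne3)
    have h5 : Θ a' ≤ Θ a := this
    rw [hva] at h5
    exact absurd hv (not_lt.2 h5)
  -- the image
  have oA : IsOpen (Θ '' Γ) := by
    rw [isOpen_iff_mem_nhds]
    rintro _ ⟨x, hx, rfl⟩
    exact mem_of_superset (hop x hx Set.univ univ_mem) (Set.image_mono Set.inter_subset_right)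
  have cA : (Θ '' Γ).OrdConnected := by
    refine ⟨?_⟩
    rintro _ ⟨p, hp, rfl⟩ _ ⟨q, hq, rfl⟩ v hv
    by_contra hcon
    have hcp : IsCompact ((Γ ∩ Θ ⁻¹' Set.Icc (Θ p) (Θ q)) ∩ {x | Θ x ≤ v}) :=
      (cpt p hp q hq).inter_right (isClosed_le hΘ continuous_const)
    obtain ⟨w, hw, hmax⟩ := hcp.exists_isMaxOn ⟨p, ⟨hp, le_rfl, hv.1.trans hv.2⟩, hv.1⟩ hΘ.continuousOn
    have hwv : Θ w < v := lt_of_le_of_ne hw.2 (fun h => hcon ⟨w, hw.1.1, h⟩)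
    obtain ⟨y, hy, hy1, hy2⟩ := up w hw.1.1 v hwv
    have : Θ y ≤ Θ w := hmax ⟨⟨hy, hw.1.2.1.trans hy1.le, hy2.le.trans hv.2⟩, hy2.le⟩
    linarith
  obtain ⟨χ, cχ, sχ, rχ⟩ := interval_param _ oA cA ⟨_, xm, hKΓ hxm, rfl⟩
  have ex : ∀ t, ∃ x ∈ Γ, Θ x = χ t := fun t => by
    have : χ t ∈ Θ '' Γ := rχ ▸ ⟨t, rfl⟩
    exact this
  choose f hf1 hf2 using ex
  have cf : Continuous f := by
    rw [continuous_iff_continuousAt]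
    intro t N hN
    have h1 := hop (f t) (hf1 t) N hN
    rw [hf2] at h1
    have h2 := cχ.continuousAt.eventually h1
    rw [mem_map]
    filter_upwards [h2] with s hs
    obtain ⟨x, ⟨hx1, hx2⟩, hx3⟩ := hs
    have : x = f s := inj hx2 (hf1 s) (by rw [hx3, hf2])
    rw [Set.mem_preimage, ← this]; exact hx1
  have rf : Set.range f = Γ := by
    ext x
    constructor
    · rintro ⟨t, rfl⟩; exact hf1 t
    · intro hx
      have : Θ x ∈ Set.range χ := rχ ▸ ⟨x, hx, rfl⟩
      obtain ⟨t, ht⟩ := this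
      exact ⟨t, inj (hf1 t) hx (by rw [hf2, ht])⟩
  refine ⟨f, cf, ?_, ?_, rf⟩
  · intro s t hst
    apply sχ.injective
    rw [← hf2, ← hf2, hst]
  · intro Q hQ
    rcases (f ⁻¹' Q).eq_empty_or_nonempty with he | ⟨t0, ht0⟩
    · rw [he]; exact isCompact_empty
    have cQ : IsCompact (Q ∩ Γ) := hQ.inter_right hcl
    obtain ⟨a, ha, hamax⟩ := cQ.exists_isMaxOn ⟨f t0, ht0, hf1 t0⟩ hΘ.continuousOn
    obtain ⟨b, hb, hbmin⟩ := cQ.exists_isMinOn ⟨f t0, ht0, hf1 t0⟩ hΘ.continuousOn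
    obtain ⟨ta, rfl⟩ : a ∈ Set.range f := rf ▸ ha.2
    obtain ⟨tb, rfl⟩ : b ∈ Set.range f := rf ▸ hb.2
    refine (isCompact_Icc (a := tb) (b := ta)).of_isClosed_subset (hQ.isClosed.preimage cf) ?_
    intro t ht
    have h1 : Θ (f t) ≤ Θ (f ta) := hamax ⟨ht, hf1 t⟩
    have h2 : Θ (f tb) ≤ Θ (f t) := hbmin ⟨ht, hf1 t⟩
    rw [hf2, hf2] at h1 h2
    exact ⟨sχ.le_iff_le.1 h2, sχ.le_iff_le.1 h1⟩

end QES

namespace QES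

lemma PC_eval_sum (n : ℕ) (e b m : ℝ) (z : ℂ) :
    (PC n e b m).eval z = ∑ k ∈ Finset.range (n+1), (((n.factorial : ℝ)/(k.factorial) * ph n e b m (n+2-k) : ℝ) : ℂ) * z^k := by
  unfold PC PR
  rw [Polynomial.map_sum, eval_finsetSum]
  refine Finset.sum_congr rfl fun k _ => ?_
  simp

lemma PC_eval_cont (n : ℕ) : Continuous (fun v : (ℝ × ℝ × ℝ) × ℂ => (PC n v.1.1 v.1.2.1 v.1.2.2).eval v.2) := by
  simp only [PC_eval_sum]
  refine continuous_finsetSum _ fun k _ => ?_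
  have := ph_cont n (n+2-k)
  have h2 : Continuous (fun v : (ℝ × ℝ × ℝ) × ℂ => ph n v.1.1 v.1.2.1 v.1.2.2 (n+2-k)) := this.comp continuous_fst
  fun_prop

lemma PC_splits (n : ℕ) (e b m : ℝ) : (PC n e b m).Splits := IsAlgClosed.splits _

lemma PC_root_near (n : ℕ) (v0 : ℝ × ℝ × ℝ) (z : ℂ) (hz : (PC n v0.1 v0.2.1 v0.2.2).eval z = 0) (η : ℝ) (hη : 0 < η) :
    ∀ᶠ v in nhds v0, ∃ w, (PC n v.1 v.2.1 v.2.2).eval w = 0 ∧ ‖z - w‖ < η := by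
  have hc : Continuous (fun v : ℝ × ℝ × ℝ => ‖(PC n v.1 v.2.1 v.2.2).eval z‖) :=
    ((PC_eval_cont n).comp (Continuous.prodMk_left z)).norm
  have h0 := hc.tendsto v0
  rw [hz, norm_zero] at h0
  filter_upwards [h0.eventually_lt tendsto_const_nhds (pow_pos hη n)] with v hv
  by_contra hcon
  push Not at hcon
  rw [(PC_splits n _ _ _).eval_eq_prod_roots_of_monic (PC_monic n _ _ _)] at hv
  have : ∀ s : Multiset ℂ, (∀ w ∈ s, η ≤ ‖z - w‖) → η ^ s.card ≤ ‖(s.map (fun x => z - x)).prod‖ := by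
    intro s
    induction s using Multiset.induction with
    | empty => simp
    | cons a s ih =>
      intro h
      rw [Multiset.map_cons, Multiset.prod_cons, Multiset.card_cons, pow_succ', norm_mul]
      exact mul_le_mul (h a (Multiset.mem_cons_self a s)) (ih fun w hw => h w (Multiset.mem_cons_of_mem hw)) (by positivity) (norm_nonneg _)
  have h2 := this (PC n v.1 v.2.1 v.2.2).roots (fun w hw => hcon w ((mem_roots'.1 hw).2))
  rw [PC_card_roots] at h2
  exact absurd hv (not_lt.2 h2)

lemma PC_root_bound (n : ℕ) (e b m : ℝ) (z : ℂ) (hz : (PC n e b m).eval z = 0) :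
    ‖z‖ ≤ 1 + ∑ k ∈ Finset.range n, ‖(PC n e b m).coeff k‖ := by
  by_contra hcon
  push Not at hcon
  set S := ∑ k ∈ Finset.range n, ‖(PC n e b m).coeff k‖ with hS
  have hS0 : 0 ≤ S := Finset.sum_nonneg fun _ _ => norm_nonneg _
  have h1 : 1 ≤ ‖z‖ := by linarith
  rw [eval_eq_sum_range, PC_natDegree, Finset.sum_range_succ] at hz
  have hl : (PC n e b m).coeff n = 1 := by
    have := PC_monic n e b m
    rwa [Monic, leadingCoeff, PC_natDegree] at this
  rw [hl, one_mul] at hz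
  have h2 : ‖z‖^n = ‖∑ k ∈ Finset.range n, (PC n e b m).coeff k * z^k‖ := by
    rw [← norm_pow, eq_neg_of_add_eq_zero_right hz, norm_neg]
  cases n with
  | zero => simp at h2
  | succ n =>
    have h3 : ‖z‖^(n+1) ≤ S * ‖z‖^n := by
      rw [h2, hS, Finset.sum_mul]
      refine (norm_sum_le _ _).trans (Finset.sum_le_sum fun k hk => ?_)
      rw [norm_mul, norm_pow]
      have : k ≤ n := by have := Finset.mem_range.1 hk; omega
      gcongr
    rw [pow_succ'] at h3
    have := le_of_mul_le_mul_right h3 (by positivity)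
    linarith

/-- nonvanishing on a closed set is stable -/
lemma PC_ne_stable (n : ℕ) (v0 : ℝ × ℝ × ℝ) (S : Set ℂ) (hS : IsClosed S)
    (h : ∀ z ∈ S, (PC n v0.1 v0.2.1 v0.2.2).eval z ≠ 0) :
    ∀ᶠ v in nhds v0, ∀ z ∈ S, (PC n v.1 v.2.1 v.2.2).eval z ≠ 0 := by
  have hc : Continuous (fun v : ℝ × ℝ × ℝ => 1 + ∑ k ∈ Finset.range n, ‖(PC n v.1 v.2.1 v.2.2).coeff k‖) := by
    refine continuous_const.add (continuous_finsetSum _ fun k hk => ?_)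
    have hk' := Finset.mem_range.1 hk
    have e : ∀ v : ℝ × ℝ × ℝ, (PC n v.1 v.2.1 v.2.2).coeff k = ((n.factorial * ph n v.1 v.2.1 v.2.2 (n+2-k) / k.factorial : ℝ) : ℂ) := by
      intro v
      rw [PC_coeff, ← PR_coeff n v.1 v.2.1 v.2.2 k (n+2-k) (by omega)]
      rw [mul_div_assoc, div_self (Nat.cast_ne_zero.2 (Nat.factorial_ne_zero _)), mul_one]
    simp only [e]
    have := ph_cont n (n+2-k)
    fun_prop
  obtain ⟨M, hM⟩ : ∃ M, M = 1 + ∑ k ∈ Finset.range n, ‖(PC n v0.1 v0.2.1 v0.2.2).coeff k‖ + 1 := ⟨_, rfl⟩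
  have ev1 := (hc.tendsto v0).eventually_lt (tendsto_const_nhds (x := M)) (by rw [hM]; linarith)
  have hcomp : IsCompact (S ∩ Metric.closedBall 0 M) := (isCompact_closedBall _ _).inter_left hS
  have ev2 : ∀ᶠ v in nhds v0, ∀ z ∈ S ∩ Metric.closedBall 0 M, (PC n v.1 v.2.1 v.2.2).eval z ≠ 0 := by
    refine hcomp.eventually_forall_of_forall_eventually fun z hz => ?_
    exact (PC_eval_cont n).continuousAt.eventually_ne (h z hz.1)
  filter_upwards [ev1, ev2] with v h1 h2 z hz hz0
  refine h2 z ⟨hz, ?_⟩ hz0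
  rw [mem_closedBall_zero_iff]
  exact (PC_root_bound n _ _ _ z hz0).trans h1.le

lemma NR_locconst (n : ℕ) (b m : ℝ) (h : qq n 1 b m = 0) :
    ∀ᶠ x : ℝ × ℝ in nhds (b, m), qq n 1 x.1 x.2 = 0 → NR n 1 x.1 x.2 = NR n 1 b m := by
  classical
  set S := (PC n 1 b m).roots.toFinset with hS
  obtain ⟨η, hη, h1, h2⟩ : ∃ η > 0, (∀ z ∈ S, z.im ≠ 0 → η ≤ |z.im|) ∧ (∀ z ∈ S, ∀ w ∈ S, z ≠ w → 2*η ≤ ‖z - w‖) := by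
    have e1 : ∀ᶠ η in nhdsWithin (0:ℝ) (Set.Ioi 0), ∀ z ∈ S, z.im ≠ 0 → η ≤ |z.im| := by
      rw [Finset.eventually_all]
      intro z _
      by_cases hz : z.im = 0
      · simp [hz]
      · filter_upwards [mem_nhdsWithin_of_mem_nhds (Iio_mem_nhds (abs_pos.2 hz))] with η hη _ using le_of_lt hη
    have e2 : ∀ᶠ η in nhdsWithin (0:ℝ) (Set.Ioi 0), ∀ z ∈ S, ∀ w ∈ S, z ≠ w → 2*η ≤ ‖z - w‖ := by
      rw [Finset.eventually_all]
      intro z _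
      rw [Finset.eventually_all]
      intro w _
      by_cases hz : z = w
      · simp [hz]
      · have : 0 < ‖z - w‖/2 := by have := norm_pos_iff.2 (sub_ne_zero.2 hz); positivity
        filter_upwards [mem_nhdsWithin_of_mem_nhds (Iio_mem_nhds this)] with η hη _
        have : η < ‖z - w‖/2 := hη
        linarith
    obtain ⟨η, hη⟩ := (e1.and (e2.and self_mem_nhdsWithin)).exists
    exact ⟨η, hη.2.2, hη.1, hη.2.1⟩
  have hcont : Continuous (fun x : ℝ × ℝ => ((1, x.1, x.2) : ℝ × ℝ × ℝ)) := by fun_prop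
  have ev : ∀ᶠ x : ℝ × ℝ in nhds (b, m), ∀ z ∈ S, ∃ w, (PC n 1 x.1 x.2).eval w = 0 ∧ ‖z - w‖ < η := by
    rw [Finset.eventually_all]
    intro z hz
    exact (hcont.tendsto (b, m)).eventually (PC_root_near n (1, b, m) z ((mem_PC n 1 b m z).1 hz) η hη)
  filter_upwards [ev] with x hx hq
  choose! w hw1 hw2 using hx
  set T := (PC n 1 x.1 x.2).roots.toFinset with hT
  have hST : S.card = T.card := by rw [hS, hT, PC_card_finset n 1 _ _ one_ne_zero h, PC_card_finset n 1 _ _ one_ne_zero hq]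
  have hmaps : ∀ z ∈ S, w z ∈ T := fun z hz => (mem_PC n 1 _ _ _).2 (hw1 z hz)
  have hinj : Set.InjOn w S := by
    intro z hz z' hz' he
    by_contra hne
    have a := h2 z hz z' hz' hne
    have b1 := hw2 z hz
    have b2 := hw2 z' hz'
    rw [← he] at b2
    have : ‖z - z'‖ ≤ ‖z - w z‖ + ‖z' - w z‖ := by
      calc ‖z - z'‖ = ‖(z - w z) - (z' - w z)‖ := by ring_nf
        _ ≤ _ := norm_sub_le _ _
    linarith
  have hsurj : Set.SurjOn w S T := Finset.surjOn_of_injOn_of_card_le w hmaps hinj hST.ge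
  have hreal : ∀ z ∈ S, ((w z).im = 0 ↔ z.im = 0) := by
    intro z hz
    constructor
    · intro hw
      by_contra hne
      have a := h1 z hz hne
      have : |(z - w z).im| ≤ ‖z - w z‖ := abs_im_le_norm _
      rw [sub_im, hw, sub_zero] at this
      linarith [hw2 z hz]
    · intro hz0
      have hcz : (starRingEnd ℂ) z = z := conj_eq_iff_im.2 hz0
      have hcm : (starRingEnd ℂ) (w z) ∈ (T : Set ℂ) := by
        rw [Finset.mem_coe, hT, mem_PC, PC_eval_conj, hw1 z hz, map_zero]
      obtain ⟨z', hz', he⟩ := hsurj hcm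
      have hzz : z = z' := by
        by_contra hne
        have a := h2 z hz z' hz' hne
        have b1 := hw2 z hz
        have b2 := hw2 z' hz'
        rw [he] at b2
        have b3 : ‖z - (starRingEnd ℂ) (w z)‖ < η := by
          rw [← hcz, ← map_sub, RCLike.norm_conj, hcz]; exact b1
        have : ‖z - z'‖ ≤ ‖z - (starRingEnd ℂ) (w z)‖ + ‖z' - (starRingEnd ℂ) (w z)‖ := by
          calc ‖z - z'‖ = ‖(z - (starRingEnd ℂ) (w z)) - (z' - (starRingEnd ℂ) (w z))‖ := by ring_nf
            _ ≤ _ := norm_sub_le _ _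
        linarith
      rw [← hzz] at he
      exact conj_eq_iff_im.1 he.symm
  unfold NR
  symm
  refine Finset.card_nbij w ?_ ?_ ?_
  · intro z hz
    rw [Finset.mem_coe, Finset.mem_filter] at hz ⊢
    exact ⟨hmaps z hz.1, (hreal z hz.1).2 hz.2⟩
  · intro z hz z' hz' he
    rw [Finset.mem_coe, Finset.mem_filter] at hz hz'
    exact hinj hz.1 hz'.1 he
  · intro y hy
    rw [Finset.mem_coe, Finset.mem_filter] at hy
    obtain ⟨z, hz, rfl⟩ := hsurj hy.1
    exact ⟨z, by rw [Finset.mem_coe, Finset.mem_filter]; exact ⟨hz, (hreal z hz).1 hy.2⟩, rfl⟩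

end QES

namespace QES

lemma Lop_eval (n : ℕ) (e b m : ℝ) (h : qq n e b m = 0) (z : ℂ) :
    e * (derivative (derivative (PC n e b m))).eval z + 2*(z^2-b) * (derivative (PC n e b m)).eval z
      - 2*n*z*(PC n e b m).eval z + m * (PC n e b m).eval z = 0 := by
  have := congrArg (fun p => p.eval z) (PC_Lop n e b m h)
  unfold Lop at this
  simpa [sub_eq_add_neg] using this

lemma bethe (n : ℕ) (e b m : ℝ) (he : e ≠ 0) (h : qq n e b m = 0) (w : ℂ) (hw : (PC n e b m).eval w = 0) :
    (e : ℂ) * ∑ u ∈ (PC n e b m).roots.toFinset.erase w, 1/(w - u) = b - w^2 := by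
  have hsimp := Lop_simple n e b m (by exact_mod_cast he) (PC n e b m) (PC_monic n e b m).ne_zero (PC_Lop n e b m h) w hw
  have hL := Lop_eval n e b m h w
  have hnd := PC_nodup n e b m he h
  have hne := (PC_monic n e b m).ne_zero
  set p := PC n e b m with hp
  obtain ⟨q, hq⟩ := dvd_iff_isRoot.2 (show p.IsRoot w from hw)
  have hq0 : q ≠ 0 := by rintro rfl; simp at hq; exact hne hq
  have hroots : p.roots = w ::ₘ q.roots := by
    rw [hq, roots_mul (by rw [← hq]; exact hne), roots_X_sub_C]; rfl
  have d1 : (derivative p).eval w = q.eval w := by rw [hq]; simp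
  have d2 : (derivative (derivative p)).eval w = 2 * (derivative q).eval w := by rw [hq]; simp; ring
  rw [d1] at hsimp
  have hs := (IsAlgClosed.splits q).eval_derivative_eq_eval_mul_sum hsimp
  rw [hw, d1, d2, hs] at hL
  have hsum : ∑ u ∈ p.roots.toFinset.erase w, 1/(w - u) = (q.roots.map fun z ↦ 1 / (w - z)).sum := by
    rw [Finset.sum]
    congr 2
    rw [Finset.erase_val, Multiset.toFinset_val, hnd.dedup, hroots, Multiset.erase_cons_head]
  rw [hsum]
  have : (2 * q.eval w) * (e * (q.roots.map fun z ↦ 1 / (w - z)).sum - (b - w^2)) = 0 := by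
    linear_combination hL
  rcases mul_eq_zero.1 this with h1 | h1
  · exact absurd (mul_eq_zero.1 h1) (by simp [hsimp])
  · exact sub_eq_zero.1 h1

lemma mul_deriv_pow (q : ℂ[X]) (k : ℕ) : q * derivative (q^k) = (k:ℂ[X]) * derivative q * q^k := by
  cases k with
  | zero => simp
  | succ j =>
    rw [derivative_pow_succ, pow_succ]
    simp
    ring

lemma PC_zero_right (n j : ℕ) (hj : j ≤ n) : qq n 0 1 (2*((n:ℝ)-2*j)) = 0 ∧
    PC n 0 1 (2*((n:ℝ)-2*j)) = (X - C 1)^j * (X + C 1)^(n-j) := by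
  have hm : ((X - C 1)^j * (X + C 1)^(n-j) : ℂ[X]).Monic := ((monic_X_sub_C _).pow _).mul ((monic_X_add_C _).pow _)
  have key : Lop n (0:ℝ) (1:ℝ) ((2*((n:ℝ)-2*j) : ℝ):ℂ) ((X - C 1 : ℂ[X])^j * (X + C 1)^(n-j)) = 0 := by
    obtain ⟨k, rfl⟩ := Nat.exists_eq_add_of_le hj
    unfold Lop
    have hj' : (X - C 1 : ℂ[X]) * derivative ((X - C 1 : ℂ[X])^j) = (j:ℂ[X]) * (X - C 1)^j := by
      rw [mul_deriv_pow]; simp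
    have hk' : (X + C 1 : ℂ[X]) * derivative ((X + C 1 : ℂ[X])^k) = (k:ℂ[X]) * (X + C 1)^k := by
      rw [mul_deriv_pow]; simp
    rw [Nat.add_sub_cancel_left, derivative_mul (f := (X - C 1)^j)]
    generalize derivative ((X - C 1 : ℂ[X])^j) = D1 at *
    generalize derivative ((X + C 1 : ℂ[X])^k) = D2 at *
    generalize ((X - C 1 : ℂ[X])^j) = A1 at *
    generalize ((X + C 1 : ℂ[X])^k) = A2 at *
    simp only [ofReal_zero, ofReal_one, map_zero, map_one] at *
    have : (C (((2*(((j+k:ℕ):ℝ)-2*j) : ℝ):ℂ)) : ℂ[X]) = 2*((k:ℂ[X]) - j) := by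
      rw [show (((2*(((j+k:ℕ):ℝ)-2*j) : ℝ):ℂ)) = 2*((k:ℂ) - j) by push_cast; ring]
      simp [show (C 2 : ℂ[X]) = 2 from rfl]
    rw [this]
    push_cast
    linear_combination 2*(X+1)*A2*hj' + 2*(X-1)*A1*hk'
  obtain ⟨_, h2, h3⟩ := Lop_unique n 0 1 _ _ hm.ne_zero key
  rw [hm.leadingCoeff, C_1, one_mul] at h3
  exact ⟨h2, h3.symm⟩

lemma PC_zero_left (k : ℕ) : qq (2*k) 0 (-1) 0 = 0 ∧ PC (2*k) 0 (-1) 0 = (X^2 + C 1)^k := by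
  have hm : ((X^2 + C 1)^k : ℂ[X]).Monic := (monic_X_pow_add_C _ two_ne_zero).pow _
  have key : Lop (2*k) (0:ℝ) (-1:ℝ) ((0 : ℝ):ℂ) ((X^2 + C 1 : ℂ[X])^k) = 0 := by
    unfold Lop
    have hj' : (X^2 + C 1 : ℂ[X]) * derivative ((X^2 + C 1 : ℂ[X])^k) = 2*(k:ℂ[X])*X * (X^2 + C 1)^k := by
      rw [mul_deriv_pow]; simp; left; ring
    generalize derivative ((X^2 + C 1 : ℂ[X])^k) = D1 at *
    generalize ((X^2 + C 1 : ℂ[X])^k) = A1 at *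
    simp only [ofReal_zero, ofReal_one, ofReal_neg, map_zero, map_one, map_neg] at *
    push_cast
    linear_combination 2*hj'
  obtain ⟨_, h2, h3⟩ := Lop_unique (2*k) 0 (-1) _ _ hm.ne_zero key
  rw [hm.leadingCoeff, C_1, one_mul] at h3
  exact ⟨h2, h3.symm⟩

lemma NR_left (k : ℕ) : ∃ δ > 0, ∀ e x : ℝ, |e| < δ → |x| < δ → NR (2*k) e (-1) x = 0 := by
  have h := PC_ne_stable (2*k) (0, -1, 0) {z : ℂ | z.im = 0} (isClosed_eq continuous_im continuous_const) (by
    intro z hz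
    rw [(PC_zero_left k).2]
    simp only [eval_pow, eval_add, eval_X, eval_C]
    refine pow_ne_zero _ ?_
    have : z = (z.re : ℂ) := by apply Complex.ext <;> simp; exact hz
    rw [this]
    norm_cast
    positivity)
  rw [Metric.eventually_nhds_iff] at h
  obtain ⟨δ, hδ, h⟩ := h
  refine ⟨δ, hδ, fun e x he hx => ?_⟩
  unfold NR
  rw [Finset.card_eq_zero, Finset.filter_eq_empty_iff]
  intro z hz hz0
  refine h (y := (e, -1, x)) ?_ z hz0 ((mem_PC _ _ _ _ _).1 hz)
  simp [Prod.dist_eq, he, hx]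

lemma PC_sum_roots (n : ℕ) (e b m : ℝ) : (PC n e b m).roots.sum = -(m/2 : ℝ) ∨ n = 0 := by
  rcases Nat.eq_zero_or_pos n with h0 | h0
  · right; exact h0
  left
  have h := (PC_splits n e b m).nextCoeff_eq_neg_sum_roots_of_monic (PC_monic n e b m)
  rw [nextCoeff_of_natDegree_pos (by rw [PC_natDegree]; exact h0), PC_natDegree] at h
  have h2 := PR_coeff n e b m (n-1) 3 (by omega)
  have h3 : ph n e b m 3 = m/(2*n) := by
    have := ph_rec n e b m 0 (by omega)
    simp only [ph] at this
    simp [ph]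
  have hn : (n:ℝ) ≠ 0 := by positivity
  have h4 : (n.factorial : ℝ) = n * (n-1).factorial := by
    rw [← Nat.mul_factorial_pred (by omega)]; push_cast; ring
  have hf : ((n-1).factorial : ℝ) ≠ 0 := Nat.cast_ne_zero.2 (Nat.factorial_ne_zero _)
  rw [h3, h4] at h2
  have h5 : (PR n e b m).coeff (n-1) = m/2 := by
    apply mul_right_cancel₀ hf
    rw [h2]; field_simp
  rw [PC_coeff, h5] at h
  rw [h]; simp

end QES

namespace QES

lemma near_neg_real (n : ℕ) (e x r : ℝ) (he : 0 < e) (hen : e * n^2 < 3) (hr : r ≤ 1/4) (h : qq n e 1 x = 0)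
    (hroots : ∀ z, (PC n e 1 x).eval z = 0 → ‖z - 1‖ < r ∨ ‖z + 1‖ < r)
    (w : ℂ) (hw : (PC n e 1 x).eval w = 0) (hwr : ‖w + 1‖ < r) : w.im = 0 := by
  classical
  by_contra hne
  have conj_near : ∀ z : ℂ, ‖z + 1‖ < r → ‖(starRingEnd ℂ) z + 1‖ < r := by
    intro z hz
    have : (starRingEnd ℂ) z + 1 = (starRingEnd ℂ) (z + 1) := by simp
    rw [this, RCLike.norm_conj]; exact hz
  have conj_root : ∀ z : ℂ, (PC n e 1 x).eval z = 0 → (PC n e 1 x).eval ((starRingEnd ℂ) z) = 0 := by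
    intro z hz
    rw [PC_eval_conj, hz, map_zero]
  set T := (PC n e 1 x).roots.toFinset.filter (fun z => ‖z + 1‖ < r) with hT
  have mT : ∀ z, z ∈ T ↔ (PC n e 1 x).eval z = 0 ∧ ‖z + 1‖ < r := by
    intro z; rw [hT, Finset.mem_filter, mem_PC]
  obtain ⟨v, hvT, hv⟩ := Finset.exists_max_image T (fun z => z.im) ⟨w, (mT w).2 ⟨hw, hwr⟩⟩
  have hy : 0 < v.im := by
    rcases lt_or_gt_of_ne hne with h1 | h1
    · have := hv _ ((mT _).2 ⟨conj_root w hw, conj_near w hwr⟩)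
      rw [conj_im] at this; linarith
    · exact h1.trans_le (hv w ((mT w).2 ⟨hw, hwr⟩))
  obtain ⟨hv0, hvr⟩ := (mT v).1 hvT
  have hb := bethe n e 1 x he.ne' h v hv0
  have hbi := congrArg Complex.im hb
  have e1 : ((1:ℝ) - v^2 : ℂ).im = -2*v.re*v.im := by
    simp [pow_two]; ring
  rw [e1, Complex.im_ofReal_mul] at hbi
  set cv := (starRingEnd ℂ) v with hcv
  have hcvm : cv ∈ (PC n e 1 x).roots.toFinset.erase v := by
    rw [Finset.mem_erase]
    refine ⟨?_, (mem_PC _ _ _ _ _).2 (conj_root v hv0)⟩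
    intro h0
    have := congrArg Complex.im h0
    rw [hcv, conj_im] at this; linarith
  have hterm : ∀ u ∈ (PC n e 1 x).roots.toFinset.erase v, (1/(v-u)).im ≤ 1 := by
    intro u hu
    have hu0 := (mem_PC _ _ _ _ _).1 (Finset.mem_of_mem_erase hu)
    rcases hroots u hu0 with h1 | h1
    · have : 1 ≤ ‖v - u‖ := by
        have e2 : (2:ℂ) = (v + 1) - (u - 1) - (v - u) := by ring
        have h3 : ‖(2:ℂ)‖ ≤ ‖v+1‖ + ‖u-1‖ + ‖v-u‖ := by
          rw [e2]; exact (norm_sub_le _ _).trans (add_le_add_left (norm_sub_le _ _) _)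
        rw [Complex.norm_ofNat] at h3
        linarith
      refine (Complex.im_le_norm _).trans ?_
      rw [norm_div, norm_one]
      exact div_le_one_of_le₀ this (norm_nonneg _)
    · have := hv u ((mT u).2 ⟨hu0, h1⟩)
      rw [one_div, Complex.inv_im, sub_im]
      have : -(v.im - u.im)/normSq (v-u) ≤ 0 := div_nonpos_of_nonpos_of_nonneg (by linarith) (normSq_nonneg _)
      linarith
  have hcvt : (1/(v-cv)).im = -1/(2*v.im) := by
    rw [hcv, sub_conj, one_div, Complex.inv_im]
    simp [normSq_apply]
    field_simp
  have hsum : (∑ u ∈ (PC n e 1 x).roots.toFinset.erase v, 1/(v-u)).im ≤ -1/(2*v.im) + n := by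
    rw [Complex.im_sum, ← Finset.add_sum_erase _ _ hcvm, hcvt]
    have h1 := Finset.sum_le_card_nsmul (((PC n e 1 x).roots.toFinset.erase v).erase cv) (fun u => (1/(v-u)).im) 1
      (fun u hu => hterm u (Finset.mem_of_mem_erase hu))
    have h2 : (((PC n e 1 x).roots.toFinset.erase v).erase cv).card ≤ n := by
      refine ((Finset.card_erase_le).trans (Finset.card_erase_le)).trans ?_
      rw [PC_card_finset n e 1 x he.ne' h]
    have h3 : ((((PC n e 1 x).roots.toFinset.erase v).erase cv).card : ℝ) ≤ n := by exact_mod_cast h2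
    rw [nsmul_eq_mul, mul_one] at h1
    linarith
  have hre : v.re ≤ -3/4 := by
    have := (Complex.re_le_norm (v+1)).trans hvr.le
    simp at this; linarith
  set y := v.im with hyd
  have h5 : 3/2*y ≤ e * (-1/(2*y) + n) := by
    have : 3/2*y ≤ -2*v.re*y := by nlinarith
    have h6 := mul_le_mul_of_nonneg_left hsum he.le
    linarith
  have h7 : 3*y^2 ≤ -e + 2*n*e*y := by
    have := mul_le_mul_of_nonneg_left h5 (by linarith : 0 ≤ 2*y)
    have e3 : 2*y*(e * (-1/(2*y) + n)) = -e + 2*n*e*y := by field_simp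
    rw [e3] at this; linarith
  nlinarith [sq_nonneg (y - n*e/3)]

lemma PC_eval_real (n : ℕ) (e b m t : ℝ) : (PC n e b m).eval (t:ℂ) = ((PR n e b m).eval t : ℝ) := by
  unfold PC
  rw [eval_map]
  exact eval₂_at_apply ofRealHom t

lemma Lop_eval_real (n : ℕ) (e b m : ℝ) (h : qq n e b m = 0) (t : ℝ) :
    e * (derivative (derivative (PR n e b m))).eval t + 2*(t^2-b) * (derivative (PR n e b m)).eval t
      - 2*n*t*(PR n e b m).eval t + m * (PR n e b m).eval t = 0 := by
  have h1 := Lop_eval n e b m h t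
  unfold PC at h1
  rw [derivative_map, derivative_map, eval_map, eval_map, eval_map] at h1
  have e1 : ∀ p : ℝ[X], eval₂ ofRealHom (t:ℂ) p = ((p.eval t : ℝ):ℂ) := fun p => eval₂_at_apply ofRealHom t
  rw [e1, e1, e1] at h1
  exact_mod_cast h1

lemma no_two_real (n : ℕ) (e x : ℝ) (he : 0 < e) (h : qq n e 1 x = 0) (a b : ℝ) (hab : a < b)
    (ha : (PC n e 1 x).eval (a:ℂ) = 0) (hb : (PC n e 1 x).eval (b:ℂ) = 0)
    (hpos : ∀ t ∈ Set.Icc a b, 0 < 2*n*t - x) : False := by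
  set P := PR n e 1 x with hP
  have hd : ∀ t : ℝ, HasDerivAt (fun t => P.eval t * (derivative P).eval t * Real.exp ((2*t^3/3 - 2*t)/e))
      (Real.exp ((2*t^3/3 - 2*t)/e) * (((derivative P).eval t)^2 + (2*n*t-x)/e * (P.eval t)^2)) t := by
    intro t
    have h1 := P.hasDerivAt t
    have h2 := (derivative P).hasDerivAt t
    have h3 : HasDerivAt (fun t : ℝ => (2*t^3/3 - 2*t)/e) ((2*t^2-2)/e) t := by
      refine ((((hasDerivAt_pow 3 t).const_mul 2).div_const 3 |>.sub ((hasDerivAt_id t).const_mul 2)).div_const e).congr_deriv ?_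
      norm_num; ring
    refine ((h1.mul h2).mul h3.exp).congr_deriv ?_
    have hL := Lop_eval_real n e 1 x h t
    rw [← hP] at hL
    have : (derivative (derivative P)).eval t = (-(2*(t^2-1)) * (derivative P).eval t + (2*n*t - x)*P.eval t)/e := by
      field_simp; linarith
    simp only [Pi.mul_apply]
    rw [this]; field_simp; ring
  have hsm : StrictMonoOn (fun t => P.eval t * (derivative P).eval t * Real.exp ((2*t^3/3 - 2*t)/e)) (Set.Icc a b) := by
    refine strictMonoOn_of_deriv_pos (convex_Icc a b) (fun t _ => (hd t).continuousAt.continuousWithinAt) ?_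
    intro t ht
    rw [interior_Icc] at ht
    rw [(hd t).deriv]
    refine mul_pos (Real.exp_pos _) ?_
    have hp := div_pos (hpos t (Set.Ioo_subset_Icc_self ht)) he
    by_cases h0 : P.eval t = 0
    · have hs := Lop_simple n e 1 x (by exact_mod_cast he.ne') (PC n e 1 x) (PC_monic n e 1 x).ne_zero
        (by exact_mod_cast PC_Lop n e 1 x h) t (by rw [PC_eval_real, ← hP, h0, ofReal_zero])
      have : (derivative P).eval t ≠ 0 := by
        intro h1
        apply hs
        unfold PC
        rw [derivative_map, eval_map]
        refine (eval₂_at_apply ofRealHom t).trans ?_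
        rw [← hP, h1, map_zero]
      rw [h0]; positivity
    · positivity
  have := hsm (Set.left_mem_Icc.2 hab.le) (Set.right_mem_Icc.2 hab.le) hab
  rw [PC_eval_real, ofReal_eq_zero, ← hP] at ha hb
  simp only [ha, hb, zero_mul, lt_irrefl] at this

end QES

namespace QES

lemma NR_right (n j : ℕ) (hj : j ≤ n) : ∃ δ > 0, ∀ e x : ℝ, 0 < e → e < δ → |x - 2*((n:ℝ)-2*j)| < δ → qq n e 1 x = 0 →
    NR n e 1 x = n - 2*(j/2) := by
  classical
  obtain ⟨r, hr⟩ : ∃ r : ℝ, r = 1/(4*((n:ℝ)+1)) := ⟨_, rfl⟩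
  have hn1 : (0:ℝ) < (n:ℝ)+1 := by positivity
  have hr0 : 0 < r := by rw [hr]; positivity
  have hr4 : r ≤ 1/4 := by
    rw [hr]; apply one_div_le_one_div_of_le <;> linarith
  have hnr : n * r ≤ 1/4 := by
    rw [hr, mul_one_div, div_le_iff₀ (by positivity)]; linarith
  have hScl : IsClosed {z : ℂ | r ≤ ‖z - 1‖ ∧ r ≤ ‖z + 1‖} := by
    have c1 : IsClosed {z : ℂ | r ≤ ‖z - 1‖} := isClosed_le continuous_const (by fun_prop)
    have c2 : IsClosed {z : ℂ | r ≤ ‖z + 1‖} := isClosed_le continuous_const (by fun_prop)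
    exact c1.inter c2
  have h := PC_ne_stable n (0, 1, 2*((n:ℝ)-2*j)) {z : ℂ | r ≤ ‖z - 1‖ ∧ r ≤ ‖z + 1‖} hScl (by
    intro z hz
    rw [(PC_zero_right n j hj).2]
    simp only [eval_mul, eval_pow, eval_sub, eval_add, eval_X, eval_C]
    refine mul_ne_zero (pow_ne_zero _ ?_) (pow_ne_zero _ ?_)
    · exact norm_pos_iff.1 (hr0.trans_le hz.1)
    · exact norm_pos_iff.1 (hr0.trans_le hz.2))
  rw [Metric.eventually_nhds_iff] at h
  obtain ⟨δ0, hδ0, h⟩ := h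
  refine ⟨min δ0 (min 1 (1/((n:ℝ)+1)^2)), by positivity, fun e x he heδ hxδ hq => ?_⟩
  obtain ⟨he0, he1, he2⟩ : e < δ0 ∧ e < 1 ∧ e < 1/((n:ℝ)+1)^2 := by simpa using heδ
  obtain ⟨hx0, hx1, -⟩ : |x - 2*((n:ℝ)-2*j)| < δ0 ∧ |x - 2*((n:ℝ)-2*j)| < 1 ∧ |x - 2*((n:ℝ)-2*j)| < 1/((n:ℝ)+1)^2 := by
    simpa using hxδ
  have hen : e * (n:ℝ)^2 < 3 := by
    rw [lt_div_iff₀ (by positivity)] at he2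
    nlinarith
  obtain ⟨k, hk, hNR⟩ := NR_parity n e 1 x he.ne' hq
  rcases PC_sum_roots n e 1 x with hsum | h0
  swap
  · subst h0; rw [hNR]; omega
  have hroots : ∀ z, (PC n e 1 x).eval z = 0 → ‖z - 1‖ < r ∨ ‖z + 1‖ < r := by
    intro z hz
    by_contra hcon
    push Not at hcon
    refine h (y := (e, 1, x)) ?_ z hcon hz
    rw [Prod.dist_eq, Prod.dist_eq, Real.dist_eq, Real.dist_eq, Real.dist_eq]
    simp only [sub_zero, sub_self, abs_zero]
    rw [abs_of_pos he]
    exact max_lt he0 (max_lt hδ0 hx0)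
  have hcard := PC_card_finset n e 1 x he.ne' hq
  have hnd := PC_nodup n e 1 x he.ne' hq
  have hmem := mem_PC n e 1 x
  unfold NR at hNR ⊢
  set R := (PC n e 1 x).roots.toFinset with hR
  have hsumR : ∑ z ∈ R, z.re = -(x/2) := by
    rw [← Complex.re_sum]
    have : ∑ z ∈ R, z = (PC n e 1 x).roots.sum := by
      rw [Finset.sum, hR, Multiset.toFinset_val, hnd.dedup, Multiset.map_id']
    rw [this, hsum]; simp
  set A := R.filter (fun z => ‖z - 1‖ < r) with hA
  set B := R.filter (fun z => ¬ ‖z - 1‖ < r) with hB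
  have hAB : A.card + B.card = n := by rw [hA, hB, Finset.card_filter_add_card_filter_not, hcard]
  have hsAB : ∑ z ∈ A, z.re + ∑ z ∈ B, z.re = -(x/2) := by
    rw [hA, hB, Finset.sum_filter_add_sum_filter_not, hsumR]
  have nearA : ∀ z ∈ A, |z.re - 1| < r := by
    intro z hz
    have := (Finset.mem_filter.1 hz).2
    have h2 := (Complex.abs_re_le_norm (z - 1)).trans_lt this
    simpa using h2
  have nearB' : ∀ z ∈ B, ‖z + 1‖ < r := by
    intro z hz
    have := Finset.mem_filter.1 hz
    exact (hroots z ((hmem z).1 this.1)).resolve_left this.2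
  have nearB : ∀ z ∈ B, |z.re + 1| < r := by
    intro z hz
    have h2 := (Complex.abs_re_le_norm (z + 1)).trans_lt (nearB' z hz)
    simpa using h2
  have hABr : (A.card:ℝ) + B.card = n := by exact_mod_cast hAB
  have hjA : A.card = j := by
    have a1 : ∑ z ∈ A, z.re ≤ A.card • (1 + r) := Finset.sum_le_card_nsmul _ _ _ fun z hz => by linarith [(abs_lt.1 (nearA z hz)).2]
    have a2 : A.card • (1 - r) ≤ ∑ z ∈ A, z.re := Finset.card_nsmul_le_sum _ _ _ fun z hz => by linarith [(abs_lt.1 (nearA z hz)).1]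
    have b1 : ∑ z ∈ B, z.re ≤ B.card • (-1 + r) := Finset.sum_le_card_nsmul _ _ _ fun z hz => by linarith [(abs_lt.1 (nearB z hz)).2]
    have b2 : B.card • (-1 - r) ≤ ∑ z ∈ B, z.re := Finset.card_nsmul_le_sum _ _ _ fun z hz => by linarith [(abs_lt.1 (nearB z hz)).1]
    rw [nsmul_eq_mul] at a1 a2 b1 b2
    have hB' : (B.card : ℝ) = n - A.card := by linarith
    rw [hB'] at b1 b2
    obtain ⟨h3, h4⟩ := abs_lt.1 hx1
    have u1 : (A.card : ℝ) < j + 1 := by nlinarith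
    have u2 : (j : ℝ) < A.card + 1 := by nlinarith
    have u1' : A.card < j + 1 := by exact_mod_cast u1
    have u2' : j < A.card + 1 := by exact_mod_cast u2
    omega
  have hsplit : (R.filter (fun z => z.im = 0)).card = (A.filter (fun z => z.im = 0)).card + B.card := by
    have hBf : B.filter (fun z => z.im = 0) = B := by
      rw [Finset.filter_eq_self]
      intro z hz
      exact near_neg_real n e x r he hen hr4 hq hroots z ((hmem z).1 (Finset.mem_filter.1 hz).1) (nearB' z hz)
    rw [← Finset.card_filter_add_card_filter_not (s := R.filter (fun z => z.im = 0)) (fun z => ‖z - 1‖ < r)]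
    congr 1
    · rw [hA, Finset.filter_comm]
    · rw [← hBf, hB, Finset.filter_comm]
  have hA1 : (A.filter (fun z => z.im = 0)).card ≤ 1 := by
    have key : ∀ z ∈ A, z.im = 0 → ∀ w ∈ A, w.im = 0 → z.re < w.re → False := by
      intro z hz hz0 w hw hw0 hlt
      have ez : z = (z.re : ℂ) := by apply Complex.ext <;> simp; exact hz0
      have ew : w = (w.re : ℂ) := by apply Complex.ext <;> simp; exact hw0
      have rz := (hmem z).1 (Finset.mem_filter.1 hz).1
      have rw' := (hmem w).1 (Finset.mem_filter.1 hw).1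
      rw [ez] at rz
      rw [ew] at rw'
      refine no_two_real n e x he hq z.re w.re hlt rz rw' ?_
      intro t ht
      have hj1 : 1 ≤ A.card := Finset.card_pos.2 ⟨z, hz⟩
      rw [hjA] at hj1
      have hj1' : (1:ℝ) ≤ j := by exact_mod_cast hj1
      have h5 := (abs_lt.1 (nearA z hz)).1
      have h6 := ht.1
      have h7 : (n:ℝ) * (1 - r) ≤ n * t := mul_le_mul_of_nonneg_left (by linarith) (Nat.cast_nonneg n)
      have h8 := (abs_lt.1 hx1).2
      nlinarith
    rw [Finset.card_le_one]
    intro z hz w hw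
    obtain ⟨hz1, hz2⟩ := Finset.mem_filter.1 hz
    obtain ⟨hw1, hw2⟩ := Finset.mem_filter.1 hw
    rcases lt_trichotomy z.re w.re with h1 | h1 | h1
    · exact (key z hz1 hz2 w hw1 hw2 h1).elim
    · exact Complex.ext h1 (hz2.trans hw2.symm)
    · exact (key w hw1 hw2 z hz1 hz2 h1).elim
  rw [hNR] at hsplit
  rw [hNR]
  omega

end QES

namespace QES

lemma root_first_order (p q r : ℂ[X]) (hp : p ≠ 0) (h : q * derivative p = r * p) (z : ℂ) (hz : p.eval z = 0) :
    q.eval z = 0 := by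
  by_contra hq
  have hd : derivative p ≠ 0 := by
    intro h0
    have h1 := derivative_eq_zero.1 h0
    rw [eq_C_of_natDegree_eq_zero h1] at hz hp
    simp at hz hp; exact hp hz
  have hq0 : q ≠ 0 := by rintro rfl; simp at hq
  have hqd : q * derivative p ≠ 0 := mul_ne_zero hq0 hd
  have h1 := derivative_rootMultiplicity_of_root (show p.IsRoot z from hz)
  have h2 := rootMultiplicity_mul (x := z) hqd
  rw [rootMultiplicity_eq_zero hq, h1, zero_add] at h2
  have h3 : p.rootMultiplicity z ≤ (q * derivative p).rootMultiplicity z := by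
    rw [le_rootMultiplicity_iff hqd, h]
    exact (pow_rootMultiplicity_dvd p z).mul_left r
  have h4 := (rootMultiplicity_pos hp).2 (show p.IsRoot z from hz)
  omega

lemma root_zero (n : ℕ) (b x : ℝ) (h : qq n 0 b x = 0) (z : ℂ) (hz : (PC n 0 b x).eval z = 0) : z^2 = b := by
  have hL := PC_Lop n 0 b x h
  unfold Lop at hL
  have := root_first_order (PC n 0 b x) (2*(X^2 - C (b:ℂ))) (2*(n:ℂ[X])*X - C (x:ℂ)) (PC_monic n 0 b x).ne_zero (by
    simp only [ofReal_zero, map_zero, zero_mul, zero_add] at hL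
    linear_combination hL) z hz
  have h2 : 2*(z^2 - b) = 0 := by simpa using this
  linear_combination h2/2

lemma sum_pm (a : ℂ) (s : Multiset ℂ) (h : ∀ z ∈ s, z = a ∨ z = -a) : ∃ k ≤ s.card, s.sum = (2*k - s.card) * a := by
  induction s using Multiset.induction with
  | empty => exact ⟨0, by simp, by simp⟩
  | cons z s ih =>
    obtain ⟨k, hk, hs⟩ := ih fun w hw => h w (Multiset.mem_cons_of_mem hw)
    rw [Multiset.sum_cons, Multiset.card_cons, hs]
    rcases h z (Multiset.mem_cons_self z s) with rfl | rfl
    · exact ⟨k+1, by omega, by push_cast; ring⟩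
    · exact ⟨k, by omega, by push_cast; ring⟩

lemma qq_zero_n (e b m : ℝ) : qq 0 e b m = m := by simp [qq, ph]

lemma roots_right (n : ℕ) (x : ℝ) (h : qq n 0 1 x = 0) : ∃ j ≤ n, x = 2*((n:ℝ)-2*j) := by
  rcases PC_sum_roots n 0 1 x with h1 | h1
  · obtain ⟨k, hk, hs⟩ := sum_pm 1 (PC n 0 1 x).roots (fun z hz => by
      have := root_zero n 1 x h z (mem_roots'.1 hz).2
      rw [ofReal_one] at this
      simpa using this)
    rw [PC_card_roots] at hk hs
    refine ⟨k, hk, ?_⟩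
    rw [h1, mul_one] at hs
    have : -(x/2) = 2*(k:ℝ) - n := by exact_mod_cast hs
    linarith
  · subst h1
    rw [qq_zero_n] at h
    exact ⟨0, le_rfl, by simp [h]⟩

lemma roots_left (n : ℕ) (x : ℝ) (h : qq n 0 (-1) x = 0) : x = 0 ∧ Even n := by
  rcases PC_sum_roots n 0 (-1) x with h1 | h1
  · obtain ⟨k, hk, hs⟩ := sum_pm I (PC n 0 (-1) x).roots (fun z hz => by
      have := root_zero n (-1) x h z (mem_roots'.1 hz).2
      have h2 : (z - I)*(z + I) = 0 := by
        push_cast at this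
        linear_combination this - I_sq
      rcases mul_eq_zero.1 h2 with h3 | h3
      · left; exact sub_eq_zero.1 h3
      · right; exact eq_neg_of_add_eq_zero_left h3)
    rw [PC_card_roots] at hk hs
    rw [h1] at hs
    have e1 := congrArg Complex.re hs
    have e2 := congrArg Complex.im hs
    simp at e1 e2
    refine ⟨by linarith, ?_⟩
    have : ((2*k : ℕ):ℝ) = n := by push_cast; linarith
    have : 2*k = n := by exact_mod_cast this
    exact ⟨k, by omega⟩
  · subst h1
    rw [qq_zero_n] at h
    exact ⟨h, by simp⟩

lemma reverse_pow' (q : ℂ[X]) (k : ℕ) : (q^k).reverse = q.reverse^k := by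
  induction k with
  | zero => rw [pow_zero, pow_zero, ← C_1, reverse_C]
  | succ k ih => rw [pow_succ, pow_succ, reverse_mul_of_domain, ih]

lemma qm_sign (n : ℕ) (e b m s : ℝ) (h : (PC n e b m).reverse = C (s:ℂ) * PC n e b m) : ∃ c > 0, qm n e b m = s * c := by
  have hc : ∀ k ≤ n, (PR n e b m).coeff (n-k) = s * (PR n e b m).coeff k := by
    intro k hk
    have := congrArg (fun p => p.coeff k) h
    simp only [coeff_reverse, PC_natDegree, revAt_le hk, coeff_C_mul, PC_coeff] at this
    exact_mod_cast this
  refine ⟨∑ k ∈ Finset.range (n+1), (PR n e b m).coeff k^2 * (k.factorial * (n-k).factorial / n.factorial^2), ?_, ?_⟩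
  · refine lt_of_lt_of_le ?_ (Finset.single_le_sum (fun k _ => by positivity) (Finset.self_mem_range_succ n))
    rw [PR_coeff_n]; positivity
  · unfold qm
    rw [PP_eq, Finset.mul_sum]
    refine Finset.sum_congr rfl fun k hk => ?_
    have hk' : k ≤ n := by have := Finset.mem_range.1 hk; omega
    have h1 := PR_coeff n e b m (n-k) (k+2) (by omega)
    have h2 := PR_coeff n e b m k (n-k+2) (by omega)
    rw [hc k hk'] at h1
    have hf : (n.factorial : ℝ) ≠ 0 := Nat.cast_ne_zero.2 (Nat.factorial_ne_zero _)
    have h3 : ph n e b m (k+2) = s * (PR n e b m).coeff k * (n-k).factorial / n.factorial := by field_simp; linarith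
    have h4 : ph n e b m (n-k+2) = (PR n e b m).coeff k * k.factorial / n.factorial := by field_simp; linarith
    rw [h3, h4]; field_simp

lemma qm_right (n j : ℕ) (hj : j ≤ n) : 0 < (-1)^j * qm n 0 1 (2*((n:ℝ)-2*j)) := by
  obtain ⟨c, hc, h⟩ := qm_sign n 0 1 (2*((n:ℝ)-2*j)) ((-1)^j) (by
    rw [(PC_zero_right n j hj).2, reverse_mul_of_domain, reverse_pow', reverse_pow']
    have e1 : (X - C 1 : ℂ[X]).reverse = C (-1) * (X - C 1) := by
      ext k
      rw [coeff_reverse, natDegree_X_sub_C]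
      rcases k with _ | _ | k
      · simp [revAt_le, coeff_one]
      · simp [revAt_le, coeff_one]
      · rw [revAt_eq_self_of_lt (by omega)]; simp [coeff_X, coeff_one]
    have e2 : (X + C 1 : ℂ[X]).reverse = X + C 1 := by
      ext k
      rw [coeff_reverse, natDegree_X_add_C]
      rcases k with _ | _ | k
      · simp [revAt_le, coeff_one]
      · simp [revAt_le, coeff_one]
      · rw [revAt_eq_self_of_lt (by omega)]
    rw [e1, e2, mul_pow]
    push_cast
    rw [C_pow, mul_assoc])
  rw [h, ← mul_assoc, ← mul_pow]; simpa using hc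

lemma qm_left (k : ℕ) : 0 < qm (2*k) 0 (-1) 0 := by
  obtain ⟨c, hc, h⟩ := qm_sign (2*k) 0 (-1) 0 1 (by
    rw [(PC_zero_left k).2, reverse_pow']
    have e2 : (X^2 + C 1 : ℂ[X]).reverse = X^2 + C 1 := by
      ext k
      rw [coeff_reverse, natDegree_X_pow_add_C]
      rcases k with _ | _ | _ | k
      · simp [revAt_le, coeff_one]
      · simp [revAt_le, coeff_one]
      · simp [revAt_le, coeff_one]
      · rw [revAt_eq_self_of_lt (by omega)]
    rw [e2]; simp)
  rw [h]; simpa using hc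

end QES

namespace QES

lemma tail_one (n : ℕ) (b z : ℝ) (h : qq n 0 b z = 0) (ha : qm n 0 b z ≠ 0) (ρ0 : ℝ) (hρ0 : 0 < ρ0) :
    ∃ ρ > 0, ρ ≤ ρ0 ∧ ∃ δ > 0, ∃ g : ℝ → ℝ, ContinuousOn g (Set.Ioo 0 δ) ∧ ∀ e ∈ Set.Ioo 0 δ,
      |g e - z| < ρ ∧ qq n e b (g e) = 0 ∧ 0 < qm n 0 b z * qm n e b (g e) ∧
      ∀ x, |x - z| < ρ → qq n e b x = 0 → x = g e := by
  set a := qm n 0 b z with had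
  have hapos : 0 < |a| := abs_pos.2 ha
  obtain ⟨δ1, hδ1, hs⟩ := qq_strict n 0 b z (|a|/2) (by positivity)
  have hqmc : ∀ᶠ v : ℝ × ℝ × ℝ in nhds (0, b, z), 0 < a * qm n v.1 v.2.1 v.2.2 := by
    have : Continuous (fun v : ℝ × ℝ × ℝ => a * qm n v.1 v.2.1 v.2.2) := continuous_const.mul (qm_cont n)
    refine (this.tendsto (0,b,z)).eventually_const_lt ?_
    exact mul_self_pos.2 ha
  rw [Metric.eventually_nhds_iff] at hqmc
  obtain ⟨δ2, hδ2, hqmc⟩ := hqmc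
  obtain ⟨ρ, hρ, hρ0', hρ1, hρ2⟩ : ∃ ρ > 0, ρ ≤ ρ0 ∧ ρ < δ1 ∧ ρ < δ2 := by
    refine ⟨min ρ0 (min (δ1/2) (δ2/2)), by positivity, min_le_left _ _, ?_, ?_⟩
    · exact ((min_le_right _ _).trans (min_le_left _ _)).trans_lt (by linarith)
    · exact ((min_le_right _ _).trans (min_le_right _ _)).trans_lt (by linarith)
  have hs' : ∀ e m1 m2 : ℝ, |e| < δ1 → |m1 - z| < δ1 → |m2 - z| < δ1 →
      |qq n e b m1 - qq n e b m2 - a*(m1-m2)| ≤ |a|/2*|m1-m2| := by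
    intro e m1 m2 h1 h2 h3
    have := hs e b m1 b m2 (by simpa using h1) (by simpa using hδ1) h2 (by simpa using hδ1) h3
    simpa using this
  have hlow : ∀ e m1 m2 : ℝ, |e| < δ1 → |m1 - z| < δ1 → |m2 - z| < δ1 →
      |a|/2*|m1-m2| ≤ |qq n e b m1 - qq n e b m2| := by
    intro e m1 m2 h1 h2 h3
    have h4 := hs' e m1 m2 h1 h2 h3
    have h5 := abs_sub_abs_le_abs_sub (a*(m1-m2)) (qq n e b m1 - qq n e b m2)
    rw [abs_sub_comm (a*(m1-m2)), abs_mul] at h5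
    linarith
  have hc1 : ∀ x, Continuous (fun e : ℝ => qq n e b x) := fun x =>
    (qq_cont n).comp (by fun_prop : Continuous fun e : ℝ => ((e, b, x) : ℝ × ℝ × ℝ))
  have hc2 : ∀ e, Continuous (fun x : ℝ => qq n e b x) := fun e =>
    (qq_cont n).comp (by fun_prop : Continuous fun x : ℝ => ((e, b, x) : ℝ × ℝ × ℝ))
  -- signs at the ends
  have hplus : 0 < a * qq n 0 b (z + ρ/2) := by
    have := hs' 0 (z+ρ/2) z (by simpa using hδ1) (by rw [add_sub_cancel_left, abs_of_pos (by positivity)]; linarith) (by simpa using hδ1)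
    rw [h, sub_zero, add_sub_cancel_left, abs_of_pos (by positivity : 0 < ρ/2)] at this
    have hh := abs_le.1 this
    rcases lt_or_gt_of_ne ha with h0 | h0
    · rw [abs_of_neg h0] at hh
      refine mul_pos_of_neg_of_neg h0 ?_
      nlinarith [hh.2, mul_neg_of_neg_of_pos h0 hρ]
    · rw [abs_of_pos h0] at hh
      refine mul_pos h0 ?_
      nlinarith [hh.1, mul_pos h0 hρ]
  have hminus : a * qq n 0 b (z - ρ/2) < 0 := by
    have := hs' 0 (z-ρ/2) z (by simpa using hδ1) (by rw [show z - ρ/2 - z = -(ρ/2) by ring, abs_neg, abs_of_pos (by positivity)]; linarith) (by simpa using hδ1)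
    rw [h, sub_zero, show z - ρ/2 - z = -(ρ/2) by ring, abs_neg, abs_of_pos (by positivity : 0 < ρ/2)] at this
    have hh := abs_le.1 this
    rcases lt_or_gt_of_ne ha with h0 | h0
    · rw [abs_of_neg h0] at hh
      refine mul_neg_of_neg_of_pos h0 ?_
      nlinarith [hh.1, mul_neg_of_neg_of_pos h0 hρ]
    · rw [abs_of_pos h0] at hh
      refine mul_neg_of_pos_of_neg h0 ?_
      nlinarith [hh.2, mul_pos h0 hρ]
  have ev1 : ∀ᶠ e in nhds (0:ℝ), 0 < a * qq n e b (z + ρ/2) :=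
    ((continuous_const.mul (hc1 (z+ρ/2))).tendsto 0).eventually_const_lt hplus
  have ev2 : ∀ᶠ e in nhds (0:ℝ), a * qq n e b (z - ρ/2) < 0 :=
    ((continuous_const.mul (hc1 (z-ρ/2))).tendsto 0).eventually_lt_const hminus
  obtain ⟨δ3, hδ3, ev⟩ := Metric.eventually_nhds_iff.1 (ev1.and ev2)
  obtain ⟨δ, hδ, hd1, hd2, hd3⟩ : ∃ δ > 0, δ ≤ δ1 ∧ δ ≤ δ2 ∧ δ ≤ δ3 :=
    ⟨min δ1 (min δ2 δ3), by positivity, min_le_left _ _, (min_le_right _ _).trans (min_le_left _ _), (min_le_right _ _).trans (min_le_right _ _)⟩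
  have habs : ∀ e ∈ Set.Ioo 0 δ, |e| < δ := fun e he => by rw [abs_of_pos he.1]; exact he.2
  have hex : ∀ e ∈ Set.Ioo 0 δ, ∃ x, |x - z| < ρ ∧ qq n e b x = 0 := by
    intro e he
    obtain ⟨s1, s2⟩ := ev (y := e) (by rw [Real.dist_eq, sub_zero]; exact (habs e he).trans_le hd3)
    have := intermediate_value_Icc (by linarith : z - ρ/2 ≤ z + ρ/2) (continuous_const.mul (hc2 e) : Continuous fun x => a * qq n e b x).continuousOn
    obtain ⟨x, hx, hx0⟩ := this (Set.mem_Icc.2 ⟨s2.le, s1.le⟩)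
    refine ⟨x, ?_, (mul_eq_zero.1 hx0).resolve_left ha⟩
    rw [abs_lt]; constructor <;> linarith [hx.1, hx.2]
  choose! g hg1 hg2 using hex
  refine ⟨ρ, hρ, hρ0', δ, hδ, g, ?_, ?_⟩
  · intro e0 he0
    refine ContinuousAt.continuousWithinAt ?_
    have hnb : ∀ᶠ e in nhds e0, e ∈ Set.Ioo 0 δ := Ioo_mem_nhds he0.1 he0.2
    rw [ContinuousAt, tendsto_iff_norm_sub_tendsto_zero]
    have hz : Tendsto (fun e => |a|⁻¹*2*|qq n e b (g e0)|) (nhds e0) (nhds 0) := by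
      have := ((hc1 (g e0)).abs.tendsto e0).const_mul (|a|⁻¹*2)
      rw [hg2 e0 he0, abs_zero, mul_zero] at this
      exact this
    refine squeeze_zero' (Eventually.of_forall fun _ => norm_nonneg _) ?_ hz
    filter_upwards [hnb] with e he
    have := hlow e (g e) (g e0) ((habs e he).trans_le hd1) ((hg1 e he).trans hρ1) ((hg1 e0 he0).trans hρ1)
    rw [hg2 e he, zero_sub, abs_neg] at this
    rw [Real.norm_eq_abs, mul_assoc, le_inv_mul_iff₀ hapos]
    linarith
  · intro e he
    refine ⟨hg1 e he, hg2 e he, ?_, ?_⟩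
    · refine hqmc (y := (e, b, g e)) ?_
      rw [Prod.dist_eq, Prod.dist_eq, Real.dist_eq, Real.dist_eq, Real.dist_eq]
      simp only [sub_zero, sub_self, abs_zero]
      exact max_lt ((habs e he).trans_le hd2) (max_lt hδ2 ((hg1 e he).trans hρ2))
    · intro x hx hx0
      have := hlow e x (g e) ((habs e he).trans_le hd1) (hx.trans hρ1) ((hg1 e he).trans hρ1)
      rw [hx0, hg2 e he, sub_zero, abs_zero] at this
      have h5 : |x - g e| ≤ 0 := by
        by_contra hcon
        push Not at hcon
        have := mul_pos (half_pos hapos) hcon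
        linarith
      exact sub_eq_zero.1 (abs_nonpos_iff.1 h5)

lemma tail_all (n : ℕ) (b : ℝ) (J : Finset ℕ) (z : ℕ → ℝ) (hall : ∀ x, qq n 0 b x = 0 → ∃ j ∈ J, x = z j)
    (hz : ∀ j ∈ J, qq n 0 b (z j) = 0 ∧ qm n 0 b (z j) ≠ 0) (ρ0 : ℕ → ℝ) (hρ0 : ∀ j ∈ J, 0 < ρ0 j) :
    ∃ δ > 0, ∃ g : ℕ → ℝ → ℝ, (∀ j ∈ J, ContinuousOn (g j) (Set.Ioo 0 δ)) ∧ ∀ e ∈ Set.Ioo 0 δ,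
      (∀ j ∈ J, |g j e - z j| < ρ0 j ∧ qq n e b (g j e) = 0 ∧ 0 < qm n 0 b (z j) * qm n e b (g j e)) ∧
      ∀ x, qq n e b x = 0 → ∃ j ∈ J, x = g j e := by
  have ht : ∀ j ∈ J, _ := fun j hj => tail_one n b (z j) (hz j hj).1 (hz j hj).2 (ρ0 j) (hρ0 j hj)
  choose! ρ hρ hρρ δ hδ g hgc hg using ht
  obtain ⟨M, hM⟩ : ∃ M, M = 2*|b| + 1 + 2*((n:ℝ)+1)^2 := ⟨_, rfl⟩
  have hK : IsCompact ({x : ℝ | ∀ j ∈ J, ρ j ≤ |x - z j|} ∩ Set.Icc (-M) M) := by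
    refine isCompact_Icc.inter_left ?_
    have : {x : ℝ | ∀ j ∈ J, ρ j ≤ |x - z j|} = ⋂ j ∈ J, {x : ℝ | ρ j ≤ |x - z j|} := by ext; simp
    rw [this]
    exact isClosed_biInter fun j _ => isClosed_le continuous_const (by fun_prop)
  have ev : ∀ᶠ e in nhds (0:ℝ), ∀ x ∈ ({x : ℝ | ∀ j ∈ J, ρ j ≤ |x - z j|} ∩ Set.Icc (-M) M), qq n e b x ≠ 0 := by
    refine hK.eventually_forall_of_forall_eventually fun x hx => ?_
    have hc : Continuous (fun v : ℝ × ℝ => qq n v.1 b v.2) := 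
      (qq_cont n).comp (by fun_prop : Continuous fun v : ℝ × ℝ => ((v.1, b, v.2) : ℝ × ℝ × ℝ))
    refine hc.continuousAt.eventually_ne ?_
    intro h0
    obtain ⟨j, hj, hxj⟩ := hall x h0
    have := hx.1 j hj
    rw [hxj, sub_self, abs_zero] at this
    linarith [hρ j hj]
  have ev2 : ∀ᶠ e in nhds (0:ℝ), ∀ j ∈ J, |e| < δ j := by
    rw [Finset.eventually_all]
    intro j hj
    have : Tendsto (fun e : ℝ => |e|) (nhds 0) (nhds 0) := by simpa using (continuous_abs (G := ℝ)).tendsto 0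
    exact this.eventually_lt_const (hδ j hj)
  obtain ⟨δ', hδ', H⟩ := Metric.eventually_nhds_iff.1 (ev.and ev2)
  refine ⟨min δ' 1, by positivity, g, ?_, ?_⟩
  · intro j hj
    refine (hgc j hj).mono fun e he => ⟨he.1, ?_⟩
    have := (H (y := e) (by rw [Real.dist_eq, sub_zero, abs_of_pos he.1]; exact he.2.trans_le (min_le_left _ _))).2 j hj
    exact (le_abs_self e).trans_lt this
  · intro e he
    have hH := H (y := e) (by rw [Real.dist_eq, sub_zero, abs_of_pos he.1]; exact he.2.trans_le (min_le_left _ _))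
    have hI : ∀ j ∈ J, e ∈ Set.Ioo 0 (δ j) := fun j hj => ⟨he.1, (le_abs_self e).trans_lt (hH.2 j hj)⟩
    refine ⟨fun j hj => ?_, fun x hx => ?_⟩
    · obtain ⟨h1, h2, h3, -⟩ := hg j hj e (hI j hj)
      exact ⟨h1.trans_le (hρρ j hj), h2, h3⟩
    · by_contra hcon
      push Not at hcon
      refine hH.1 x ⟨fun j hj => ?_, ?_⟩ hx
      · by_contra hlt
        push Not at hlt
        exact hcon j hj ((hg j hj e (hI j hj)).2.2.2 x hlt hx)
      · have := qq_bound n e b x (by rw [abs_of_pos he.1]; exact (he.2.trans_le (min_le_right _ _)).le) hx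
        rw [← hM] at this
        exact abs_le.1 this.le

end QES

namespace QES

lemma ph_scale2 (n : ℕ) (s e b m : ℝ) (hs : s ≠ 0) (k : ℕ) : ph n (s^3*e) (s^2*b) (s*m) (k+2) = s^k * ph n e b m (k+2) := by
  have := ph_scale n s e b m (k+2)
  have h2 : s^2 ≠ 0 := pow_ne_zero _ hs
  apply mul_left_cancel₀ h2
  rw [this]; ring

lemma qm_scale (n : ℕ) (s e b m : ℝ) (hs : s ≠ 0) : qm n (s^3*e) (s^2*b) (s*m) = s^n * qm n e b m := by
  unfold qm
  rw [PP_eq, PP_eq, Finset.mul_sum]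
  refine Finset.sum_congr rfl fun k hk => ?_
  have hk' : k ≤ n := by have := Finset.mem_range.1 hk; omega
  rw [ph_scale2 n s e b m hs, ph_scale2 n s e b m hs]
  have : s^n = s^k * s^(n-k) := by rw [← pow_add]; congr 1; omega
  rw [this]; ring

lemma qq_scale2 (n : ℕ) (s e b m : ℝ) (hs : s ≠ 0) : qq n (s^3*e) (s^2*b) (s*m) = 0 ↔ qq n e b m = 0 := by
  have := qq_scale n s e b m
  constructor
  · intro h
    rw [h, mul_zero] at this
    exact (mul_eq_zero.1 this.symm).resolve_left (pow_ne_zero _ hs)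
  · intro h
    rw [h, mul_zero] at this
    exact (mul_eq_zero.1 this).resolve_left (pow_ne_zero _ hs)

lemma PC_scale (n : ℕ) (s e b m : ℝ) (hs : s ≠ 0) (z : ℂ) :
    (PC n (s^3*e) (s^2*b) (s*m)).eval (s*z) = s^n * (PC n e b m).eval z := by
  rw [PC_eval_sum, PC_eval_sum, Finset.mul_sum]
  refine Finset.sum_congr rfl fun k hk => ?_
  have hk' : k ≤ n := by have := Finset.mem_range.1 hk; omega
  rw [show n + 2 - k = (n-k) + 2 by omega, ph_scale2 n s e b m hs]
  have : (s:ℂ)^n = s^k * s^(n-k) := by rw [← pow_add]; congr 1; omega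
  rw [this, mul_pow]; push_cast; ring

lemma NR_scale (n : ℕ) (s e b m : ℝ) (hs : s ≠ 0) : NR n (s^3*e) (s^2*b) (s*m) = NR n e b m := by
  have hsc : (s:ℂ) ≠ 0 := by exact_mod_cast hs
  unfold NR
  symm
  refine Finset.card_nbij (fun z => (s:ℂ)*z) ?_ ?_ ?_
  · intro z hz
    rw [Finset.mem_coe, Finset.mem_filter, mem_PC] at hz ⊢
    refine ⟨by rw [PC_scale n s e b m hs, hz.1, mul_zero], by rw [im_ofReal_mul, hz.2, mul_zero]⟩
  · intro z _ w _ h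
    exact mul_left_cancel₀ hsc h
  · intro y hy
    rw [Finset.mem_coe, Finset.mem_filter, mem_PC] at hy
    have e1 : y = (s:ℂ) * ((s:ℂ)⁻¹ * y) := by rw [mul_inv_cancel_left₀ hsc]
    refine ⟨(s:ℂ)⁻¹*y, ?_, e1.symm⟩
    rw [Finset.mem_coe, Finset.mem_filter, mem_PC]
    constructor
    · have h1 := hy.1
      rw [e1, PC_scale n s e b m hs] at h1
      exact (mul_eq_zero.1 h1).resolve_left (pow_ne_zero _ hsc)
    · rw [← ofReal_inv, im_ofReal_mul, hy.2, mul_zero]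

lemma tails (n : ℕ) (σ : ℝ) (J : Finset ℕ) (z : ℕ → ℝ) (hall : ∀ x, qq n 0 σ x = 0 → ∃ j ∈ J, x = z j)
    (hz : ∀ j ∈ J, qq n 0 σ (z j) = 0 ∧ qm n 0 σ (z j) ≠ 0) (N : ℕ → ℕ)
    (hN : ∀ j ∈ J, ∃ δ > 0, ∀ e x : ℝ, 0 < e → e < δ → |x - z j| < δ → qq n e σ x = 0 → NR n e σ x = N j) :
    ∃ R > 0, ∃ G : ℕ → ℝ → ℝ, (∀ j ∈ J, ContinuousOn (G j) (Set.Ici R)) ∧ ∀ t ≥ R,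
      (∀ j ∈ J, qq n 1 (σ*t) (G j t) = 0 ∧ 0 < qm n 0 σ (z j) * qm n 1 (σ*t) (G j t) ∧ NR n 1 (σ*t) (G j t) = N j) ∧
      ∀ μ, qq n 1 (σ*t) μ = 0 → ∃ j ∈ J, μ = G j t := by
  choose! δ1 hδ1 hN using hN
  obtain ⟨δ2, hδ2, g, hgc, hg⟩ := tail_all n σ J z hall hz δ1 hδ1
  have ev : ∀ᶠ e in nhdsWithin (0:ℝ) (Set.Ioi 0), (∀ j ∈ J, e < δ1 j) ∧ e < δ2 := by
    refine Eventually.and ?_ ?_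
    · rw [Finset.eventually_all]
      intro j hj
      exact mem_nhdsWithin_of_mem_nhds (Iio_mem_nhds (hδ1 j hj))
    · exact mem_nhdsWithin_of_mem_nhds (Iio_mem_nhds hδ2)
  have hlim : Tendsto (fun t : ℝ => ((Real.sqrt t)^3)⁻¹) atTop (nhdsWithin (0:ℝ) (Set.Ioi 0)) :=
    tendsto_inv_atTop_nhdsGT_zero.comp ((tendsto_pow_atTop (by norm_num)).comp Real.tendsto_sqrt_atTop)
  obtain ⟨R, hR⟩ := eventually_atTop.1 (hlim.eventually ev)
  have hpos : ∀ t ≥ max R 1, 0 < Real.sqrt t := fun t ht =>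
    Real.sqrt_pos.2 (lt_of_lt_of_le one_pos ((le_max_right _ _).trans ht))
  have hIoo : ∀ t ≥ max R 1, ((Real.sqrt t)^3)⁻¹ ∈ Set.Ioo 0 δ2 := fun t ht =>
    ⟨inv_pos.2 (pow_pos (hpos t ht) 3), (hR t ((le_max_left _ _).trans ht)).2⟩
  refine ⟨max R 1, by positivity, fun j t => Real.sqrt t * g j ((Real.sqrt t)^3)⁻¹, ?_, ?_⟩
  · intro j hj
    refine (Real.continuous_sqrt.continuousOn).mul ((hgc j hj).comp ?_ hIoo)
    refine ContinuousOn.inv₀ (by fun_prop) fun t ht => (pow_pos (hpos t ht) 3).ne'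
  · intro t ht
    have hs := hpos t ht
    set s := Real.sqrt t with hsd
    have hs0 := hs.ne'
    obtain ⟨e, he⟩ : ∃ e, e = (s^3)⁻¹ := ⟨_, rfl⟩
    have heI := hIoo t ht
    rw [← he] at heI
    have e1 : s^3*e = 1 := by rw [he]; exact mul_inv_cancel₀ (pow_ne_zero _ hs0)
    have e2 : σ*t = s^2*σ := by rw [hsd, Real.sq_sqrt (by linarith [le_max_right R 1])]; ring
    obtain ⟨h1, h2⟩ := hg e heI
    simp only [← hsd, ← he]
    rw [e2, ← e1]
    refine ⟨fun j hj => ?_, fun μ hμ => ?_⟩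
    · obtain ⟨a1, a2, a3⟩ := h1 j hj
      rw [qq_scale2 n s e σ _ hs0, qm_scale n s e σ _ hs0, NR_scale n s e σ _ hs0]
      refine ⟨a2, ?_, hN j hj e _ heI.1 ?_ a1 a2⟩
      · have := mul_pos (pow_pos hs n) a3
        linarith
      · have := (hR t ((le_max_left _ _).trans ht)).1 j hj
        rwa [he]
    · have e3 : μ = s * (s⁻¹*μ) := by rw [mul_inv_cancel_left₀ hs0]
      rw [e3, qq_scale2 n s e σ _ hs0] at hμ
      obtain ⟨j, hj, hx⟩ := h2 _ hμ
      exact ⟨j, hj, by rw [e3, hx]⟩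

lemma tails_right (n : ℕ) : ∃ R > 0, ∃ G : ℕ → ℝ → ℝ, (∀ j ≤ n, ContinuousOn (G j) (Set.Ici R)) ∧ ∀ t ≥ R,
      (∀ j ≤ n, qq n 1 t (G j t) = 0 ∧ 0 < (-1)^j * qm n 1 t (G j t) ∧ NR n 1 t (G j t) = n - 2*(j/2)) ∧
      ∀ μ, qq n 1 t μ = 0 → ∃ j ≤ n, μ = G j t := by
  have hJ : ∀ j, j ∈ Finset.range (n+1) ↔ j ≤ n := fun j => by rw [Finset.mem_range]; omega
  have := tails n 1 (Finset.range (n+1)) (fun j => 2*((n:ℝ)-2*j)) (by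
    intro x hx; simpa only [hJ] using roots_right n x hx) (by
    intro j hj
    refine ⟨(PC_zero_right n j ((hJ j).1 hj)).1, fun h0 => ?_⟩
    have := qm_right n j ((hJ j).1 hj)
    rw [h0, mul_zero] at this
    exact lt_irrefl _ this) (fun j => n - 2*(j/2)) (fun j hj => NR_right n j ((hJ j).1 hj))
  simp only [hJ, one_mul] at this
  obtain ⟨R, hR, G, hG, h⟩ := this
  refine ⟨R, hR, G, hG, fun t ht => ⟨fun j hj => ?_, (h t ht).2⟩⟩
  obtain ⟨a1, a2, a3⟩ := (h t ht).1 j hj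
  refine ⟨a1, ?_, a3⟩
  have h3 := qm_right n j hj
  have h4 : 0 < ((-1)^j * qm n 0 1 (2*((n:ℝ)-2*j))) * ((-1)^j * qm n 1 t (G j t)) := by
    have : ((-1:ℝ)^j)*((-1)^j) = 1 := by rw [← mul_pow]; simp
    calc (0:ℝ) < (((-1:ℝ)^j)*((-1)^j)) * (qm n 0 1 (2*((n:ℝ)-2*j)) * qm n 1 t (G j t)) := by rw [this, one_mul]; exact a2
      _ = _ := by ring
  exact (pos_iff_pos_of_mul_pos h4).1 h3

lemma tails_left_odd (n : ℕ) (hn : ¬ Even n) : ∃ R > 0, ∀ t ≥ R, ∀ μ, qq n 1 (-t) μ ≠ 0 := by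
  obtain ⟨R, hR, G, hG, h⟩ := tails n (-1) ∅ (fun j => 0) (by
    intro x hx; exact absurd (roots_left n x hx).2 hn) (by simp) (fun j => 0) (by simp)
  refine ⟨R, hR, fun t ht μ hμ => ?_⟩
  obtain ⟨j, hj, -⟩ := (h t ht).2 μ (by rw [neg_one_mul]; exact hμ)
  simp at hj

lemma tails_left_even (k : ℕ) : ∃ R > 0, ∃ G : ℝ → ℝ, ContinuousOn G (Set.Ici R) ∧ ∀ t ≥ R,
      (qq (2*k) 1 (-t) (G t) = 0 ∧ 0 < qm (2*k) 1 (-t) (G t) ∧ NR (2*k) 1 (-t) (G t) = 0) ∧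
      ∀ μ, qq (2*k) 1 (-t) μ = 0 → μ = G t := by
  have := tails (2*k) (-1) {0} (fun j => 0) (by
    intro x hx; simpa using (roots_left (2*k) x hx).1) (by
    intro j hj
    exact ⟨(PC_zero_left k).1, (qm_left k).ne'⟩) (fun j => 0) (fun j hj => by
      obtain ⟨δ, hδ, h⟩ := NR_left k
      refine ⟨δ, hδ, fun e x he heδ hx _ => h e x (by rwa [abs_of_pos he]) (by simpa using hx)⟩)
  simp only [Finset.mem_singleton, forall_eq, exists_eq_left, neg_one_mul] at this
  obtain ⟨R, hR, G, hG, h⟩ := this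
  refine ⟨R, hR, G 0, hG, fun t ht => ⟨?_, (h t ht).2⟩⟩
  obtain ⟨a1, a2, a3⟩ := (h t ht).1
  exact ⟨a1, (pos_iff_pos_of_mul_pos a2).1 (qm_left k), a3⟩

end QES

namespace QES

lemma exists_fol (n : ℕ) : ∃ σ Λ Θ, Fol (fun x => qq n 1 x.1 x.2) (fun x => qm n 1 x.1 x.2)
    (fun x => qb n 1 x.1 x.2) σ Λ Θ := by
  have cF : Continuous (fun x : ℝ × ℝ => qq n 1 x.1 x.2) :=
    (qq_cont n).comp (f := fun x : ℝ × ℝ => ((1, x.1, x.2) : ℝ × ℝ × ℝ)) (by fun_prop)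
  have cA : Continuous (fun x : ℝ × ℝ => qm n 1 x.1 x.2) :=
    (qm_cont n).comp (f := fun x : ℝ × ℝ => ((1, x.1, x.2) : ℝ × ℝ × ℝ)) (by fun_prop)
  have cB : Continuous (fun x : ℝ × ℝ => qb n 1 x.1 x.2) :=
    (qb_cont n).comp (f := fun x : ℝ × ℝ => ((1, x.1, x.2) : ℝ × ℝ × ℝ)) (by fun_prop)
  obtain ⟨σ, h1, h2, h3⟩ := exists_slope _ _ _ cF cA cB (fun x h h' => lemmaK n x.1 x.2 h h')
    (1 + 2*((n:ℝ)+1)^2) (fun x h => by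
      have := qq_bound n 1 x.1 x.2 (by simp) h
      linarith)
  obtain ⟨Λ, Θ, t1, t2, t3, t4, t5⟩ := exists_Theta σ h1 _ h3
  refine ⟨σ, Λ, Θ, cF, cA, ?_, h1.continuous, h2, ?_, t1, t2, t3, t4, t5⟩
  · intro x η hη
    obtain ⟨δ, hδ, h⟩ := qq_strict n 1 x.1 x.2 η hη
    refine ⟨δ, hδ, fun y z hy hz => ?_⟩
    rw [Prod.dist_eq, max_lt_iff, Real.dist_eq, Real.dist_eq] at hy hz
    exact h 1 y.1 y.2 z.1 z.2 (by simpa using hδ) hy.1 hy.2 hz.1 hz.2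
  · intro R
    obtain ⟨K, L, h⟩ := slope_lip σ h1 _ h3 R
    exact ⟨L, L.2, fun t ht y => (h t ht).2 y⟩

/-- the curve in `(b, μ)` coordinates -/
def GG (n m : ℕ) : Set (ℝ × ℝ) := {x | qq n 1 x.1 x.2 = 0 ∧ NR n 1 x.1 x.2 = n - 2*m}

lemma GG_closed (n m : ℕ) : IsClosed (GG n m) := by
  have cF : Continuous (fun x : ℝ × ℝ => qq n 1 x.1 x.2) :=
    (qq_cont n).comp (f := fun x : ℝ × ℝ => ((1, x.1, x.2) : ℝ × ℝ × ℝ)) (by fun_prop)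
  rw [← isOpen_compl_iff, isOpen_iff_mem_nhds]
  intro x hx
  by_cases h0 : qq n 1 x.1 x.2 = 0
  · filter_upwards [NR_locconst n x.1 x.2 h0] with y hy hyG
    exact hx ⟨h0, (hy hyG.1) ▸ hyG.2⟩
  · filter_upwards [cF.continuousAt.eventually_ne h0] with y hy hyG
    exact hy hyG.1

lemma curve (n m : ℕ) {σ Λ Θ} (H : Fol (fun x => qq n 1 x.1 x.2) (fun x => qm n 1 x.1 x.2)
    (fun x => qb n 1 x.1 x.2) σ Λ Θ) (R : ℝ) (o ι : ℝ → ℝ × ℝ)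
    (ho : ContinuousOn o (Set.Ici R)) (hι : ContinuousOn ι (Set.Ici R))
    (hoG : ∀ t ≥ R, o t ∈ GG n m) (hιG : ∀ t ≥ R, ι t ∈ GG n m)
    (hoR : |(o R).1| ≤ R) (hιR : |(ι R).1| ≤ R)
    (hall : ∀ x ∈ GG n m, R < |x.1| → (∃ t ≥ R, o t = x) ∨ (∃ t ≥ R, ι t = x))
    (mo : StrictMonoOn (fun t => Θ (o t)) (Set.Ici R)) (mι : StrictAntiOn (fun t => Θ (ι t)) (Set.Ici R)) :
    ∃ f : ℝ → ℝ × ℝ, Continuous f ∧ Function.Injective f ∧ (∀ K, IsCompact K → IsCompact (f ⁻¹' K)) ∧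
      Set.range f = GG n m := by
  have hclK : IsClosed {x : ℝ × ℝ | |x.1| ≤ R} := isClosed_le (by fun_prop) continuous_const
  have e1 : o R ∈ GG n m ∩ {x : ℝ × ℝ | |x.1| ≤ R} := ⟨hoG R le_rfl, hoR⟩
  have e2 : ι R ∈ GG n m ∩ {x : ℝ × ℝ | |x.1| ≤ R} := ⟨hιG R le_rfl, hιR⟩
  refine param Θ H.cΘ (GG n m) (GG_closed n m) ?_ ?_ (GG n m ∩ {x : ℝ × ℝ | |x.1| ≤ R}) ?_ R o ι ho hι
    e1 e2 ?_ mo mι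
  · intro x hx
    obtain ⟨N, hN, h⟩ := H.inj x hx.1
    refine ⟨N, hN, h.mono ?_⟩
    intro y hy
    exact ⟨hy.1, hy.2.1⟩
  · intro x hx N hN
    have hU := NR_locconst n x.1 x.2 hx.1
    refine mem_of_superset (H.open x hx.1 _ (inter_mem hN hU)) (Set.image_mono ?_)
    rintro y ⟨⟨hy, hyU⟩, hy0⟩
    exact ⟨hy, hy0, (hyU hy0).trans hx.2⟩
  · refine IsCompact.of_isClosed_subset (isCompact_Icc.prod isCompact_Icc :
      IsCompact (Set.Icc (-R) R ×ˢ Set.Icc (-(2*R+1+2*((n:ℝ)+1)^2)) (2*R+1+2*((n:ℝ)+1)^2)))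
      ((GG_closed n m).inter hclK) ?_
    rintro x ⟨hx, hxR⟩
    have hxR : |x.1| ≤ R := hxR
    have := qq_bound n 1 x.1 x.2 (by simp) hx.1
    exact ⟨abs_le.1 hxR, abs_le.1 (by linarith)⟩
  · ext x
    constructor
    · intro hx
      rcases le_or_gt |x.1| R with h | h
      · exact Or.inl (Or.inl ⟨hx, h⟩)
      · rcases hall x hx h with ⟨t, ht, rfl⟩ | ⟨t, ht, rfl⟩
        · exact Or.inl (Or.inr ⟨t, ht, rfl⟩)
        · exact Or.inr ⟨t, ht, rfl⟩
    · rintro ((hx | ⟨t, ht, rfl⟩) | ⟨t, ht, rfl⟩)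
      · exact hx.1
      · exact hoG t ht
      · exact hιG t ht

lemma curve_all (n m : ℕ) (hm : m ≤ n / 2) :
    ∃ f : ℝ → ℝ × ℝ, Continuous f ∧ Function.Injective f ∧ (∀ K, IsCompact K → IsCompact (f ⁻¹' K)) ∧
      Set.range f = GG n m := by
  obtain ⟨σ, Λ, Θ, H⟩ := exists_fol n
  obtain ⟨R1, hR1, G, hG, hGt⟩ := tails_right n
  have even_mono : ∀ R ≥ R1, ∀ j ≤ n, Even j → StrictMonoOn (fun t => Θ (t, G j t)) (Set.Ici R) := by
    intro R hR j hj he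
    refine (H.tail (Set.Ici R) Set.ordConnected_Ici (G j)
      ((hG j hj).mono (Set.Ici_subset_Ici.2 hR)) (fun b hb => ((hGt b (hR.trans hb)).1 j hj).1)).1 ?_
    intro b hb
    have := ((hGt b (hR.trans hb)).1 j hj).2.1
    rwa [he.neg_one_pow, one_mul] at this
  have odd_anti : ∀ R ≥ R1, ∀ j ≤ n, Odd j → StrictAntiOn (fun t => Θ (t, G j t)) (Set.Ici R) := by
    intro R hR j hj he
    refine (H.tail (Set.Ici R) Set.ordConnected_Ici (G j)
      ((hG j hj).mono (Set.Ici_subset_Ici.2 hR)) (fun b hb => ((hGt b (hR.trans hb)).1 j hj).1)).2 ?_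
    intro b hb
    have := ((hGt b (hR.trans hb)).1 j hj).2.1
    rw [he.neg_one_pow] at this
    show qm n 1 b (G j b) < 0
    linarith
  have cG : ∀ R ≥ R1, ∀ j ≤ n, ContinuousOn (fun t => ((t, G j t) : ℝ × ℝ)) (Set.Ici R) := by
    intro R hR j hj
    exact continuousOn_id.prodMk ((hG j hj).mono (Set.Ici_subset_Ici.2 hR))
  have memG : ∀ t ≥ R1, ∀ j ≤ n, j / 2 = m → (t, G j t) ∈ GG n m := by
    intro t ht j hj hjm
    have := (hGt t ht).1 j hj
    exact ⟨this.1, by rw [← hjm]; exact this.2.2⟩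
  have allG : ∀ x ∈ GG n m, R1 ≤ x.1 → ∃ j ≤ n, j / 2 = m ∧ (x.1, G j x.1) = x := by
    intro x hx hxR
    obtain ⟨j, hj, h⟩ := (hGt x.1 hxR).2 x.2 hx.1
    refine ⟨j, hj, ?_, by rw [← h]⟩
    have h1 := ((hGt x.1 hxR).1 j hj).2.2
    rw [← h, hx.2] at h1
    omega
  by_cases hnm : n = 2 * m
  · obtain ⟨R2, hR2, Gl, hGL, hL⟩ := tails_left_even m
    rw [← hnm] at hL
    have hR1' : max R1 R2 ≥ R1 := le_max_left _ _
    have hR2' : max R1 R2 ≥ R2 := le_max_right _ _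
    have hne : Even n := hnm ▸ even_two_mul m
    have hpos : 0 < max R1 R2 := lt_of_lt_of_le hR1 hR1'
    generalize max R1 R2 = R at *
    have hGl1 : ContinuousOn Gl (Set.Ici R) := hGL.mono (Set.Ici_subset_Ici.2 hR2')
    refine curve n m H R (fun t => (t, G n t)) (fun t => (-t, Gl t)) (cG R hR1' n le_rfl)
      (continuousOn_id.neg.prodMk hGl1) (fun t ht => memG t (hR1'.trans ht) n le_rfl (by omega)) ?_ ?_ ?_ ?_
      (even_mono R hR1' n le_rfl hne) ?_
    · intro t ht
      have := (hL t (hR2'.trans ht)).1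
      exact ⟨this.1, by rw [this.2.2]; omega⟩
    · simp [abs_of_pos hpos]
    · simp [abs_of_pos hpos]
    · intro x hx hxR
      rcases lt_abs.1 hxR with h | h
      · obtain ⟨j, hj, hjm, hj'⟩ := allG x hx (hR1'.trans h.le)
        obtain rfl : j = n := by omega
        exact Or.inl ⟨x.1, h.le, hj'⟩
      · have h2 := (hL (-x.1) (hR2'.trans h.le)).2 x.2 (by rw [neg_neg]; exact hx.1)
        refine Or.inr ⟨-x.1, h.le, ?_⟩
        simp only [neg_neg, ← h2]
    · have := (H.tail (Set.Iic (-R)) Set.ordConnected_Iic (fun b => Gl (-b)) (by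
        refine hGl1.comp continuousOn_neg ?_
        intro b hb
        have : b ≤ -R := hb
        exact (by linarith : R ≤ -b)) (by
        intro b hb
        have hb : b ≤ -R := hb
        have := (hL (-b) (by linarith)).1.1
        rwa [neg_neg] at this)).1 (by
        intro b hb
        have hb : b ≤ -R := hb
        have := (hL (-b) (by linarith)).1.2.1
        rwa [neg_neg] at this)
      intro s hs t ht hst
      have ht2 : -t ≤ -R := neg_le_neg ht
      have hs2 : -s ≤ -R := neg_le_neg hs
      have h := this (a := -t) (b := -s) ht2 hs2 (neg_lt_neg hst)
      simpa using h
  · have h1 : 2*m+1 ≤ n := by omega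
    obtain ⟨R2, hR2, hL⟩ : ∃ R2 > 0, ∀ t ≥ R2, ∀ μ, ((-t, μ) : ℝ × ℝ) ∉ GG n m := by
      by_cases hne : Even n
      · obtain ⟨k, rfl⟩ := hne.two_dvd
        obtain ⟨R2, hR2, Gl, hGL, hL⟩ := tails_left_even k
        refine ⟨R2, hR2, fun t ht μ hx => ?_⟩
        have := (hL t ht).2 μ hx.1
        have h2 : NR (2*k) 1 (-t) μ = 2*k-2*m := hx.2
        rw [this, (hL t ht).1.2.2] at h2
        omega
      · obtain ⟨R2, hR2, hL⟩ := tails_left_odd n hne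
        exact ⟨R2, hR2, fun t ht μ hx => hL t ht μ hx.1⟩
    have hR1' : max R1 R2 ≥ R1 := le_max_left _ _
    have hR2' : max R1 R2 ≥ R2 := le_max_right _ _
    have hpos : 0 < max R1 R2 := lt_of_lt_of_le hR1 hR1'
    generalize max R1 R2 = R at *
    refine curve n m H R (fun t => (t, G (2*m) t)) (fun t => (t, G (2*m+1) t)) (cG R hR1' _ (by omega))
      (cG R hR1' _ h1) (fun t ht => memG t (hR1'.trans ht) _ (by omega) (by omega))
      (fun t ht => memG t (hR1'.trans ht) _ (by omega) (by omega)) (by simp [abs_of_pos hpos])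
      (by simp [abs_of_pos hpos]) ?_
      (even_mono R hR1' _ (by omega) (even_two_mul m)) (odd_anti R hR1' _ h1 (odd_two_mul_add_one m))
    intro x hx hxR
    rcases lt_abs.1 hxR with h | h
    · obtain ⟨j, hj, hjm, hj'⟩ := allG x hx (hR1'.trans h.le)
      obtain rfl | rfl : j = 2*m ∨ j = 2*m+1 := by omega
      · exact Or.inl ⟨x.1, h.le, hj'⟩
      · exact Or.inr ⟨x.1, h.le, hj'⟩
    · refine absurd ?_ (hL (-x.1) (hR2'.trans h.le) x.2)
      rwa [neg_neg]

theorem part3 (n : ℕ) : ∀ m : ℕ, m ≤ n / 2 → (qesGamma n m).Nonempty ∧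
      ∃ f : ℝ → ℝ × ℝ, Continuous f ∧ Function.Injective f ∧
        (∀ K : Set (ℝ × ℝ), IsCompact K → IsCompact (f ⁻¹' K)) ∧
        Set.range f = qesGamma n m := by
  intro m hm
  obtain ⟨f, hf, hi, hp, hr⟩ := curve_all n m hm
  have key : ∃ f : ℝ → ℝ × ℝ, Continuous f ∧ Function.Injective f ∧
        (∀ K : Set (ℝ × ℝ), IsCompact K → IsCompact (f ⁻¹' K)) ∧
        Set.range f = qesGamma n m := by
    refine ⟨fun s => ((f s).1, (f s).2 - (f s).1^2), by fun_prop, ?_, ?_, ?_⟩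
    · intro s t hst
      simp only [Prod.mk.injEq] at hst
      apply hi
      refine Prod.ext hst.1 ?_
      have h2 := hst.2
      rw [hst.1] at h2
      linarith
    · intro K hK
      have h := hp _ (hK.image (by fun_prop : Continuous fun x : ℝ × ℝ => ((x.1, x.2 + x.1^2) : ℝ × ℝ)))
      convert h using 1
      ext s
      simp only [Set.mem_preimage, Set.mem_image]
      constructor
      · intro hs
        exact ⟨_, hs, by simp⟩
      · rintro ⟨x, hx, hxs⟩
        rw [← hxs]
        simpa using hx
    · ext x
      rw [gamma_iff]
      constructor
      · rintro ⟨s, rfl⟩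
        have : f s ∈ GG n m := hr ▸ Set.mem_range_self s
        simpa [GG] using this
      · intro hx
        have : ((x.1, x.2 + x.1^2) : ℝ × ℝ) ∈ Set.range f := by rw [hr]; exact hx
        obtain ⟨s, hs⟩ := this
        refine ⟨s, ?_⟩
        simp [hs]
  refine ⟨?_, key⟩
  obtain ⟨f, -, -, -, h⟩ := key
  rw [← h]
  exact Set.range_nonempty f

end QES

theorem qes_real_locus_decomposition (n : ℕ) :
    -- every witnessing polynomial has degree `n`, `n` distinct zeros, and
    -- `n - 2m` real zeros for some `0 ≤ m ≤ n/2`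
    (∀ b lam : ℝ, ∀ p : Polynomial ℂ, QESWitness ((n : ℂ) + 1) b lam p →
      p.natDegree = n ∧ {z : ℂ | p.eval z = 0}.ncard = n ∧
      ∃ m : ℕ, 2 * m ≤ n ∧ {z : ℂ | p.eval z = 0 ∧ z.im = 0}.ncard = n - 2 * m) ∧
    -- the `Γ_{n,m}` are pairwise disjoint
    (∀ m m' : ℕ, m ≤ n / 2 → m' ≤ n / 2 → m ≠ m' →
      Disjoint (qesGamma n m) (qesGamma n m')) ∧
    -- each `Γ_{n,m}` is a properly embedded simple curve
    (∀ m : ℕ, m ≤ n / 2 → (qesGamma n m).Nonempty ∧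
      ∃ f : ℝ → ℝ × ℝ, Continuous f ∧ Function.Injective f ∧
        (∀ K : Set (ℝ × ℝ), IsCompact K → IsCompact (f ⁻¹' K)) ∧
        Set.range f = qesGamma n m) ∧
    -- their union is the whole real QES spectral locus
    (⋃ m ∈ {m : ℕ | m ≤ n / 2}, qesGamma n m) = qesRealLocus ((n : ℂ) + 1) := by
  exact ⟨QES.part1 n, QES.part2 n, QES.part3 n, QES.part4 n⟩
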